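/- arXiv:2211.07020 — 2 statements merged into one kernel-verified Lean document; each statement's English description precedes it below -/
import Mathlib

section
/- For every integer d ≥ 0, the K-vector-space dimension of the degree-d homogeneous component of the ideal I_{n-1}(X) ⊆ R equals C(C(n,2)+d, C(n+1,2)−1) + (n−1)·C(C(n,2)−1+d, C(n+1,2)−2) + C(n,2)·C(C(n,2)−2+d, C(n+1,2)−3), where C(a,b) denotes the binomial coefficient with the convention C(a,b) = 0 whenever a < b (in particular whenever a < 0). -/
open MvPolynomial
open scoped Classical

/-- The polynomial ring `R = K[x_{ij} : 1 ≤ i ≤ j ≤ n]`, realized as the multivariate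
polynomial ring whose variables are indexed by unordered pairs of elements of `Fin n`
(so that `x_{ij} = x_{ji}` automatically). -/
abbrev SymPolyRing (K : Type*) [Field K] (n : ℕ) := MvPolynomial (Sym2 (Fin n)) K


/-- The ideal of `k × k` minors of a square matrix `M` over a commutative ring: it is
generated by the determinants of all `k × k` submatrices of `M` (given by choosing `k`
distinct rows and `k` distinct columns). -/
noncomputable def minorsIdeal {R : Type*} [CommRing R] {n : ℕ} (k : ℕ)
    (M : Matrix (Fin n) (Fin n) R) : Ideal R :=
  Ideal.span { d | ∃ f g : Fin k → Fin n,
    Function.Injective f ∧ Function.Injective g ∧ d = (M.submatrix f g).det }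

/-- The generic symmetric `n × n` matrix `X = (x_{ij})`. -/
noncomputable def genericSym (K : Type*) [Field K] (n : ℕ) :
    Matrix (Fin n) (Fin n) (SymPolyRing K n) :=
  fun i j => MvPolynomial.X s(i, j)

/-- The binomial coefficient `C(a, b)` for integers, with the convention that
`C(a, b) = 0` whenever `a < b` (in particular whenever `a < 0`). -/
def intChoose (a b : ℤ) : ℤ :=
  if a < b then 0 else (a.toNat.choose b.toNat : ℤ)

/-- The dimension over `K` of the degree-`d` homogeneous component of an ideal `J` of
`MvPolynomial σ K`, i.e. of the `K`-subspace of homogeneous polynomials of degree `d`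
lying in `J`. -/
noncomputable def idealComponentDim (K : Type*) [Field K] {σ : Type*}
    (J : Ideal (MvPolynomial σ K)) (d : ℕ) : ℕ :=
  Module.finrank K
    ↥(Submodule.restrictScalars K J ⊓ homogeneousSubmodule σ K d)


namespace SymMinors

variable {K : Type*} [Field K] {m : ℕ}

/-- Weight of a variable: squared distance to the diagonal. -/
def uw (m : ℕ) : Sym2 (Fin (m + 1)) → ℤ :=
  Sym2.lift ⟨fun a b => ((a : ℤ) - (b : ℤ)) ^ 2, fun a b => by ring⟩

@[simp] lemma uw_mk (a b : Fin (m + 1)) : uw m s(a, b) = ((a : ℤ) - (b : ℤ)) ^ 2 := rfl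

/-- Weight of a monomial. -/
noncomputable def V (M : Sym2 (Fin (m + 1)) →₀ ℕ) : ℤ := Finsupp.weight (uw m) M

lemma V_add (M N : Sym2 (Fin (m + 1)) →₀ ℕ) : V (M + N) = V M + V N := by simp [V]

lemma V_single (a b : Fin (m + 1)) :
    V (Finsupp.single s(a, b) 1) = ((a : ℤ) - (b : ℤ)) ^ 2 := by
  simp [V, Finsupp.weight_single]

lemma uw_le (s : Sym2 (Fin (m + 1))) : uw m s ≤ (m : ℤ) ^ 2 := by
  induction s using Sym2.ind with
  | _ a b =>
    rw [uw_mk]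
    have ha := a.2
    have hb := b.2
    apply sq_le_sq'
    · omega
    · omega

lemma V_le (M : Sym2 (Fin (m + 1)) →₀ ℕ) : V M ≤ (M.degree : ℤ) * (m : ℤ) ^ 2 := by
  unfold V
  rw [Finsupp.weight_eq_sum, Finsupp.degree_eq_sum]
  push_cast
  rw [Finset.sum_mul]
  apply Finset.sum_le_sum
  intro s _
  rw [nsmul_eq_mul]
  exact mul_le_mul_of_nonneg_left (uw_le s) (by positivity)

/-- The adjugate of the generic symmetric matrix. -/
noncomputable def A (K : Type*) [Field K] (m : ℕ) :
    Matrix (Fin (m + 1)) (Fin (m + 1)) (SymPolyRing K (m + 1)) :=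
  (genericSym K (m + 1)).adjugate

lemma genericSym_transpose (n : ℕ) : (genericSym K n).transpose = genericSym K n := by
  ext1 i j
  simp [genericSym, Matrix.transpose_apply, Sym2.eq_swap]

lemma A_symm (i j : Fin (m + 1)) : A K m i j = A K m j i := by
  have := Matrix.adjugate_transpose (genericSym K (m + 1))
  rw [genericSym_transpose] at this
  exact (congrFun (congrFun this i) j).symm

lemma rel_sum (a b : Fin (m + 1)) :
    ∑ k, (X s(a, k) : SymPolyRing K (m + 1)) * A K m k b =
      if a = b then (genericSym K (m + 1)).det else 0 := by
  have := congrFun (congrFun (Matrix.mul_adjugate (genericSym K (m + 1))) a) b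
  rw [Matrix.mul_apply, Matrix.smul_apply, Matrix.one_apply] at this
  simpa [A, genericSym] using this

/-- Forbidden variables. -/
noncomputable def forb (i j : Fin (m + 1)) : Finset (Sym2 (Fin (m + 1))) :=
  Finset.univ.filter (fun s => (∃ k : Fin (m + 1), k.val = j.val + 1 ∧ s = s(j, k)) ∨
    (i.val < m ∧ s = s(i, i)))

/-- Spanning elements. -/
noncomputable def bel (K : Type*) [Field K] (M : Sym2 (Fin (m + 1)) →₀ ℕ) (i j : Fin (m + 1)) :
    SymPolyRing K (m + 1) := monomial M 1 * A K m i j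

/-- Span of the allowed elements. -/
noncomputable def B (K : Type*) [Field K] (m : ℕ) : Submodule K (SymPolyRing K (m + 1)) :=
  Submodule.span K {f | ∃ (M : Sym2 (Fin (m + 1)) →₀ ℕ) (i j : Fin (m + 1)),
    i ≤ j ∧ (∀ s ∈ forb i j, M s = 0) ∧ f = bel K M i j}

lemma bel_symm (M : Sym2 (Fin (m + 1)) →₀ ℕ) (i j : Fin (m + 1)) :
    bel K M i j = bel K M j i := by simp [bel, A_symm i j]

lemma split (M : Sym2 (Fin (m + 1)) →₀ ℕ) (s : Sym2 (Fin (m + 1))) (h : M s ≠ 0) :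
    ∃ M', M = M' + Finsupp.single s 1 := by
  refine ⟨M - Finsupp.single s 1, ?_⟩
  rw [tsub_add_cancel_of_le]
  rw [Finsupp.single_le_iff]
  omega

lemma bel_add (M : Sym2 (Fin (m + 1)) →₀ ℕ) (s : Sym2 (Fin (m + 1))) (i j : Fin (m + 1)) :
    bel K (M + Finsupp.single s 1) i j = monomial M 1 * (X s * A K m i j) := by
  rw [bel, MvPolynomial.X, ← mul_assoc, monomial_mul, one_mul]

lemma bel_sum (M : Sym2 (Fin (m + 1)) →₀ ℕ) (a b : Fin (m + 1)) :
    ∑ k, bel K (M + Finsupp.single s(a, k) 1) k b =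
      if a = b then monomial M 1 * (genericSym K (m + 1)).det else 0 := by
  simp_rw [bel_add, ← Finset.mul_sum, rel_sum]
  split_ifs <;> simp

lemma bel_eq (M : Sym2 (Fin (m + 1)) →₀ ℕ) (a b k : Fin (m + 1)) (hab : a ≠ b) :
    bel K (M + Finsupp.single s(a, k) 1) k b =
      - ∑ l ∈ Finset.univ.erase k, bel K (M + Finsupp.single s(a, l) 1) l b := by
  rw [eq_neg_iff_add_eq_zero,
    Finset.add_sum_erase _ (fun l => bel K (M + Finsupp.single s(a, l) 1) l b) (Finset.mem_univ k),
    bel_sum, if_neg hab]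

lemma bel_eq' (M : Sym2 (Fin (m + 1)) →₀ ℕ) (a b : Fin (m + 1)) :
    bel K (M + Finsupp.single s(a, a) 1) a a =
      (∑ l, bel K (M + Finsupp.single s(b, l) 1) l b)
      - ∑ l ∈ Finset.univ.erase a, bel K (M + Finsupp.single s(a, l) 1) l a := by
  rw [eq_sub_iff_add_eq,
    Finset.add_sum_erase _ (fun l => bel K (M + Finsupp.single s(a, l) 1) l a) (Finset.mem_univ a),
    bel_sum, bel_sum, if_pos rfl, if_pos rfl]

lemma key1 (i j k : ℤ) (hij : i ≤ j) (h1 : k ≠ j) (h2 : k ≠ j + 1) :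
    (j + 1 - j) ^ 2 + |j - i| < (j + 1 - k) ^ 2 + |k - i| := by
  rw [abs_of_nonneg (by omega : 0 ≤ j - i)]
  rcases lt_or_gt_of_ne h1 with h | h
  · have := le_abs_self (k - i)
    nlinarith
  · have : j + 1 < k := by omega
    rw [abs_of_nonneg (by omega : 0 ≤ k - i)]
    nlinarith

lemma key2 (i j k : ℤ) (hij : i < j) (h1 : k ≠ i) (h2 : k ≠ i + 1) :
    (i - i) ^ 2 + |i - j| < (i - k) ^ 2 + |k - j| := by
  rw [abs_sub_comm, abs_of_nonneg (by omega : 0 ≤ j - i)]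
  have := neg_le_abs (k - j)
  rcases lt_or_gt_of_ne h1 with h | h
  · nlinarith
  · have : i + 1 < k := by omega
    nlinarith

theorem bel_mem_B (D : ℕ) : ∀ (w t : ℕ) (M : Sym2 (Fin (m + 1)) →₀ ℕ) (i j : Fin (m + 1)),
    M.degree = D → (D : ℤ) * (m : ℤ) ^ 2 + m - V M - |(i : ℤ) - j| = w →
    2 * (m : ℤ) - i - j = t → bel K M i j ∈ B K m := by
  intro w
  induction w using Nat.strong_induction_on with
  | _ w ihw =>
  intro t
  induction t using Nat.strong_induction_on with
  | _ t iht =>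
  -- the general step
  have step : ∀ (M M' : Sym2 (Fin (m + 1)) →₀ ℕ) (i j i' j' : Fin (m + 1)),
      M.degree = D → (D : ℤ) * (m : ℤ) ^ 2 + m - V M - |(i : ℤ) - j| = w →
      2 * (m : ℤ) - i - j = t → M'.degree = M.degree →
      (V M + |(i : ℤ) - j| < V M' + |(i' : ℤ) - j'| ∨
        (V M + |(i : ℤ) - j| = V M' + |(i' : ℤ) - j'| ∧ (i : ℤ) + j < i' + j')) →
      bel K M' i' j' ∈ B K m := by
    intro M M' i j i' j' hD hw ht hdeg h
    have hi := i'.2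
    have hj := j'.2
    have hb : |(i' : ℤ) - j'| ≤ m := by rw [abs_le]; omega
    have hV := V_le M'
    rw [hdeg, hD] at hV
    rcases h with h | ⟨h, h'⟩
    · have h0 : 0 ≤ (D : ℤ) * (m : ℤ) ^ 2 + m - V M' - |(i' : ℤ) - j'| := by linarith
      obtain ⟨w', hw'⟩ := Int.eq_ofNat_of_zero_le h0
      obtain ⟨t', ht'⟩ := Int.eq_ofNat_of_zero_le (by omega : 0 ≤ 2 * (m : ℤ) - i' - j')
      exact ihw w' (by omega) t' M' i' j' (by omega) hw' ht'
    · obtain ⟨t', ht'⟩ := Int.eq_ofNat_of_zero_le (by omega : 0 ≤ 2 * (m : ℤ) - i' - j')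
      exact iht t' (by omega) M' i' j' (by omega) (by omega) ht'
  have main : ∀ (M : Sym2 (Fin (m + 1)) →₀ ℕ) (i j : Fin (m + 1)), i ≤ j →
      M.degree = D → (D : ℤ) * (m : ℤ) ^ 2 + m - V M - |(i : ℤ) - j| = w →
      2 * (m : ℤ) - i - j = t → bel K M i j ∈ B K m := by
    intro M i j hij hD hw ht
    by_cases hall : ∀ s ∈ forb i j, M s = 0
    · exact Submodule.subset_span ⟨M, i, j, hij, hall, rfl⟩
    push Not at hall
    obtain ⟨s, hs, hM⟩ := hall
    obtain ⟨M', rfl⟩ := split M s hM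
    simp only [forb, Finset.mem_filter, Finset.mem_univ, true_and] at hs
    have hij' : (i : ℕ) ≤ j := hij
    rcases hs with ⟨k, hk, rfl⟩ | ⟨hi, rfl⟩
    · have hne : k ≠ i := by
        intro h; rw [h] at hk; omega
      have e := bel_eq (K := K) M' k i j hne
      rw [Sym2.eq_swap, bel_symm, e]
      refine neg_mem (sum_mem fun l hl => ?_)
      have hl' : l ≠ j := (Finset.mem_erase.mp hl).1
      have hlj : (l : ℕ) ≠ j := fun h => hl' (Fin.ext h)
      refine step _ _ i j l i hD hw ht (by simp) ?_
      rw [V_add, V_add, V_single, V_single]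
      have hkz : (k : ℤ) = j + 1 := by exact_mod_cast hk
      by_cases hlk : (l : ℕ) = k
      · right
        have : (l : ℤ) = j + 1 := by omega
        rw [hkz, this, abs_sub_comm, abs_of_nonneg (by omega), abs_of_nonneg (by omega)]
        constructor
        · ring
        · omega
      · left
        have := key1 i j l (by omega) (by omega) (by omega)
        rw [hkz, abs_sub_comm (i : ℤ) j]
        have e2 : ((j : ℤ) - (j + 1)) ^ 2 = (j + 1 - j) ^ 2 := by ring
        rw [e2]
        linarith
    · rcases eq_or_lt_of_le hij with rfl | hlt
      · let b : Fin (m + 1) := ⟨i + 1, by omega⟩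
        have hb : (b : ℤ) = i + 1 := by simp [b]
        rw [bel_eq' M' i b]
        refine sub_mem (sum_mem fun l _ => ?_) (sum_mem fun l hl => ?_)
        · refine step _ _ i i l b hD hw ht (by simp) ?_
          rw [V_add, V_add, V_single, V_single]
          by_cases hlb : (l : ℕ) = b
          · right
            have : (l : ℤ) = b := by exact_mod_cast hlb
            rw [this]
            constructor
            · simp
            · omega
          · left
            have h1 : 0 < |(l : ℤ) - b| := abs_pos.mpr (by omega)
            have h2 := sq_nonneg ((b : ℤ) - l)
            simp only [sub_self, abs_zero]
            linarith
        · have hl' : l ≠ i := (Finset.mem_erase.mp hl).1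
          have hlj : (l : ℕ) ≠ i := fun h => hl' (Fin.ext h)
          refine step _ _ i i l i hD hw ht (by simp) ?_
          rw [V_add, V_add, V_single, V_single]
          left
          have h1 : 0 < |(l : ℤ) - i| := abs_pos.mpr (by omega)
          have h2 := sq_nonneg ((i : ℤ) - l)
          simp only [sub_self, abs_zero]
          linarith
      · have hlt' : (i : ℕ) < j := hlt
        rw [bel_eq (K := K) M' i j i hlt.ne]
        refine neg_mem (sum_mem fun l hl => ?_)
        have hl' : l ≠ i := (Finset.mem_erase.mp hl).1
        have hlj : (l : ℕ) ≠ i := fun h => hl' (Fin.ext h)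
        refine step _ _ i j l j hD hw ht (by simp) ?_
        rw [V_add, V_add, V_single, V_single]
        by_cases hlk : (l : ℕ) = i + 1
        · right
          have : (l : ℤ) = i + 1 := by exact_mod_cast hlk
          rw [this, abs_of_nonpos (by omega), abs_of_nonpos (by omega)]
          constructor
          · ring
          · omega
        · left
          have := key2 i j l (by omega) (by omega) (by omega)
          linarith
  intro M i j hD hw ht
  rcases le_total i j with h | h
  · exact main M i j h hD hw ht
  · rw [bel_symm]
    exact main M j i h hD (by rw [abs_sub_comm]; exact hw) (by omega)

theorem bel_mem (M : Sym2 (Fin (m + 1)) →₀ ℕ) (i j : Fin (m + 1)) : bel K M i j ∈ B K m := by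
  have hi := i.2
  have hj := j.2
  have hb : |(i : ℤ) - j| ≤ m := by rw [abs_le]; omega
  have hV := V_le M
  obtain ⟨w', hw'⟩ := Int.eq_ofNat_of_zero_le
    (by linarith : 0 ≤ (M.degree : ℤ) * (m : ℤ) ^ 2 + m - V M - |(i : ℤ) - j|)
  obtain ⟨t', ht'⟩ := Int.eq_ofNat_of_zero_le (by omega : 0 ≤ 2 * (m : ℤ) - i - j)
  exact bel_mem_B _ w' t' M i j rfl hw' ht'

lemma exists_succAbove_perm (f : Fin m → Fin (m + 1)) (hf : Function.Injective f) :
    ∃ (i : Fin (m + 1)) (σ : Equiv.Perm (Fin m)), f = i.succAbove ∘ σ := by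
  have hns : ¬ Function.Surjective f := by
    intro h
    have := Fintype.card_le_of_surjective f h
    simp at this
  rw [Function.Surjective] at hns
  push Not at hns
  obtain ⟨i, hi⟩ := hns
  have h : ∀ k, ∃ l, i.succAbove l = f k := fun k => Fin.exists_succAbove_eq (hi k)
  choose σ hσ using h
  have hinj : Function.Injective σ := by
    intro a b hab
    apply hf
    rw [← hσ, ← hσ, hab]
  refine ⟨i, Equiv.ofBijective σ (Finite.injective_iff_bijective.mp hinj), ?_⟩
  ext1 k
  simp [hσ]

/-- The `(i,j)` submaximal minor. -/
noncomputable def Dm (K : Type*) [Field K] (i j : Fin (m + 1)) : SymPolyRing K (m + 1) :=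
  ((genericSym K (m + 1)).submatrix i.succAbove j.succAbove).det

lemma A_eq (i j : Fin (m + 1)) : A K m i j = (-1) ^ (i + j : ℕ) * Dm K i j := by
  rw [A_symm, A, Matrix.adjugate_fin_succ_eq_det_submatrix, Dm]

lemma Dm_eq (i j : Fin (m + 1)) : Dm K i j = (-1) ^ (i + j : ℕ) * A K m i j := by
  rw [A_eq, ← mul_assoc, ← mul_pow]; simp

lemma minor_eq (f g : Fin m → Fin (m + 1)) (hf : Function.Injective f)
    (hg : Function.Injective g) : ∃ (i j : Fin (m + 1)) (p : SymPolyRing K (m + 1)),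
      ((genericSym K (m + 1)).submatrix f g).det = p * A K m i j := by
  obtain ⟨i, σ, rfl⟩ := exists_succAbove_perm f hf
  obtain ⟨j, τ, rfl⟩ := exists_succAbove_perm g hg
  have h1 := Matrix.det_permute σ
    ((genericSym K (m + 1)).submatrix i.succAbove (j.succAbove ∘ τ))
  have h2 := Matrix.det_permute' τ
    ((genericSym K (m + 1)).submatrix i.succAbove j.succAbove)
  rw [Matrix.submatrix_submatrix] at h1 h2
  simp only [Function.comp_id] at h1 h2
  rw [h1, h2]
  refine ⟨i, j, Equiv.Perm.sign σ * (Equiv.Perm.sign τ * (-1) ^ (i + j : ℕ)), ?_⟩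
  change _ * (_ * Dm K i j) = _
  rw [Dm_eq]
  ring

lemma mul_A_mem (p : SymPolyRing K (m + 1)) (i j : Fin (m + 1)) : p * A K m i j ∈ B K m := by
  rw [p.as_sum, Finset.sum_mul]
  refine sum_mem fun M _ => ?_
  have : monomial M (coeff M p) * A K m i j = coeff M p • bel K M i j := by
    rw [bel, ← smul_mul_assoc, smul_monomial, smul_eq_mul, mul_one]
  rw [this]
  exact Submodule.smul_mem _ _ (bel_mem M i j)

lemma ideal_eq_B :
    Submodule.restrictScalars K (minorsIdeal m (genericSym K (m + 1))) = B K m := by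
  apply le_antisymm
  · intro f hf
    rw [Submodule.restrictScalars_mem] at hf
    have key : ∀ p : SymPolyRing K (m + 1), p * f ∈ B K m := by
      unfold minorsIdeal at hf
      induction hf using Submodule.span_induction with
      | mem x hx =>
        obtain ⟨f, g, hf, hg, rfl⟩ := hx
        obtain ⟨i, j, q, hq⟩ := minor_eq (K := K) f g hf hg
        intro p
        rw [hq, ← mul_assoc]
        exact mul_A_mem _ i j
      | zero => intro p; simp
      | add x y _ _ hx hy => intro p; rw [mul_add]; exact add_mem (hx p) (hy p)
      | smul a x _ hx => intro p; rw [smul_eq_mul, ← mul_assoc]; exact hx _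
    simpa using key 1
  · refine Submodule.span_le.mpr ?_
    rintro _ ⟨M, i, j, -, -, rfl⟩
    change bel K M i j ∈ minorsIdeal m (genericSym K (m + 1))
    rw [bel, A_eq]
    refine Ideal.mul_mem_left _ _ (Ideal.mul_mem_left _ _ (Ideal.subset_span ?_))
    exact ⟨_, _, Fin.succAbove_right_injective, Fin.succAbove_right_injective, rfl⟩

/-- Exponent of the term of the minor attached to a permutation. -/
noncomputable def mon (i j : Fin (m + 1)) (σ : Equiv.Perm (Fin m)) : Sym2 (Fin (m + 1)) →₀ ℕ :=
  ∑ k, Finsupp.single s(i.succAbove (σ k), j.succAbove k) 1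

lemma Dm_sum (i j : Fin (m + 1)) :
    Dm K i j = ∑ σ : Equiv.Perm (Fin m), Equiv.Perm.sign σ • monomial (mon i j σ) (1 : K) := by
  rw [Dm, Matrix.det_apply]
  refine Finset.sum_congr rfl fun σ _ => ?_
  congr 1
  rw [mon, monomial_sum_one]
  rfl

lemma V_mon (i j : Fin (m + 1)) (σ : Equiv.Perm (Fin m)) :
    V (mon i j σ) = ∑ k, ((i.succAbove (σ k) : ℤ) - (j.succAbove k : ℤ)) ^ 2 := by
  have : V (mon i j σ) = ∑ k, V (Finsupp.single s(i.succAbove (σ k), j.succAbove k) 1) := by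
    simp only [V, mon, map_sum]
  rw [this]
  simp only [V_single]

lemma perm_eq_one (σ : Equiv.Perm (Fin m)) (h : Monotone σ) : σ = 1 := by
  have hs : StrictMono σ := h.strictMono_of_injective σ.injective
  have h1 : Set.range σ = Set.range (id : Fin m → Fin m) := by simp
  have := StrictMono.range_inj hs strictMono_id |>.mp h1
  ext k
  rw [this]; rfl

lemma V_mon_lt (i j : Fin (m + 1)) (σ : Equiv.Perm (Fin m)) (hσ : σ ≠ 1) :
    V (mon i j 1) < V (mon i j σ) := by
  rw [V_mon, V_mon]
  set a : Fin m → ℤ := fun k => (i.succAbove k : ℤ) with ha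
  set b : Fin m → ℤ := fun k => (j.succAbove k : ℤ) with hb
  have sa : StrictMono a := by
    intro x y hxy
    have := Fin.strictMono_succAbove i hxy
    simp only [ha]; exact_mod_cast this
  have sb : StrictMono b := by
    intro x y hxy
    have := Fin.strictMono_succAbove j hxy
    simp only [hb]; exact_mod_cast this
  have hm : Monovary a b := sa.monotone.monovary sb.monotone
  have hlt : ∑ k, a (σ k) * b k < ∑ k, a k * b k := by
    rw [hm.sum_comp_perm_mul_lt_sum_mul_iff]
    intro hmv
    apply hσ
    apply perm_eq_one
    intro x y hxy
    rcases eq_or_lt_of_le hxy with rfl | hlt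
    · exact le_rfl
    · exact sa.le_iff_le.mp (hmv (sb hlt))
  have hperm : ∑ k, a (σ k) ^ 2 = ∑ k, a k ^ 2 := Equiv.sum_comp σ (fun k => a k ^ 2)
  have e : ∀ τ : Equiv.Perm (Fin m), ∑ k, (a (τ k) - b k) ^ 2 =
      ∑ k, a (τ k) ^ 2 + ∑ k, b k ^ 2 - 2 * ∑ k, a (τ k) * b k := by
    intro τ
    rw [Finset.mul_sum, ← Finset.sum_add_distrib, ← Finset.sum_sub_distrib]
    exact Finset.sum_congr rfl fun k _ => by ring
  change ∑ k, (a ((1 : Equiv.Perm (Fin m)) k) - b k) ^ 2 < ∑ k, (a (σ k) - b k) ^ 2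
  rw [e, e, hperm]
  simp only [Equiv.Perm.coe_one, id_eq]
  linarith

lemma coeff_Dm (i j : Fin (m + 1)) (N : Sym2 (Fin (m + 1)) →₀ ℕ) :
    coeff N (Dm K i j) = ∑ σ : Equiv.Perm (Fin m),
      Equiv.Perm.sign σ • (if mon i j σ = N then (1 : K) else 0) := by
  rw [Dm_sum, coeff_sum]
  refine Finset.sum_congr rfl fun σ _ => ?_
  rcases Int.units_eq_one_or (Equiv.Perm.sign σ) with h | h <;> rw [h]
  · simp [coeff_monomial]
  · simp only [Units.neg_smul, one_smul, coeff_neg, coeff_monomial]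

lemma coeff_Dm_lm (i j : Fin (m + 1)) : coeff (mon i j 1) (Dm K i j) = 1 := by
  rw [coeff_Dm, Finset.sum_eq_single 1]
  · simp
  · intro σ _ hσ
    rw [if_neg, smul_zero]
    intro h
    have := V_mon_lt i j σ hσ
    rw [h] at this
    exact lt_irrefl _ this
  · simp

lemma coeff_Dm_ne (i j : Fin (m + 1)) (N : Sym2 (Fin (m + 1)) →₀ ℕ)
    (h : coeff N (Dm K i j) ≠ 0) : N = mon i j 1 ∨ V (mon i j 1) < V N := by
  rw [coeff_Dm] at h
  obtain ⟨σ, -, hσ⟩ := Finset.exists_ne_zero_of_sum_ne_zero h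
  have hN : mon i j σ = N := by
    by_contra hne
    rw [if_neg hne, smul_zero] at hσ
    exact hσ rfl
  by_cases h1 : σ = 1
  · left; rw [← hN, h1]
  · right; rw [← hN]; exact V_mon_lt i j σ h1

lemma coeff_A (i j : Fin (m + 1)) (N : Sym2 (Fin (m + 1)) →₀ ℕ) :
    coeff N (A K m i j) = (-1) ^ (i + j : ℕ) * coeff N (Dm K i j) := by
  rw [A_eq]
  have : ((-1) ^ (i + j : ℕ) : SymPolyRing K (m + 1)) = C ((-1) ^ (i + j : ℕ)) := by simp
  rw [this, coeff_C_mul]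

lemma coeff_bel_lm (M : Sym2 (Fin (m + 1)) →₀ ℕ) (i j : Fin (m + 1)) :
    coeff (M + mon i j 1) (bel K M i j) ≠ 0 := by
  rw [bel, coeff_monomial_mul, coeff_A, coeff_Dm_lm]
  simp

lemma coeff_bel_ne (M : Sym2 (Fin (m + 1)) →₀ ℕ) (i j : Fin (m + 1))
    (N : Sym2 (Fin (m + 1)) →₀ ℕ) (h : coeff N (bel K M i j) ≠ 0) :
    N = M + mon i j 1 ∨ V (M + mon i j 1) < V N := by
  rw [bel, coeff_monomial_mul'] at h
  split_ifs at h with hM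
  · obtain ⟨N', rfl⟩ := exists_add_of_le hM
    rw [add_tsub_cancel_left, coeff_A] at h
    have h' : coeff N' (Dm K i j) ≠ 0 := fun h0 => h (by rw [h0]; simp)
    rcases coeff_Dm_ne i j N' h' with rfl | h'
    · left; rfl
    · right; rw [V_add, V_add]; linarith
  · exact absurd rfl h

lemma mon_degree (i j : Fin (m + 1)) (σ : Equiv.Perm (Fin m)) : (mon i j σ).degree = m := by
  simp [mon, map_sum]

lemma bel_homog (M : Sym2 (Fin (m + 1)) →₀ ℕ) (i j : Fin (m + 1)) :
    (bel K M i j).IsHomogeneous (M.degree + m) := by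
  rw [bel]
  refine (isHomogeneous_monomial 1 rfl).mul ?_
  rw [A_eq]
  have : ((-1) ^ (i + j : ℕ) : SymPolyRing K (m + 1)) = C ((-1) ^ (i + j : ℕ)) := by simp
  rw [this]
  refine IsHomogeneous.C_mul ?_ _
  rw [Dm_sum]
  refine IsHomogeneous.sum _ _ _ fun σ _ => ?_
  have hh : (monomial (mon i j σ) (1 : K)).IsHomogeneous m :=
    isHomogeneous_monomial 1 (mon_degree i j σ)
  rcases Int.units_eq_one_or (Equiv.Perm.sign σ) with h | h <;> rw [h]
  · simpa using hh
  · simpa using hh.neg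

lemma linInd_of_lead {ι σ : Type*} (f : ι → MvPolynomial σ K) (l : ι → σ →₀ ℕ)
    (v : (σ →₀ ℕ) → ℤ) (hl : Function.Injective l) (h1 : ∀ a, coeff (l a) (f a) ≠ 0)
    (h2 : ∀ a N, coeff N (f a) ≠ 0 → N = l a ∨ v (l a) < v N) : LinearIndependent K f := by
  rw [linearIndependent_iff']
  intro s g hg
  by_contra hne
  push Not at hne
  obtain ⟨i, hi, hgi⟩ := hne
  obtain ⟨a, ha, hmin⟩ := (s.filter fun a => g a ≠ 0).exists_min_image (fun a => v (l a))
    ⟨i, by simp [hi, hgi]⟩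
  rw [Finset.mem_filter] at ha
  have := congrArg (coeff (l a)) hg
  rw [coeff_sum, Finset.sum_eq_single a] at this
  · rw [coeff_smul, coeff_zero, smul_eq_mul] at this
    exact (mul_ne_zero ha.2 (h1 a)) this
  · intro b hb hba
    rw [coeff_smul, smul_eq_mul]
    by_contra hne
    have hgb : g b ≠ 0 := left_ne_zero_of_mul hne
    rcases h2 b _ (right_ne_zero_of_mul hne) with h | h
    · exact hba (hl h.symm)
    · exact absurd (hmin b (by simp [hb, hgb])) (not_le.mpr h)
  · intro h; exact absurd ha.1 h

lemma mon_apply (i j : Fin (m + 1)) (s : Sym2 (Fin (m + 1))) :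
    mon i j 1 s = ∑ k : Fin m, if s(i.succAbove k, j.succAbove k) = s then 1 else 0 := by
  simp [mon, Finsupp.finsetSum_apply, Finsupp.single_apply]

lemma sA_val (i : Fin (m + 1)) (k : Fin m) :
    (i.succAbove k : ℕ) = if (k : ℕ) < i then (k : ℕ) else k + 1 := by
  rw [Fin.succAbove]
  simp only [Fin.lt_def, Fin.val_castSucc]
  split_ifs <;> simp

lemma mon_diag (i j : Fin (m + 1)) : mon i j 1 s(i, i) = 0 := by
  rw [mon_apply]
  refine Finset.sum_eq_zero fun k _ => if_neg fun h => ?_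
  have := Fin.succAbove_ne i k
  simp only [Sym2.eq_iff] at h
  tauto

lemma mon_off (i j l : Fin (m + 1)) (hij : i ≤ j) (hl : l.val = j.val + 1) :
    mon i j 1 s(j, l) = 0 := by
  rw [mon_apply]
  refine Finset.sum_eq_zero fun k _ => if_neg fun h => ?_
  have hij' : (i : ℕ) ≤ j := hij
  have h1 := sA_val i k
  have h2 := sA_val j k
  simp only [Sym2.eq_iff, Fin.ext_iff] at h
  split_ifs at h1 h2 <;> omega

lemma mon_pos (i j : Fin (m + 1)) (s : Sym2 (Fin (m + 1))) (k : Fin m)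
    (h : s(i.succAbove k, j.succAbove k) = s) : 0 < mon i j 1 s := by
  rw [mon_apply]
  refine Finset.sum_pos' (fun _ _ => by positivity) ⟨k, Finset.mem_univ k, ?_⟩
  rw [if_pos h]; exact one_pos

lemma lead_inj_i (M M' : Sym2 (Fin (m + 1)) →₀ ℕ) (i j i' j' : Fin (m + 1))
    (hij' : i' ≤ j') (hM : ∀ s ∈ forb i j, M s = 0)
    (h : M + mon i j 1 = M' + mon i' j' 1) : i' ≤ i := by
  by_contra hlt
  have hlt' : (i : ℕ) < i' := Fin.lt_def.mp (not_le.mp hlt)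
  have h3 : (i' : ℕ) ≤ j' := hij'
  have hi := i'.2
  have h1 := DFunLike.congr_fun h s(i, i)
  rw [Finsupp.add_apply, Finsupp.add_apply, mon_diag,
    hM s(i, i) (by simp [forb]; right; omega)] at h1
  have := mon_pos i' j' s(i, i) ⟨i, by omega⟩ (by
    have e1 : i'.succAbove ⟨i, by omega⟩ = i := by
      apply Fin.ext; rw [sA_val, if_pos hlt']
    have e2 : j'.succAbove ⟨i, by omega⟩ = i := by
      apply Fin.ext; rw [sA_val, if_pos (lt_of_lt_of_le hlt' h3)]
    rw [e1, e2])
  omega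

lemma lead_inj_j (M M' : Sym2 (Fin (m + 1)) →₀ ℕ) (i j j' : Fin (m + 1))
    (hij : i ≤ j) (hM : ∀ s ∈ forb i j, M s = 0)
    (h : M + mon i j 1 = M' + mon i j' 1) : j' ≤ j := by
  by_contra hlt
  have hlt' : (j : ℕ) < j' := Fin.lt_def.mp (not_le.mp hlt)
  have h3 : (i : ℕ) ≤ j := hij
  have hi := j'.2
  have h1 := DFunLike.congr_fun h s(j, ⟨j + 1, by omega⟩)
  rw [Finsupp.add_apply, Finsupp.add_apply, mon_off i j _ hij rfl,
    hM s(j, ⟨j + 1, by omega⟩) (by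
      simp only [forb, Finset.mem_filter, Finset.mem_univ, true_and]
      exact Or.inl ⟨_, rfl, rfl⟩)] at h1
  have := mon_pos i j' s(j, ⟨j + 1, by omega⟩) ⟨j, by omega⟩ (by
    have e1 : i.succAbove ⟨j, by omega⟩ = ⟨j + 1, by omega⟩ := by
      apply Fin.ext; rw [sA_val, if_neg (not_lt.mpr h3)]
    have e2 : j'.succAbove ⟨j, by omega⟩ = j := by
      apply Fin.ext; rw [sA_val, if_pos hlt']
    rw [e1, e2, Sym2.eq_swap])
  omega

lemma lead_inj (M M' : Sym2 (Fin (m + 1)) →₀ ℕ) (i j i' j' : Fin (m + 1))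
    (hij : i ≤ j) (hij' : i' ≤ j') (hM : ∀ s ∈ forb i j, M s = 0)
    (hM' : ∀ s ∈ forb i' j', M' s = 0)
    (h : M + mon i j 1 = M' + mon i' j' 1) : i = i' ∧ j = j' ∧ M = M' := by
  obtain rfl : i = i' := le_antisymm (lead_inj_i M' M i' j' i j hij hM' h.symm)
    (lead_inj_i M M' i j i' j' hij' hM h)
  obtain rfl : j = j' := le_antisymm (lead_inj_j M' M i j' j hij' hM' h.symm)
    (lead_inj_j M M' i j j' hij hM h)
  exact ⟨rfl, rfl, add_right_cancel h⟩

/-- Index set of the basis in degree `e + m`. -/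
noncomputable def T (m e : ℕ) :
    Finset (Σ _ : Fin (m + 1) × Fin (m + 1), Sym2 (Fin (m + 1)) →₀ ℕ) :=
  ((Finset.univ : Finset (Fin (m + 1) × Fin (m + 1))).filter (fun p => p.1 ≤ p.2)).sigma
    (fun p => (Finset.univ \ forb p.1 p.2).finsuppAntidiag e)

lemma mem_T (e : ℕ) (x : Σ _ : Fin (m + 1) × Fin (m + 1), Sym2 (Fin (m + 1)) →₀ ℕ) :
    x ∈ T m e ↔ x.1.1 ≤ x.1.2 ∧ (∀ s ∈ forb x.1.1 x.1.2, x.2 s = 0) ∧ x.2.degree = e := by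
  rw [T, Finset.mem_sigma, Finset.mem_filter, Finset.mem_finsuppAntidiag']
  simp only [Finset.mem_univ, true_and]
  have h1 : (x.2.support ⊆ Finset.univ \ forb x.1.1 x.1.2) ↔
      ∀ s ∈ forb x.1.1 x.1.2, x.2 s = 0 := by
    simp only [Finset.subset_iff, Finsupp.mem_support_iff, Finset.mem_sdiff, Finset.mem_univ,
      true_and]
    exact forall_congr' fun s => by tauto
  have h2 : (x.2.sum fun _ x => x) = x.2.degree := rfl
  rw [h1, h2]
  tauto

lemma comp_eq_span (e : ℕ) :
    B K m ⊓ homogeneousSubmodule (Sym2 (Fin (m + 1))) K (e + m) =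
      Submodule.span K (Set.range fun x : T m e => bel K x.1.2 x.1.1.1 x.1.1.2) := by
  apply le_antisymm
  · rintro f ⟨hf, hd⟩
    have h1 : homogeneousComponent (e + m) f = f := by
      have := homogeneousComponent_of_mem (n := e + m) (m := e + m) hd
      simpa using this
    rw [← h1]
    have h2 : homogeneousComponent (e + m) f ∈ (B K m).map (homogeneousComponent (e + m)) :=
      Submodule.mem_map_of_mem hf
    rw [B, Submodule.map_span] at h2
    refine (Submodule.span_le.mpr ?_) h2
    rintro _ ⟨_, ⟨M, i, j, hij, hM, rfl⟩, rfl⟩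
    rw [homogeneousComponent_of_mem (bel_homog M i j)]
    split_ifs with h
    · refine Submodule.subset_span ⟨⟨⟨(i, j), M⟩, (mem_T _ _).mpr ⟨hij, hM, ?_⟩⟩, rfl⟩
      simp only
      omega
    · exact Submodule.zero_mem _
  · refine Submodule.span_le.mpr ?_
    rintro _ ⟨⟨x, hx⟩, rfl⟩
    obtain ⟨h1, h2, h3⟩ := (mem_T _ _).mp hx
    refine ⟨Submodule.subset_span ⟨_, _, _, h1, h2, rfl⟩, ?_⟩
    have := bel_homog (K := K) x.2 x.1.1 x.1.2
    rw [h3] at this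
    exact this

lemma linInd (e : ℕ) :
    LinearIndependent K (fun x : T m e => bel K x.1.2 x.1.1.1 x.1.1.2) := by
  refine linInd_of_lead _ (fun x => x.1.2 + mon x.1.1.1 x.1.1.2 1) V ?_ ?_ ?_
  · rintro ⟨⟨⟨i, j⟩, M⟩, hx⟩ ⟨⟨⟨i', j'⟩, M'⟩, hy⟩ h
    obtain ⟨h1, h2, h3⟩ := (mem_T _ _).mp hx
    obtain ⟨h1', h2', h3'⟩ := (mem_T _ _).mp hy
    obtain ⟨rfl, rfl, rfl⟩ := lead_inj _ _ _ _ _ _ h1 h1' h2 h2' h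
    rfl
  · intro x; exact coeff_bel_lm _ _ _
  · intro x N h; exact coeff_bel_ne _ _ _ _ h

lemma dim_eq_card (e : ℕ) :
    idealComponentDim K (minorsIdeal m (genericSym K (m + 1))) (e + m) = (T m e).card := by
  rw [idealComponentDim, ideal_eq_B, comp_eq_span, finrank_span_eq_card (linInd e)]
  simp

lemma dim_small (d : ℕ) (hd : d < m) :
    idealComponentDim K (minorsIdeal m (genericSym K (m + 1))) d = 0 := by
  rw [idealComponentDim, ideal_eq_B]
  have : B K m ⊓ homogeneousSubmodule (Sym2 (Fin (m + 1))) K d = ⊥ := by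
    rw [eq_bot_iff]
    rintro f ⟨hf, hd'⟩
    have h1 : homogeneousComponent d f = f := by
      have := homogeneousComponent_of_mem (n := d) (m := d) hd'
      simpa using this
    rw [← h1]
    have h2 : homogeneousComponent d f ∈ (B K m).map (homogeneousComponent d) :=
      Submodule.mem_map_of_mem hf
    rw [B, Submodule.map_span] at h2
    refine (Submodule.span_le.mpr ?_) h2
    rintro _ ⟨_, ⟨M, i, j, hij, hM, rfl⟩, rfl⟩
    rw [homogeneousComponent_of_mem (bel_homog M i j), if_neg (by omega)]
    exact Submodule.zero_mem _
  rw [this, finrank_bot]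

lemma forb_card_last : (forb (Fin.last m) (Fin.last m)).card = 0 := by
  rw [Finset.card_eq_zero, forb, Finset.filter_eq_empty_iff]
  rintro s - (⟨k, hk, -⟩ | ⟨h, -⟩)
  · have := k.2
    simp at hk
    omega
  · simp at h

lemma forb_card_one (i : Fin m) : (forb i.castSucc (Fin.last m)).card = 1 := by
  rw [Finset.card_eq_one]
  refine ⟨s(i.castSucc, i.castSucc), ?_⟩
  ext s
  simp only [forb, Finset.mem_filter, Finset.mem_univ, true_and, Finset.mem_singleton]
  constructor
  · rintro (⟨k, hk, -⟩ | ⟨_, h⟩)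
    · have := k.2
      simp at hk
      omega
    · exact h
  · intro h
    exact Or.inr ⟨i.2, h⟩

lemma forb_card_two (i : Fin (m + 1)) (j : Fin m) (hij : i ≤ j.castSucc) :
    (forb i j.castSucc).card = 2 := by
  have hij' : (i : ℕ) ≤ j := hij
  have := j.2
  rw [Finset.card_eq_two]
  refine ⟨s(j.castSucc, j.succ), s(i, i), ?_, ?_⟩
  · intro h
    simp only [Sym2.eq_iff, Fin.ext_iff, Fin.val_castSucc, Fin.val_succ] at h
    omega
  ext s
  simp only [forb, Finset.mem_filter, Finset.mem_univ, true_and, Finset.mem_singleton,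
    Finset.mem_insert]
  constructor
  · rintro (⟨k, hk, h⟩ | ⟨_, h⟩)
    · left
      rw [h]
      have : k = j.succ := Fin.ext (by simpa using hk)
      rw [this]
    · exact Or.inr h
  · rintro (h | h)
    · exact Or.inl ⟨j.succ, by simp, h⟩
    · exact Or.inr ⟨by omega, h⟩

lemma card_compl (i j : Fin (m + 1)) (e c : ℕ) (hc : (forb i j).card = c) :
    ((Finset.univ \ forb i j).finsuppAntidiag e).card =
      ((m + 2).choose 2 - c).multichoose e := by
  rw [Finset.card_finsuppAntidiag_nat_eq_multichoose, Finset.card_sdiff_of_subset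
    (Finset.subset_univ _), hc, Finset.card_univ, Sym2.card, Fintype.card_fin]

lemma card_T (e : ℕ) : (T m e).card = ((m + 2).choose 2).multichoose e +
    m * ((m + 2).choose 2 - 1).multichoose e +
    (m + 1).choose 2 * ((m + 2).choose 2 - 2).multichoose e := by
  rw [T, Finset.card_sigma, Finset.sum_filter, Fintype.sum_prod_type_right, Fin.sum_univ_castSucc]
  have h1 : ∑ i : Fin (m + 1), (if i ≤ Fin.last m then
      ((Finset.univ \ forb i (Fin.last m)).finsuppAntidiag e).card else 0) =
      m * ((m + 2).choose 2 - 1).multichoose e + ((m + 2).choose 2).multichoose e := by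
    rw [Fin.sum_univ_castSucc, if_pos le_rfl, card_compl _ _ e 0 forb_card_last]
    congr 1
    rw [Finset.sum_congr rfl (g := fun _ => ((m + 2).choose 2 - 1).multichoose e)]
    · simp
    · intro i _
      rw [if_pos (Fin.le_last _), card_compl _ _ e 1 (forb_card_one i)]
  have h2 : ∀ j : Fin m, ∑ i : Fin (m + 1), (if i ≤ j.castSucc then
      ((Finset.univ \ forb i j.castSucc).finsuppAntidiag e).card else 0) =
      (j + 1) * ((m + 2).choose 2 - 2).multichoose e := by
    intro j
    rw [← Finset.sum_filter, Finset.sum_congr rfl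
      (g := fun _ => ((m + 2).choose 2 - 2).multichoose e)]
    · rw [Finset.sum_const, smul_eq_mul]
      congr 1
      have : (Finset.univ.filter fun i : Fin (m + 1) => i ≤ j.castSucc) =
          Finset.Iic j.castSucc := by ext; simp
      rw [this, Fin.card_Iic]
      simp
    · intro i hi
      exact card_compl _ _ e 2 (forb_card_two i j (Finset.mem_filter.mp hi).2)
  have h3 : ∑ j : Fin m, ((j : ℕ) + 1) = (m + 1).choose 2 := by
    rw [Fin.sum_univ_eq_sum_range (fun j => j + 1) m]
    have := Finset.sum_range_succ' (fun j => j) m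
    rw [add_zero] at this
    rw [← this, Finset.sum_range_id, Nat.choose_two_right]
  simp only at h1 ⊢
  rw [h1, Finset.sum_congr rfl (fun j _ => h2 j), ← Finset.sum_mul, h3]
  ring

lemma intChoose_eq (a b : ℤ) (N e : ℕ) (hN : 1 ≤ N) (hb : b = N - 1) (ha : a = N - 1 + e) :
    intChoose a b = N.multichoose e := by
  subst ha hb
  rw [intChoose, if_neg (by omega), Nat.multichoose_eq]
  have h1 : ((N : ℤ) - 1 + e).toNat = N + e - 1 := by omega
  have h2 : ((N : ℤ) - 1).toNat = N - 1 := by omega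
  rw [h1, h2]
  congr 1
  have : N + e - 1 = (N - 1) + e := by omega
  rw [this, Nat.choose_symm_add]

theorem final (K : Type*) [Field K] (m : ℕ) (hm : 1 ≤ m) (d : ℕ) :
    (idealComponentDim K (minorsIdeal m (genericSym K (m + 1))) d : ℤ) =
      intChoose ((Nat.choose (m + 1) 2 : ℤ) + d) ((Nat.choose (m + 2) 2 : ℤ) - 1)
        + (m : ℤ) *
            intChoose ((Nat.choose (m + 1) 2 : ℤ) - 1 + d) ((Nat.choose (m + 2) 2 : ℤ) - 2)
        + (Nat.choose (m + 1) 2 : ℤ) *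
            intChoose ((Nat.choose (m + 1) 2 : ℤ) - 2 + d)
              ((Nat.choose (m + 2) 2 : ℤ) - 3) := by
  have hc : (m + 2).choose 2 = (m + 1) + (m + 1).choose 2 := by
    rw [Nat.choose_succ_succ' (m + 1) 1, Nat.choose_one_right]
  have hpos : 1 ≤ (m + 1).choose 2 := Nat.choose_pos (by omega)
  rcases lt_or_ge d m with hd | hd
  · rw [dim_small d hd]
    simp only [intChoose]
    rw [if_pos (by omega), if_pos (by omega), if_pos (by omega)]
    simp
  · obtain ⟨e, rfl⟩ := Nat.exists_eq_add_of_le' hd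
    rw [dim_eq_card, card_T]
    rw [intChoose_eq _ _ ((m + 2).choose 2) e (by omega) (by omega) (by omega),
      intChoose_eq _ _ ((m + 2).choose 2 - 1) e (by omega) (by omega) (by omega),
      intChoose_eq _ _ ((m + 2).choose 2 - 2) e (by omega) (by omega) (by omega)]
    push_cast
    ring

end SymMinors

/-- The Hilbert function of the ideal `I_{n-1}(X)` of submaximal minors of the generic
symmetric `n × n` matrix: for every `d ≥ 0`, the `K`-dimension of its degree-`d` component
equals `C(C(n,2)+d, C(n+1,2)−1) + (n−1)·C(C(n,2)−1+d, C(n+1,2)−2)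
 + C(n,2)·C(C(n,2)−2+d, C(n+1,2)−3)`. -/
theorem hilbertFunction_submaximalMinors_generic_symmetric
    (K : Type*) [Field K] (n : ℕ) (hn : 2 ≤ n) (d : ℕ) :
    (idealComponentDim K (minorsIdeal (n - 1) (genericSym K n)) d : ℤ) =
      intChoose ((Nat.choose n 2 : ℤ) + d) ((Nat.choose (n + 1) 2 : ℤ) - 1)
        + ((n : ℤ) - 1) * intChoose ((Nat.choose n 2 : ℤ) - 1 + d) ((Nat.choose (n + 1) 2 : ℤ) - 2)
        + (Nat.choose n 2 : ℤ) *
            intChoose ((Nat.choose n 2 : ℤ) - 2 + d) ((Nat.choose (n + 1) 2 : ℤ) - 3) := by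
  obtain ⟨m, rfl⟩ : ∃ m, n = m + 1 := ⟨n - 1, by omega⟩
  have h := SymMinors.final K m (by omega) d
  have e : ((m + 1 : ℕ) : ℤ) - 1 = m := by push_cast; ring
  rw [e]
  exact h
end

section
/- Let G be a simple graph on [n] and T a spanning forest of G (a union of one spanning tree of each connected component of G). Then the iterated initial ideal of I_{n-1}(X) with respect to the weight vectors w_G, then w_T, then w_diag equals I_T; that is, in_{w_diag}(in_{w_T}(in_{w_G}(I_{n-1}(X)))) = I_T. Equivalently, the (n-1)-minors of X form a Gröbner basis of I_{n-1}(X) with respect to the weight order <_{T,G} := <_{w_diag} ∘ <_{w_T} ∘ <_{w_G}. -/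
open MvPolynomial
open scoped Classical

/-- The weight of a monomial (exponent vector) `m` with respect to a weight vector `w`. -/
def monWeight {σ : Type*} (w : σ → ℕ) (m : σ →₀ ℕ) : ℕ :=
  m.sum fun s e => e * w s

/-- The maximal `w`-weight of a monomial occurring in the polynomial `f`. -/
noncomputable def topWeight {σ : Type*} {K : Type*} [Field K] (w : σ → ℕ)
    (f : MvPolynomial σ K) : ℕ :=
  f.support.sup (monWeight w)

/-- The initial form `in_w(f)` of a polynomial `f` with respect to a weight vector `w`:
the sum of all terms of `f` of maximal `w`-weight. -/
noncomputable def initialForm {σ : Type*} {K : Type*} [Field K] (w : σ → ℕ)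
    (f : MvPolynomial σ K) : MvPolynomial σ K :=
  ∑ m ∈ f.support.filter (fun m => monWeight w m = topWeight w f),
    MvPolynomial.monomial m (MvPolynomial.coeff m f)

/-- The initial ideal `in_w(J)` of an ideal `J` with respect to a weight vector `w`:
the ideal generated by the initial forms of the nonzero elements of `J`. -/
noncomputable def initialIdeal {σ : Type*} {K : Type*} [Field K] (w : σ → ℕ)
    (J : Ideal (MvPolynomial σ K)) : Ideal (MvPolynomial σ K) :=
  Ideal.span { g | ∃ f ∈ J, f ≠ 0 ∧ g = initialForm w f }

/-- The weight vector `w_H` attached to a graph `H` on `[n]`: diagonal variables and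
variables corresponding to edges of `H` get weight `2`, all other (off-diagonal)
variables get weight `1`. -/
noncomputable def graphWeight {n : ℕ} (H : SimpleGraph (Fin n)) : Sym2 (Fin n) → ℕ :=
  fun e => if e.IsDiag ∨ e ∈ H.edgeSet then 2 else 1

/-- The weight vector `w_diag`: diagonal variables get weight `2`, off-diagonal
variables get weight `1`. -/
noncomputable def diagWeight (n : ℕ) : Sym2 (Fin n) → ℕ :=
  fun e => if e.IsDiag then 2 else 1

/-- The monomial `(∏_{i ∈ [n]∖V(p)} x_{ii}) · x_p` associated to a path `p`, where `V(p)`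
is the vertex set of `p` and `x_p = ∏_{ij ∈ p} x_{ij}`. -/
noncomputable def pathGenerator {K : Type*} [Field K] {n : ℕ} {T : SimpleGraph (Fin n)}
    {k l : Fin n} (p : T.Walk k l) : SymPolyRing K n :=
  (∏ i ∈ Finset.univ \ p.support.toFinset, MvPolynomial.X s(i, i)) *
    (p.edges.map fun e => (MvPolynomial.X e : SymPolyRing K n)).prod

/-- The squarefree monomial ideal `I_T` associated to a forest `T` on `[n]`, generated by:
(i)  `(x_{11}⋯x_{nn})/x_{ii}` for all `i`;
(ii) `(x_{11}⋯x_{nn})/(x_{kk}x_{ll}) · x_{kl}` for all `k < l` with no path in `T`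
     between `k` and `l`;
(iii) `(∏_{i ∈ [n]∖V(p)} x_{ii}) · x_p` for every path `p` in `T` (a path having at least
     one edge and no repeated vertex). -/
noncomputable def forestIdeal (K : Type*) [Field K] (n : ℕ) (T : SimpleGraph (Fin n)) :
    Ideal (SymPolyRing K n) :=
  Ideal.span { m : SymPolyRing K n |
    (∃ i : Fin n, m = ∏ j ∈ Finset.univ.erase i, MvPolynomial.X s(j, j)) ∨
    (∃ k l : Fin n, k < l ∧ ¬ T.Reachable k l ∧
      m = (∏ j ∈ (Finset.univ.erase k).erase l, MvPolynomial.X s(j, j)) *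
        MvPolynomial.X s(k, l)) ∨
    (∃ (k l : Fin n) (p : T.Walk k l), p.IsPath ∧ k ≠ l ∧ m = pathGenerator p) }


theorem monWeight_eq {σ : Type*} (w : σ → ℕ) (m : σ →₀ ℕ) :
    monWeight w m = Finsupp.weight w m := by
  simp [monWeight, Finsupp.weight_apply]

theorem initialForm_eq {σ K : Type*} [Field K] (w : σ → ℕ) (f : MvPolynomial σ K) :
    initialForm w f = weightedHomogeneousComponent w (topWeight w f) f := by
  rw [weightedHomogeneousComponent_apply, initialForm]
  simp only [monWeight_eq]

theorem coeff_initialForm {σ K : Type*} [Field K] (w : σ → ℕ) (f : MvPolynomial σ K)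
    (m : σ →₀ ℕ) : coeff m (initialForm w f) =
      if monWeight w m = topWeight w f then coeff m f else 0 := by
  rw [initialForm_eq, coeff_weightedHomogeneousComponent, monWeight_eq]

theorem le_topWeight {σ K : Type*} [Field K] (w : σ → ℕ) (f : MvPolynomial σ K)
    (m : σ →₀ ℕ) (hm : m ∈ f.support) : monWeight w m ≤ topWeight w f :=
  Finset.le_sup (f := monWeight w) hm

theorem topWeight_eq {σ K : Type*} [Field K] (w : σ → ℕ) (f : MvPolynomial σ K)
    (m : σ →₀ ℕ) (hm : m ∈ f.support) (h : ∀ m' ∈ f.support, monWeight w m' ≤ monWeight w m) :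
    topWeight w f = monWeight w m :=
  le_antisymm (Finset.sup_le h) (le_topWeight w f m hm)

theorem monWeight_comb {σ : Type*} (w w' : σ → ℕ) (N : ℕ) (m : σ →₀ ℕ) :
    monWeight (fun s => N * w s + w' s) m = N * monWeight w m + monWeight w' m := by
  simp only [monWeight, Finsupp.sum, Finset.mul_sum, ← Finset.sum_add_distrib]
  refine Finset.sum_congr rfl fun _ _ => ?_
  ring

theorem initialIdeal_mono {σ K : Type*} [Field K] (w : σ → ℕ) {I J : Ideal (MvPolynomial σ K)}
    (h : I ≤ J) : initialIdeal w I ≤ initialIdeal w J := by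
  apply Ideal.span_mono
  rintro g ⟨f, hf, h0, rfl⟩
  exact ⟨f, h hf, h0, rfl⟩

theorem initialForm_mem {σ K : Type*} [Field K] (w : σ → ℕ) {I : Ideal (MvPolynomial σ K)}
    {f : MvPolynomial σ K} (hf : f ∈ I) : initialForm w f ∈ initialIdeal w I := by
  by_cases h : f = 0
  · subst h
    have : initialForm w (0 : MvPolynomial σ K) = 0 := by simp [initialForm]
    rw [this]; exact Ideal.zero_mem _
  · exact Ideal.subset_span ⟨f, hf, h, rfl⟩

theorem comp_of_mem_initialIdeal {σ K : Type*} [Field K] (w : σ → ℕ)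
    {I : Ideal (MvPolynomial σ K)} {g : MvPolynomial σ K} (hg : g ∈ initialIdeal w I) :
    ∀ d : ℕ, ∃ f ∈ I, (∀ m ∈ f.support, monWeight w m ≤ d) ∧
      weightedHomogeneousComponent w d g = weightedHomogeneousComponent w d f := by
  refine Submodule.span_induction (p := fun g _ => ∀ d : ℕ, ∃ f ∈ I,
    (∀ m ∈ f.support, monWeight w m ≤ d) ∧
      weightedHomogeneousComponent w d g = weightedHomogeneousComponent w d f) ?_ ?_ ?_ ?_ hg
  · rintro _ ⟨f, hf, h0, rfl⟩ d
    by_cases hd : d = topWeight w f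
    · subst hd
      refine ⟨f, hf, fun m hm => le_topWeight w f m hm, ?_⟩
      ext m
      simp only [coeff_weightedHomogeneousComponent, coeff_initialForm, monWeight_eq]
      split_ifs <;> rfl
    · refine ⟨0, I.zero_mem, by simp, ?_⟩
      ext m
      simp only [coeff_weightedHomogeneousComponent, coeff_initialForm, monWeight_eq]
      split_ifs with h1 h2
      · exact absurd (h1.symm.trans h2) hd
      all_goals simp
  · intro d
    exact ⟨0, I.zero_mem, by simp, by simp⟩
  · intro x y _ _ hx hy d
    obtain ⟨f, hf, hf1, hf2⟩ := hx d
    obtain ⟨f', hf', hf1', hf2'⟩ := hy d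
    refine ⟨f + f', I.add_mem hf hf', ?_, by rw [map_add, map_add, hf2, hf2']⟩
    intro m hm
    rcases Finset.mem_union.1 (support_add hm) with h | h
    · exact hf1 m h
    · exact hf1' m h
  · intro a x _ hx
    induction a using MvPolynomial.induction_on' with
    | add p q hp hq =>
      intro d
      obtain ⟨f, hf, hf1, hf2⟩ := hp d
      obtain ⟨f', hf', hf1', hf2'⟩ := hq d
      refine ⟨f + f', I.add_mem hf hf', ?_, ?_⟩
      · intro m hm
        rcases Finset.mem_union.1 (support_add hm) with h | h
        · exact hf1 m h
        · exact hf1' m h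
      · rw [add_smul, map_add, map_add, hf2, hf2']
    | monomial b c =>
      intro d
      by_cases hd : monWeight w b ≤ d
      · obtain ⟨f, hf, hf1, hf2⟩ := hx (d - monWeight w b)
        refine ⟨monomial b c * f, I.mul_mem_left _ hf, ?_, ?_⟩
        · intro m hm
          rw [mem_support_iff, coeff_monomial_mul'] at hm
          split_ifs at hm with hb
          · have := hf1 (m - b) (mem_support_iff.2 (right_ne_zero_of_mul hm))
            have h2 : monWeight w m = monWeight w b + monWeight w (m - b) := by
              rw [monWeight_eq, monWeight_eq, monWeight_eq, ← map_add, add_tsub_cancel_of_le hb]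
            omega
          · exact absurd rfl hm
        · ext m
          have := congrArg (coeff (m - b)) hf2
          simp only [coeff_weightedHomogeneousComponent, smul_eq_mul, coeff_monomial_mul',
            ← monWeight_eq] at this ⊢
          by_cases hb : b ≤ m
          · have h2 : monWeight w m = monWeight w b + monWeight w (m - b) := by
              rw [monWeight_eq, monWeight_eq, monWeight_eq, ← map_add, add_tsub_cancel_of_le hb]
            by_cases h3 : monWeight w m = d
            · have h4 : monWeight w (m - b) = d - monWeight w b := by omega
              simp only [h4, if_true] at this
              simp [hb, h3, this]
            · simp [h3]
          · simp [hb]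
      · refine ⟨0, I.zero_mem, by simp, ?_⟩
        ext m
        simp only [coeff_weightedHomogeneousComponent, smul_eq_mul, coeff_monomial_mul',
            ← monWeight_eq]
        by_cases hb : b ≤ m
        · have h2 : monWeight w m = monWeight w b + monWeight w (m - b) := by
            rw [monWeight_eq, monWeight_eq, monWeight_eq, ← map_add, add_tsub_cancel_of_le hb]
          have h3 : monWeight w m ≠ d := by omega
          simp [h3]
        · simp [hb]

theorem initialIdeal_comb {σ K : Type*} [Field K] (w w' : σ → ℕ)
    (I Q : Ideal (MvPolynomial σ K)) (N0 : ℕ)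
    (h : ∀ N, N0 ≤ N → initialIdeal (fun s => N * w s + w' s) I ≤ Q) :
    initialIdeal w' (initialIdeal w I) ≤ Q := by
  rw [initialIdeal, Ideal.span_le]
  rintro _ ⟨g, hg, -, rfl⟩
  set D := topWeight w' g with hD
  have hsum : initialForm w' g = ∑ d ∈ g.support.image (monWeight w),
      weightedHomogeneousComponent w' D (weightedHomogeneousComponent w d g) := by
    ext m
    simp only [coeff_sum, coeff_initialForm, coeff_weightedHomogeneousComponent, ← monWeight_eq,
      ← hD]
    by_cases h1 : monWeight w' m = D
    · simp only [h1, if_true, Finset.sum_ite_eq]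
      by_cases h2 : m ∈ g.support
      · rw [if_pos (Finset.mem_image_of_mem _ h2)]
      · rw [notMem_support_iff] at h2
        simp [h2]
    · simp [h1]
  rw [hsum]
  refine Ideal.sum_mem _ fun d _ => ?_
  obtain ⟨f, hf, hf1, hf2⟩ := comp_of_mem_initialIdeal w hg d
  by_cases hz : weightedHomogeneousComponent w' D (weightedHomogeneousComponent w d g) = 0
  · rw [hz]; exact Q.zero_mem
  obtain ⟨m, hm⟩ := MvPolynomial.exists_coeff_ne_zero hz
  have hcf : ∀ m, monWeight w m = d → coeff m g = coeff m f := by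
    intro m hm
    have := congrArg (coeff m) hf2
    simpa [coeff_weightedHomogeneousComponent, ← monWeight_eq, hm] using this
  simp only [coeff_weightedHomogeneousComponent, ← monWeight_eq] at hm
  have hm1 : monWeight w' m = D := by
    by_contra hc; simp [hc] at hm
  have hm2 : monWeight w m = d := by
    by_contra hc; simp [hc] at hm
  simp only [hm1, hm2, if_true] at hm
  rw [hcf m hm2] at hm
  set N := N0 + f.support.sup (monWeight w') + 1 with hN
  have hbound : ∀ m' ∈ f.support, monWeight w' m' < N := by
    intro m' hm'
    have := Finset.le_sup (f := monWeight w') hm'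
    omega
  have hle : ∀ m' ∈ f.support, monWeight w m' ≠ d → N * monWeight w m' + monWeight w' m' < N * d := by
    intro m' hm' hne
    have h1 : monWeight w m' + 1 ≤ d := lt_of_le_of_ne (hf1 m' hm') hne
    have h2 := hbound m' hm'
    nlinarith [Nat.mul_le_mul_left N h1]
  have htop : topWeight (fun s => N * w s + w' s) f = N * d + D := by
    rw [topWeight_eq _ f m (mem_support_iff.2 hm), monWeight_comb, hm1, hm2]
    intro m' hm'
    rw [monWeight_comb, monWeight_comb, hm1, hm2]
    by_cases hd : monWeight w m' = d
    · have : monWeight w' m' ≤ D := by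
        apply le_topWeight
        rw [mem_support_iff, hcf m' hd]
        exact mem_support_iff.1 hm'
      rw [hd]; omega
    · have := hle m' hm' hd
      omega
  have key : weightedHomogeneousComponent w' D (weightedHomogeneousComponent w d g) =
      initialForm (fun s => N * w s + w' s) f := by
    ext m'
    simp only [coeff_weightedHomogeneousComponent, ← monWeight_eq, coeff_initialForm, htop,
      monWeight_comb]
    by_cases h0 : m' ∈ f.support
    · by_cases hd : monWeight w m' = d
      · simp [hd, hcf m' hd]
      · have := hle m' h0 hd
        rw [if_neg (show ¬ (N * monWeight w m' + monWeight w' m' = N * d + D) by omega)]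
        simp [hd]
    · rw [notMem_support_iff] at h0
      by_cases hd : monWeight w m' = d
      · simp [hcf m' hd, h0]
      · simp [hd, h0]
  rw [key]
  exact h N (by omega) (initialForm_mem _ hf)

theorem initialForm_unique {σ K : Type*} [Field K] (w1 w2 w3 : σ → ℕ)
    (f : MvPolynomial σ K) (m0 : σ →₀ ℕ) (hm0 : m0 ∈ f.support) (N0 : ℕ)
    (h : ∀ N, N0 ≤ N → ∀ M, ∀ m ∈ f.support, m ≠ m0 →
      M * monWeight w1 m + (N * monWeight w2 m + monWeight w3 m) <
        M * monWeight w1 m0 + (N * monWeight w2 m0 + monWeight w3 m0)) :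
    initialForm w3 (initialForm w2 (initialForm w1 f)) = monomial m0 (coeff m0 f) := by
  have h1 : ∀ m ∈ f.support, monWeight w1 m ≤ monWeight w1 m0 := by
    intro m hm
    by_contra hc
    push Not at hc
    have hne : m ≠ m0 := by rintro rfl; exact lt_irrefl _ hc
    have := h N0 le_rfl (N0 * monWeight w2 m0 + monWeight w3 m0) m hm hne
    generalize N0 * monWeight w2 m0 + monWeight w3 m0 = Z at this
    have h5 : Z * (monWeight w1 m0 + 1) ≤ Z * monWeight w1 m := Nat.mul_le_mul_left Z hc
    rw [Nat.mul_succ] at h5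
    omega
  have t1 := topWeight_eq w1 f m0 hm0 h1
  have s1 : ∀ m, m ∈ (initialForm w1 f).support ↔ m ∈ f.support ∧ monWeight w1 m = monWeight w1 m0 := by
    intro m
    simp only [mem_support_iff, coeff_initialForm, t1]
    by_cases hh : monWeight w1 m = monWeight w1 m0 <;> simp [hh]
  have h2 : ∀ m ∈ (initialForm w1 f).support, monWeight w2 m ≤ monWeight w2 m0 := by
    intro m hm
    obtain ⟨hm, he⟩ := (s1 m).1 hm
    by_contra hc
    push Not at hc
    have hne : m ≠ m0 := by rintro rfl; exact lt_irrefl _ hc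
    have := h (N0 + monWeight w3 m0) (by omega) 0 m hm hne
    have h5 : (N0 + monWeight w3 m0) * (monWeight w2 m0 + 1) ≤
      (N0 + monWeight w3 m0) * monWeight w2 m := Nat.mul_le_mul_left _ hc
    rw [Nat.mul_succ] at h5
    omega
  have t2 := topWeight_eq w2 _ m0 ((s1 m0).2 ⟨hm0, rfl⟩) h2
  have s2 : ∀ m, m ∈ (initialForm w2 (initialForm w1 f)).support ↔
      m ∈ f.support ∧ monWeight w1 m = monWeight w1 m0 ∧ monWeight w2 m = monWeight w2 m0 := by
    intro m
    rw [mem_support_iff, coeff_initialForm, t2]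
    by_cases hh : monWeight w2 m = monWeight w2 m0
    · rw [if_pos hh, ← mem_support_iff, s1]; simp [hh]
    · simp [hh]
  have h3 : ∀ m ∈ (initialForm w2 (initialForm w1 f)).support, m ≠ m0 →
      monWeight w3 m < monWeight w3 m0 := by
    intro m hm hne
    obtain ⟨hm, he, he'⟩ := (s2 m).1 hm
    have := h N0 le_rfl 0 m hm hne
    rw [he'] at this
    omega
  have t3 := topWeight_eq w3 _ m0 ((s2 m0).2 ⟨hm0, rfl, rfl⟩) (fun m hm => by
    by_cases hne : m = m0
    · rw [hne]
    · exact (h3 m hm hne).le)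
  ext m
  rw [coeff_monomial]
  by_cases hne : m0 = m
  · subst hne
    simp [coeff_initialForm, t1, t2, t3]
  · rw [if_neg hne, coeff_initialForm, t3]
    by_cases hm : m ∈ (initialForm w2 (initialForm w1 f)).support
    · rw [if_neg (h3 m hm (Ne.symm hne)).ne]
    · rw [notMem_support_iff] at hm
      simp [hm]


/-- Cost of a variable: defect of its combined weight. -/
noncomputable def ecost {n : ℕ} (G T : SimpleGraph (Fin n)) (N M : ℕ) (e : Sym2 (Fin n)) : ℕ :=
  if e.IsDiag then 0 else if e ∈ T.edgeSet then 1 else if e ∈ G.edgeSet then N + 1 else M + N + 1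

theorem weight_add_ecost {n : ℕ} (G T : SimpleGraph (Fin n)) (hTG : T ≤ G) (N M : ℕ)
    (e : Sym2 (Fin n)) :
    M * graphWeight G e + (N * graphWeight T e + diagWeight n e) + ecost G T N M e =
      2 * M + 2 * N + 2 := by
  have h : e ∈ T.edgeSet → e ∈ G.edgeSet := fun h => SimpleGraph.edgeSet_mono hTG h
  unfold graphWeight diagWeight ecost
  by_cases h1 : e.IsDiag
  · simp [h1]; omega
  · by_cases h2 : e ∈ T.edgeSet
    · simp [h1, h2, h h2]; omega
    · by_cases h3 : e ∈ G.edgeSet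
      · simp [h1, h2, h3]; omega
      · simp [h1, h2, h3]; omega

section
variable {n : ℕ} (G T : SimpleGraph (Fin n)) (N M : ℕ)

theorem ecost_diag (r : Fin n) : ecost G T N M s(r, r) = 0 := by simp [ecost]

theorem ecost_pos {r q : Fin n} (h : r ≠ q) : 1 ≤ ecost G T N M s(r, q) := by
  unfold ecost
  rw [if_neg (by simpa using h)]
  split_ifs <;> omega

theorem ecost_edge {r q : Fin n} (h : T.Adj r q) : ecost G T N M s(r, q) = 1 := by
  unfold ecost
  rw [if_neg (by simpa using h.ne), if_pos (by simpa using h)]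

theorem ecost_nonedge {r q : Fin n} (hrq : r ≠ q) (h : ¬ T.Adj r q) :
    N + 1 ≤ ecost G T N M s(r, q) := by
  unfold ecost
  rw [if_neg (by simpa using hrq), if_neg (by simpa using h)]
  split_ifs <;> omega

theorem ecost_unreach (hTG : T ≤ G) {r q : Fin n} (h : ¬ G.Reachable r q) :
    ecost G T N M s(r, q) = M + N + 1 := by
  have h1 : r ≠ q := by rintro rfl; exact h (SimpleGraph.Reachable.refl _)
  have h2 : ¬ G.Adj r q := fun h' => h h'.reachable
  unfold ecost
  rw [if_neg (by simpa using h1), if_neg (by simpa using fun h' => h2 (hTG h')),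
    if_neg (by simpa using h2)]

/-- A potential at `k` for the costs, valid off `D`. -/
structure Pot {n : ℕ} (c : Sym2 (Fin n) → ℕ) (k : Fin n) (φ : Fin n → ℕ) : Prop where
  zero : φ k = 0
  le : ∀ r, r ≠ k → ∀ q, φ r ≤ c s(r, q) + φ q
  uniq : ∀ r, r ≠ k → ∀ q q', q ≠ r → q' ≠ r → φ r = c s(r, q) + φ q →
    φ r = c s(r, q') + φ q' → q = q'

/-- First potential: distance in the forest. -/
noncomputable def phi1 (k r : Fin n) : ℕ := if T.Reachable r k then T.dist r k else N

/-- Second potential. -/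
noncomputable def phi2 (k r : Fin n) : ℕ :=
  if r = k then 0 else if T.Reachable r k then 1 else M + N + 1

theorem dist_lt_card {n : ℕ} (T : SimpleGraph (Fin n)) {r k : Fin n} (h : T.Reachable r k) :
    T.dist r k < n := by
  obtain ⟨p, hp, hl⟩ := h.exists_path_of_dist
  rw [← hl]
  simpa using hp.length_lt

theorem tree_next_unique {n : ℕ} {T : SimpleGraph (Fin n)} (hT : T.IsAcyclic) {r q q' k : Fin n}
    (h : T.Adj r q) (h' : T.Adj r q') (hk : T.Reachable r k)
    (e : T.dist r k = 1 + T.dist q k) (e' : T.dist r k = 1 + T.dist q' k) : q = q' := by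
  obtain ⟨p, hp, hl⟩ := (h.symm.reachable.trans hk).exists_path_of_dist
  obtain ⟨p', hp', hl'⟩ := (h'.symm.reachable.trans hk).exists_path_of_dist
  have h1 : (SimpleGraph.Walk.cons h p).IsPath := by
    apply SimpleGraph.Walk.isPath_of_length_eq_dist
    simp; omega
  have h2 : (SimpleGraph.Walk.cons h' p').IsPath := by
    apply SimpleGraph.Walk.isPath_of_length_eq_dist
    simp; omega
  have := hT.path_unique ⟨_, h1⟩ ⟨_, h2⟩
  simp only [Subtype.mk.injEq, SimpleGraph.Walk.cons.injEq] at this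
  exact this.1

theorem phi1_le (hN : n ≤ N) (k r : Fin n) : phi1 T N k r ≤ N := by
  unfold phi1
  split_ifs with h
  · have := dist_lt_card T h; omega
  · exact le_rfl

theorem phi1_pot (hT : T.IsAcyclic) (hN : n ≤ N) (k : Fin n) :
    Pot (ecost G T N M) k (phi1 T N k) where
  zero := by simp [phi1]
  le := by
    intro r hr q
    by_cases hq : r = q
    · subst hq; omega
    by_cases ha : T.Adj r q
    · rw [ecost_edge _ _ _ _ ha]
      unfold phi1
      by_cases h : T.Reachable r k
      · have h' : T.Reachable q k := ha.symm.reachable.trans h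
        rw [if_pos h, if_pos h']
        have := ha.reachable.dist_triangle_left k
        rw [SimpleGraph.dist_eq_one_iff_adj.2 ha] at this
        exact this
      · have h' : ¬ T.Reachable q k := fun h' => h (ha.reachable.trans h')
        rw [if_neg h, if_neg h']; omega
    · have := ecost_nonedge G T N M hq ha
      have := phi1_le T N hN k r
      omega
  uniq := by
    intro r hr q q' hq hq' e e'
    have key : ∀ q, q ≠ r → phi1 T N k r = ecost G T N M s(r, q) + phi1 T N k q →
        T.Adj r q ∧ T.Reachable r k ∧ T.dist r k = 1 + T.dist q k := by
      intro q hq e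
      have ha : T.Adj r q := by
        by_contra ha
        have := ecost_nonedge G T N M hq.symm ha
        have := phi1_le T N hN k r
        omega
      rw [ecost_edge _ _ _ _ ha] at e
      unfold phi1 at e
      by_cases h : T.Reachable r k
      · have h' : T.Reachable q k := ha.symm.reachable.trans h
        rw [if_pos h, if_pos h'] at e
        exact ⟨ha, h, e⟩
      · have h' : ¬ T.Reachable q k := fun h' => h (ha.reachable.trans h')
        rw [if_neg h, if_neg h'] at e; omega
    obtain ⟨a1, a2, a3⟩ := key q hq e
    obtain ⟨b1, b2, b3⟩ := key q' hq' e'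
    exact tree_next_unique hT a1 b1 a2 a3 b3

theorem phi2_pot (hTG : T ≤ G) (hspan : ∀ u v, T.Reachable u v ↔ G.Reachable u v) (k : Fin n) :
    Pot (ecost G T N M) k (phi2 T N M k) := by
  have key : ∀ r, r ≠ k → ∀ q, q ≠ r → phi2 T N M k r ≤ ecost G T N M s(r, q) + phi2 T N M k q ∧
      (phi2 T N M k r = ecost G T N M s(r, q) + phi2 T N M k q → q = k) := by
    intro r hr q hq
    have h1 := ecost_pos G T N M hq.symm
    unfold phi2
    rw [if_neg hr]
    by_cases hqk : q = k
    · subst hqk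
      simp only [if_true]
      by_cases h : T.Reachable r q
      · rw [if_pos h]; simp; exact h1
      · rw [if_neg h, ecost_unreach G T N M hTG (fun h' => h ((hspan _ _).2 h'))]
        simp
    · rw [if_neg hqk]
      by_cases h : T.Reachable r k
      · rw [if_pos h]
        split_ifs
        · omega
        · omega
      · rw [if_neg h]
        by_cases h' : T.Reachable q k
        · have : ¬ T.Reachable r q := fun h'' => h (h''.trans h')
          rw [if_pos h', ecost_unreach G T N M hTG (fun h' => this ((hspan _ _).2 h'))]
          omega
        · rw [if_neg h']; omega
  refine ⟨by simp [phi2], ?_, ?_⟩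
  · intro r hr q
    by_cases hq : q = r
    · subst hq; omega
    · exact (key r hr q hq).1
  · intro r hr q q' hq hq' e e'
    rw [(key r hr q hq).2 e, (key r hr q' hq').2 e']

end


theorem sum_erase_perm {n : ℕ} (σ : Equiv.Perm (Fin n)) (k : Fin n) (φ : Fin n → ℕ) :
    ∑ r ∈ Finset.univ.erase k, φ (σ r) + φ (σ k) = ∑ r, φ r := by
  rw [Finset.sum_erase_add _ _ (Finset.mem_univ k)]
  exact Equiv.sum_comp σ φ

theorem pot_cost_ge {n : ℕ} {c : Sym2 (Fin n) → ℕ} {k : Fin n} {φ : Fin n → ℕ} (h : Pot c k φ)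
    (σ : Equiv.Perm (Fin n)) :
    φ (σ k) ≤ ∑ r ∈ Finset.univ.erase k, c s(r, σ r) ∧
    (∑ r ∈ Finset.univ.erase k, c s(r, σ r) ≤ φ (σ k) →
      ∀ r, r ≠ k → φ r = c s(r, σ r) + φ (σ r)) := by
  have h1 := sum_erase_perm σ k φ
  have h2 : ∑ r ∈ Finset.univ.erase k, φ r + φ k = ∑ r, φ r := by
    rw [Finset.sum_erase_add _ _ (Finset.mem_univ k)]
  rw [h.zero] at h2
  have hle : ∀ r ∈ Finset.univ.erase k, φ r ≤ c s(r, σ r) + φ (σ r) :=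
    fun r hr => h.le r (Finset.ne_of_mem_erase hr) _
  have h3 := Finset.sum_le_sum hle
  rw [Finset.sum_add_distrib] at h3
  refine ⟨by omega, fun h4 r hr => ?_⟩
  have := (Finset.sum_eq_sum_iff_of_le hle).1 (by rw [Finset.sum_add_distrib]; omega)
  exact this r (Finset.mem_erase.2 ⟨hr, Finset.mem_univ _⟩)

theorem pot_fix {n : ℕ} {c : Sym2 (Fin n) → ℕ} {k : Fin n} {φ : Fin n → ℕ} (h : Pot c k φ)
    (hc : ∀ r q, r ≠ q → 1 ≤ c s(r, q))
    (σ π : Equiv.Perm (Fin n)) (hk : σ k = π k)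
    (hσ : ∀ r, r ≠ k → φ r = c s(r, σ r) + φ (σ r))
    (hπ : ∀ r, r ≠ k → φ r = c s(r, π r) + φ (π r)) (r : Fin n) (hr : r ≠ k) (hf : σ r = r) :
    π r = r := by
  by_contra hne
  obtain ⟨s, hs, hmax⟩ := Finset.exists_max_image
    (Finset.univ.filter fun r => r ≠ k ∧ σ r = r ∧ π r ≠ r) φ ⟨r, by simp [hr, hf, hne]⟩
  simp only [Finset.mem_filter, Finset.mem_univ, true_and] at hs hmax
  obtain ⟨s1, s2, s3⟩ := hs
  set t := π.symm s with ht
  have hts : π t = s := by simp [ht]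
  have htne : t ≠ s := by rintro e; rw [e] at hts; exact s3 hts
  have htk : t ≠ k := by
    intro e
    rw [e, ← hk, ← s2] at hts
    exact s1 (σ.injective hts).symm
  have h1 := hπ t htk
  rw [hts] at h1
  have h2 := hc t s htne
  by_cases hst : σ t = t
  · have := hmax t ⟨htk, hst, by rw [hts]; exact htne.symm⟩
    omega
  · have := h.uniq t htk (σ t) s hst htne.symm (hσ t htk) h1
    rw [← s2] at this
    exact htne (σ.injective this)

theorem pot_unique {n : ℕ} {c : Sym2 (Fin n) → ℕ} {k : Fin n} {φ : Fin n → ℕ} (h : Pot c k φ)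
    (hc : ∀ r q, r ≠ q → 1 ≤ c s(r, q))
    (σ π : Equiv.Perm (Fin n)) (hk : σ k = π k)
    (hσ : ∀ r, r ≠ k → φ r = c s(r, σ r) + φ (σ r))
    (hπ : ∀ r, r ≠ k → φ r = c s(r, π r) + φ (π r)) : σ = π := by
  ext1 r
  by_cases hr : r = k
  · rw [hr, hk]
  by_cases h1 : σ r = r
  · rw [h1, pot_fix h hc σ π hk hσ hπ r hr h1]
  by_cases h2 : π r = r
  · rw [h2, pot_fix h hc π σ hk.symm hπ hσ r hr h2]
  exact h.uniq r hr _ _ h1 h2 (hσ r hr) (hπ r hr)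

/-- exponent of the term of a permutation -/
noncomputable def permExp {n : ℕ} (k : Fin n) (σ : Equiv.Perm (Fin n)) : Sym2 (Fin n) →₀ ℕ :=
  ∑ r ∈ Finset.univ.erase k, Finsupp.single s(r, σ r) 1

theorem prod_X_eq {K : Type*} [Field K] {n : ℕ} (k : Fin n) (σ : Equiv.Perm (Fin n)) :
    ∏ r ∈ Finset.univ.erase k, (X s(r, σ r) : SymPolyRing K n) = monomial (permExp k σ) 1 := by
  rw [permExp, monomial_sum_one]
  rfl

theorem monWeight_permExp {n : ℕ} (w : Sym2 (Fin n) → ℕ) (k : Fin n) (σ : Equiv.Perm (Fin n)) :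
    monWeight w (permExp k σ) = ∑ r ∈ Finset.univ.erase k, w s(r, σ r) := by
  rw [monWeight_eq, permExp, map_sum]
  simp [Finsupp.weight_apply]

theorem adj_expand {K : Type*} [Field K] {n : ℕ} (k l : Fin n) :
    (genericSym K n).adjugate l k = ∑ σ : Equiv.Perm (Fin n),
      if σ k = l then monomial (permExp k σ) ((Equiv.Perm.sign σ : ℤ) : K) else 0 := by
  rw [Matrix.adjugate_apply, ← Matrix.det_transpose, Matrix.det_apply']
  refine Finset.sum_congr rfl fun σ _ => ?_
  rw [← Finset.mul_prod_erase _ _ (Finset.mem_univ k)]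
  have : ∏ x ∈ Finset.univ.erase k, ((genericSym K n).updateRow k (Pi.single l 1)).transpose (σ x) x
      = monomial (permExp k σ) 1 := by
    rw [← prod_X_eq]
    refine Finset.prod_congr rfl fun r hr => ?_
    rw [Matrix.transpose_apply, Matrix.updateRow_ne (Finset.ne_of_mem_erase hr)]
    rfl
  rw [this]
  simp only [Matrix.transpose_apply, Matrix.updateRow_self, Pi.single_apply]
  split_ifs with h
  · rw [one_mul, ← mul_one ((Equiv.Perm.sign σ : ℤ) : K), ← C_mul_monomial]
    simp
  · simp

theorem adj_mem {K : Type*} [Field K] {n : ℕ} (hn : 2 ≤ n) (k l : Fin n) :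
    (genericSym K n).adjugate l k ∈ minorsIdeal (n - 1) (genericSym K n) := by
  obtain ⟨m, rfl⟩ : ∃ m, n = m + 1 := ⟨n - 1, by omega⟩
  rw [Matrix.adjugate_fin_succ_eq_det_submatrix]
  apply Ideal.mul_mem_left
  exact Ideal.subset_span ⟨k.succAbove, l.succAbove, Fin.succAbove_right_injective,
    Fin.succAbove_right_injective, rfl⟩

theorem fwd_aux {K : Type*} [Field K] {n : ℕ} (hn : 2 ≤ n) (G T : SimpleGraph (Fin n))
    (hTG : T ≤ G) (k : Fin n) (π : Equiv.Perm (Fin n)) (N0 : ℕ)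
    (h : ∀ N, N0 ≤ N → ∀ M, ∃ φ, Pot (ecost G T N M) k φ ∧
      ∑ r ∈ Finset.univ.erase k, ecost G T N M s(r, π r) = φ (π k)) :
    ∏ r ∈ Finset.univ.erase k, (X s(r, π r) : SymPolyRing K n) ∈
      initialIdeal (diagWeight n)
        (initialIdeal (graphWeight T)
          (initialIdeal (graphWeight G) (minorsIdeal (n - 1) (genericSym K n)))) := by
  have key : ∀ N, N0 ≤ N → ∀ M, ∀ σ : Equiv.Perm (Fin n), σ k = π k → σ ≠ π →
      M * monWeight (graphWeight G) (permExp k σ) + (N * monWeight (graphWeight T) (permExp k σ) +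
        monWeight (diagWeight n) (permExp k σ)) <
      M * monWeight (graphWeight G) (permExp k π) + (N * monWeight (graphWeight T) (permExp k π) +
        monWeight (diagWeight n) (permExp k π)) := by
    intro N hN M σ hσ hne
    obtain ⟨φ, hφ, hsum⟩ := h N hN M
    have hw : ∀ τ : Equiv.Perm (Fin n), M * monWeight (graphWeight G) (permExp k τ) +
        (N * monWeight (graphWeight T) (permExp k τ) + monWeight (diagWeight n) (permExp k τ))
        + ∑ r ∈ Finset.univ.erase k, ecost G T N M s(r, τ r) =
        ∑ r ∈ Finset.univ.erase k, (2 * M + 2 * N + 2) := by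
      intro τ
      rw [monWeight_permExp, monWeight_permExp, monWeight_permExp, Finset.mul_sum, Finset.mul_sum,
        ← Finset.sum_add_distrib, ← Finset.sum_add_distrib, ← Finset.sum_add_distrib]
      refine Finset.sum_congr rfl fun r _ => ?_
      exact weight_add_ecost G T hTG N M _
    have h1 := hw σ
    have h2 := hw π
    have h3 : φ (π k) < ∑ r ∈ Finset.univ.erase k, ecost G T N M s(r, σ r) := by
      by_contra hc
      push Not at hc
      have a1 := (pot_cost_ge hφ σ).2 (by rw [hσ]; exact hc)
      have a2 := (pot_cost_ge hφ π).2 (by rw [hsum])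
      exact hne (pot_unique hφ (fun r q hrq => ecost_pos G T N M hrq) σ π hσ a1 a2)
    omega
  have hcoeff : coeff (permExp k π) ((genericSym K n).adjugate (π k) k) =
      ((Equiv.Perm.sign π : ℤ) : K) := by
    rw [adj_expand, coeff_sum, Finset.sum_eq_single π]
    · simp
    · intro σ _ hne
      split_ifs with hσ
      · rw [coeff_monomial, if_neg]
        intro he
        have := key N0 le_rfl 0 σ hσ hne
        rw [he] at this
        exact lt_irrefl _ this
      · simp
    · simp
  have hu : ((Equiv.Perm.sign π : ℤ) : K) * ((Equiv.Perm.sign π : ℤ) : K) = 1 := by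
    rcases Int.units_eq_one_or (Equiv.Perm.sign π) with h | h <;> simp [h]
  have huniq := initialForm_unique (graphWeight G) (graphWeight T) (diagWeight n)
    ((genericSym K n).adjugate (π k) k) (permExp k π) (by
      rw [mem_support_iff, hcoeff]
      intro h0; rw [h0] at hu; simp at hu) N0 (by
      intro N hN M m hm hne
      rw [mem_support_iff, adj_expand, coeff_sum] at hm
      obtain ⟨σ, _, hσ⟩ := Finset.exists_ne_zero_of_sum_ne_zero hm
      split_ifs at hσ with hk
      · rw [coeff_monomial] at hσ
        split_ifs at hσ with he
        · subst he
          exact key N hN M σ hk (by rintro rfl; exact hne rfl)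
        · exact absurd rfl hσ
      · simp at hσ)
  have hmem : initialForm (diagWeight n) (initialForm (graphWeight T) (initialForm (graphWeight G)
      ((genericSym K n).adjugate (π k) k))) ∈ initialIdeal (diagWeight n)
        (initialIdeal (graphWeight T)
          (initialIdeal (graphWeight G) (minorsIdeal (n - 1) (genericSym K n)))) :=
    initialForm_mem _ (initialForm_mem _ (initialForm_mem _ (adj_mem hn _ _)))
  rw [huniq, hcoeff] at hmem
  have := Ideal.mul_mem_left _ (C ((Equiv.Perm.sign π : ℤ) : K)) hmem
  rwa [C_mul_monomial, hu, ← prod_X_eq] at this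

theorem path_edges {n : ℕ} {T : SimpleGraph (Fin n)} {l k : Fin n} (p : T.Walk l k)
    (hp : p.IsPath) (hlk : l ≠ k) :
    List.formPerm p.support k = l ∧
    Multiset.map (fun r => s(r, List.formPerm p.support r)) (Finset.univ.erase k).val =
      Multiset.map (fun r => s(r, r)) (Finset.univ \ p.support.toFinset).val + (p.edges : Multiset _) := by
  have hnd := hp.support_nodup
  constructor
  · have := List.formPerm_apply_getElem p.support hnd (p.length) (by simp)
    simpa [SimpleGraph.Walk.support_getElem_eq_getVert] using this
  · have h1 : (Finset.univ.erase k).val =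
        (Finset.univ \ p.support.toFinset).val + (p.support.dropLast : Multiset (Fin n)) := by
      have hlast : p.support = p.support.dropLast ++ [k] := by
        have := List.dropLast_append_getLast (l := p.support) (by simp)
        rw [SimpleGraph.Walk.getLast_support] at this
        exact this.symm
      rw [Multiset.Nodup.ext (Finset.nodup _)]
      · intro a
        have : a ∈ p.support ↔ a ∈ p.support.dropLast ∨ a = k := by
          have : a ∈ p.support ↔ a ∈ p.support.dropLast ++ [k] := by rw [← hlast]
          rw [this, List.mem_append, List.mem_singleton]
        have hk : k ∉ p.support.dropLast := by
          rw [hlast, List.nodup_append] at hnd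
          intro hk
          exact hnd.2.2 k hk k (by simp) rfl
        simp only [Finset.mem_val, Finset.mem_erase, Finset.mem_univ, and_true, Multiset.mem_add,
          Finset.mem_sdiff, List.mem_toFinset, true_and, Multiset.mem_coe, this]
        constructor
        · intro h; tauto
        · rintro (h | h)
          · tauto
          · rintro rfl; exact hk h
      · rw [Multiset.nodup_add]
        refine ⟨Finset.nodup _, ?_, ?_⟩
        · exact (hnd.sublist (List.dropLast_sublist _))
        · rw [Multiset.disjoint_left]
          intro a ha ha'
          have := List.dropLast_subset _ (Multiset.mem_coe.1 ha')
          rw [Finset.mem_val, Finset.mem_sdiff, List.mem_toFinset] at ha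
          exact ha.2 this
    rw [h1, Multiset.map_add]
    congr 1
    · refine Multiset.map_congr rfl fun r hr => ?_
      rw [List.formPerm_apply_of_notMem]
      rw [Finset.mem_val, Finset.mem_sdiff, List.mem_toFinset] at hr
      exact hr.2
    · rw [Multiset.map_coe]
      congr 1
      apply List.ext_getElem
      · simp
      · intro i h1 h2
        rw [SimpleGraph.Walk.getElem_edges_eq_edge_getElem_darts]
        have hi : i < p.darts.length := by simpa using h2
        have e1 := SimpleGraph.Walk.fst_darts_getElem hi
        have e2 := SimpleGraph.Walk.snd_darts_getElem hi
        have e3 : (p.darts[i]).edge = s((p.darts[i]).fst, (p.darts[i]).snd) := rfl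
        rw [e3, e1, e2]
        simp only [List.getElem_map, List.getElem_dropLast]
        rw [List.formPerm_apply_lt_getElem _ hnd i (by simpa using hi)]
        simp

theorem forest_le {K : Type*} [Field K] {n : ℕ} (hn : 2 ≤ n) (G T : SimpleGraph (Fin n))
    (hTG : T ≤ G) (hT : T.IsAcyclic) (hspan : ∀ u v : Fin n, T.Reachable u v ↔ G.Reachable u v) :
    forestIdeal K n T ≤ initialIdeal (diagWeight n)
        (initialIdeal (graphWeight T)
          (initialIdeal (graphWeight G) (minorsIdeal (n - 1) (genericSym K n)))) := by
  rw [forestIdeal, Ideal.span_le]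
  rintro m (⟨i, rfl⟩ | ⟨k, l, hkl, hr, rfl⟩ | ⟨l, k, p, hp, hlk, rfl⟩)
  · have := fwd_aux (K := K) hn G T hTG i 1 n (fun N hN M => ⟨_, phi1_pot G T N M hT hN i, by
      simp [ecost_diag, phi1]⟩)
    simpa using this
  · have hr' : ¬ T.Reachable l k := fun h => hr h.symm
    have := fwd_aux (K := K) hn G T hTG k (Equiv.swap k l) n
      (fun N hN M => ⟨_, phi2_pot G T N M hTG hspan k, by
        rw [Equiv.swap_apply_left, phi2, if_neg hkl.ne', if_neg hr',
          ← Finset.add_sum_erase _ _ (a := l) (by simp [hkl.ne']), Equiv.swap_apply_right,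
          ecost_unreach G T N M hTG (fun h => hr' ((hspan _ _).2 h)), Finset.sum_eq_zero]
        · rfl
        intro r hr
        simp only [Finset.mem_erase] at hr
        rw [Equiv.swap_apply_of_ne_of_ne hr.2.1 hr.1, ecost_diag]⟩)
    rw [← Finset.mul_prod_erase _ _ (a := l) (by simp [hkl.ne']), Equiv.swap_apply_right] at this
    rw [SetLike.mem_coe, mul_comm, Sym2.eq_swap]
    convert this using 2
    refine Finset.prod_congr rfl fun r hr => ?_
    simp only [Finset.mem_erase] at hr
    rw [Equiv.swap_apply_of_ne_of_ne hr.2.1 hr.1]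
  · obtain ⟨h1, h2⟩ := path_edges p hp hlk
    have hlen : T.dist l k = p.length := by
      obtain ⟨q, hq, hl⟩ := (SimpleGraph.Walk.reachable p).exists_path_of_dist
      have := hT.path_unique ⟨p, hp⟩ ⟨q, hq⟩
      simp only [Subtype.mk.injEq] at this
      rw [this, hl]
    have := fwd_aux (K := K) hn G T hTG k (List.formPerm p.support) n
      (fun N hN M => ⟨_, phi1_pot G T N M hT hN k, by
        rw [h1, phi1, if_pos (SimpleGraph.Walk.reachable p), hlen]
        have e : ∑ r ∈ Finset.univ.erase k, ecost G T N M s(r, List.formPerm p.support r) =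
          (Multiset.map (ecost G T N M) (Multiset.map (fun r => s(r, List.formPerm p.support r))
            (Finset.univ.erase k).val)).sum := by
          rw [Multiset.map_map]; rfl
        rw [e, h2, Multiset.map_add, Multiset.sum_add, Multiset.map_map, Multiset.map_coe,
          Multiset.sum_coe]
        have e1 : (Multiset.map (ecost G T N M ∘ fun r => s(r, r))
          (Finset.univ \ p.support.toFinset).val).sum = 0 := by
          apply Multiset.sum_eq_zero
          intro x hx
          obtain ⟨a, _, rfl⟩ := Multiset.mem_map.1 hx
          exact ecost_diag _ _ _ _ _
        have e2 : p.edges.map (ecost G T N M) = p.edges.map (fun _ => 1) := by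
          apply List.map_congr_left
          intro a ha
          have := p.edges_subset_edgeSet ha
          induction a with
          | _ x y => exact ecost_edge _ _ _ _ (by simpa using this)
        rw [e1, e2]
        simp⟩)
    have e : ∏ r ∈ Finset.univ.erase k, (X s(r, List.formPerm p.support r) : SymPolyRing K n) =
          (Multiset.map (fun e => (X e : SymPolyRing K n)) (Multiset.map (fun r => s(r, List.formPerm p.support r))
            (Finset.univ.erase k).val)).prod := by
          rw [Multiset.map_map]; rfl
    rw [e, h2, Multiset.map_add, Multiset.prod_add, Multiset.map_map, Multiset.map_coe,
          Multiset.prod_coe] at this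
    exact this


theorem val_lemma {K k : Type*} [Field K] [Field k] [Algebra K k] {n : ℕ}
    (w c : Sym2 (Fin n) → ℕ) (W : ℕ) (hw : ∀ e, w e + c e = W)
    (g : Sym2 (Fin n) → PowerSeries k)
    (hmin : ∀ f f' : Fin (n - 1) → Fin n, Function.Injective f → Function.Injective f' →
      ((Matrix.of fun i j => PowerSeries.X ^ c s(i, j) * g s(i, j)).submatrix f f').det = 0)
    (p : SymPolyRing K n) (hp : p ∈ minorsIdeal (n - 1) (genericSym K n)) :
    aeval (fun e => PowerSeries.constantCoeff (g e)) (initialForm w p) = 0 := by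
  let ι : PowerSeries k →+* FractionRing (PowerSeries k) := algebraMap (PowerSeries k) (FractionRing (PowerSeries k))
  have hι : Function.Injective ι := IsFractionRing.injective (PowerSeries k) (FractionRing (PowerSeries k))
  obtain ⟨t, ht0⟩ : ∃ t : FractionRing (PowerSeries k), t = ι PowerSeries.X := ⟨_, rfl⟩
  have ht : t ≠ 0 := by
    intro h
    have : (PowerSeries.X : PowerSeries k) = 0 := hι (by rw [map_zero, ← ht0]; exact h)
    exact PowerSeries.X_ne_zero this
  let j : K →+* PowerSeries k := (PowerSeries.C).comp (algebraMap K k)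
  let y : Sym2 (Fin n) → FractionRing (PowerSeries k) := fun e => (t ^ W)⁻¹ * ι (PowerSeries.X ^ c e * g e)
  let ev : SymPolyRing K n →+* FractionRing (PowerSeries k) := eval₂Hom (ι.comp j) y
  have hker : minorsIdeal (n - 1) (genericSym K n) ≤ RingHom.ker ev := by
    rw [minorsIdeal, Ideal.span_le]
    rintro _ ⟨f, f', hf, hf', rfl⟩
    rw [SetLike.mem_coe, RingHom.mem_ker, RingHom.map_det]
    have : ev.mapMatrix ((genericSym K n).submatrix f f') = (t ^ W)⁻¹ •
        ι.mapMatrix ((Matrix.of fun i j => PowerSeries.X ^ c s(i, j) * g s(i, j)).submatrix f f') := by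
      ext a b
      simp [genericSym, ev, y]
    rw [this, Matrix.det_smul, ← RingHom.map_det, hmin f f' hf hf', map_zero, mul_zero]
  have h0 : ev p = 0 := RingHom.mem_ker.1 (hker hp)
  set top := topWeight w p with htop
  have h1 : ι (∑ m ∈ p.support, j (coeff m p) * (PowerSeries.X ^ (top - monWeight w m) *
      ∏ e, g e ^ m e)) = 0 := by
    have h2 : ev p = (t ^ top)⁻¹ * ι (∑ m ∈ p.support, j (coeff m p) *
        (PowerSeries.X ^ (top - monWeight w m) * ∏ e, g e ^ m e)) := by
      show eval₂ _ _ p = _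
      rw [eval₂_eq', map_sum, Finset.mul_sum]
      refine Finset.sum_congr rfl fun m hm => ?_
      have h3 : ∏ i, y i ^ m i = (t ^ monWeight w m)⁻¹ * ι (∏ e, g e ^ m e) := by
        have h4 : monWeight w m = ∑ e, m e * w e := by
          rw [monWeight, Finsupp.sum_fintype]; simp
        rw [h4, ← Finset.prod_pow_eq_pow_sum, ← Finset.prod_inv_distrib, map_prod,
          ← Finset.prod_mul_distrib]
        refine Finset.prod_congr rfl fun e _ => ?_
        have h5 : y e = (t ^ w e)⁻¹ * ι (g e) := by
          simp only [y, map_mul, map_pow]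
          rw [← ht0]
          rw [← hw e, pow_add]
          field_simp
        rw [h5, mul_pow, map_pow, inv_pow, ← pow_mul, mul_comm (m e)]
      rw [h3, map_mul]
      rw [map_mul, map_pow, ← ht0]
      have h6 : t ^ top = t ^ monWeight w m * t ^ (top - monWeight w m) := by
        rw [← pow_add]
        congr 1
        have := le_topWeight w p m hm
        omega
      rw [h6]
      simp only [RingHom.comp_apply]
      field_simp
    rw [h2] at h0
    rcases mul_eq_zero.1 h0 with h | h
    · exact absurd (inv_eq_zero.1 h) (pow_ne_zero _ ht)
    · exact h
  have h7 := congrArg PowerSeries.constantCoeff (hι (h1.trans (map_zero ι).symm))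
  rw [map_sum, map_zero] at h7
  rw [← h7, initialForm, map_sum, Finset.sum_filter]
  refine Finset.sum_congr rfl fun m hm => ?_
  have := le_topWeight w p m hm
  split_ifs with h
  · rw [aeval_monomial, Finsupp.prod_fintype _ _ (by simp)]
    simp [j, h, ← htop]
  · have : top - monWeight w m ≠ 0 := by omega
    simp [this]

theorem rank_lemma {A : Type*} [CommRing A] [IsDomain A] {n : ℕ}
    (Y : Matrix (Fin n) (Fin n) A) (u v : Fin n → A) (hu : Y.mulVec u = 0) (hv : Y.mulVec v = 0)
    (p q : Fin n) (hpq : u p * v q ≠ u q * v p)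
    (f g : Fin (n - 1) → Fin n) (hg : Function.Injective g) :
    (Y.submatrix f g).det = 0 := by
  have hn : 1 ≤ n := p.pos
  obtain ⟨m, hm⟩ : ∃ m, (Finset.univ.image g)ᶜ = {m} := by
    rw [← Finset.card_eq_one, Finset.card_compl, Finset.card_image_of_injective _ hg]
    simp
    omega
  have hm1 : ∀ x, x ∉ Finset.univ.image g ↔ x = m := by
    intro x
    rw [← Finset.mem_compl, hm, Finset.mem_singleton]
  obtain ⟨z, hz, hz0, hzm⟩ : ∃ z, Y.mulVec z = 0 ∧ z ≠ 0 ∧ z m = 0 := by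
    by_cases h : v m • u - u m • v = 0
    · have hp := congrFun h p
      have hq := congrFun h q
      simp only [Pi.sub_apply, Pi.smul_apply, smul_eq_mul, Pi.zero_apply] at hp hq
      have hum : u m = 0 := by
        have : u m * (u p * v q - u q * v p) = 0 := by linear_combination u q * hp - u p * hq
        rcases mul_eq_zero.1 this with h | h
        · exact h
        · exact absurd (sub_eq_zero.1 h) hpq
      refine ⟨u, hu, ?_, hum⟩
      rintro rfl
      simp at hpq
    · refine ⟨_, ?_, h, ?_⟩
      · rw [Matrix.mulVec_sub, Matrix.mulVec_smul, Matrix.mulVec_smul, hu, hv]; simp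
      · simp [mul_comm]
  rw [← Matrix.exists_mulVec_eq_zero_iff]
  refine ⟨z ∘ g, ?_, ?_⟩
  · intro h0
    apply hz0
    ext x
    by_cases hx : x ∈ Finset.univ.image g
    · obtain ⟨a, _, rfl⟩ := Finset.mem_image.1 hx
      exact congrFun h0 a
    · rw [(hm1 x).1 hx, hzm]; rfl
  · ext a
    have h1 := congrFun hz (f a)
    simp only [Matrix.mulVec, dotProduct, Matrix.submatrix_apply, Function.comp] at h1 ⊢
    rw [Pi.zero_apply] at h1 ⊢
    rw [← h1, ← Finset.sum_image (s := Finset.univ) (g := g) (f := fun x => Y (f a) x * z x)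
      (fun x _ y _ h => hg h)]
    apply Finset.sum_subset (Finset.subset_univ _)
    intro x _ hx
    rw [(hm1 x).1 hx, hzm, mul_zero]

theorem solve_lemma {k : Type*} [Field k] {n : ℕ} (x0 : Sym2 (Fin n) → PowerSeries k)
    (D : Finset (Fin n)) (h1 : ∀ r q, r ≠ q → PowerSeries.constantCoeff (x0 s(r, q)) = 0)
    (h2 : ∀ r ∉ D, PowerSeries.constantCoeff (x0 s(r, r)) ≠ 0) :
    ∃ u : Fin n → Fin n → PowerSeries k, (∀ e ∈ D, ∀ d ∈ D, u e d = if d = e then 1 else 0) ∧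
      ∀ e ∈ D, ∀ r ∉ D, ∑ q, x0 s(r, q) * u e q = 0 := by
  let B : Matrix (Fin n) (Fin n) (PowerSeries k) := fun r q =>
    if r ∈ D then (if r = q then 1 else 0) else x0 s(r, q)
  have hB : IsUnit B.det := by
    rw [PowerSeries.isUnit_iff_constantCoeff, RingHom.map_det]
    have : (PowerSeries.constantCoeff).mapMatrix B = Matrix.diagonal (fun r =>
        if r ∈ D then 1 else PowerSeries.constantCoeff (x0 s(r, r))) := by
      ext r q
      change PowerSeries.constantCoeff (B r q) = _
      simp only [B, Matrix.diagonal_apply]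
      by_cases hD : r ∈ D
      · by_cases hrq : r = q
        · subst hrq; simp [hD]
        · simp [hD, hrq]
      · by_cases hrq : r = q
        · subst hrq; simp [hD]
        · simp [hD, hrq, h1 r q hrq]
    rw [this, Matrix.det_diagonal, isUnit_iff_ne_zero, Finset.prod_ne_zero_iff]
    intro r _
    split_ifs with h
    · exact one_ne_zero
    · exact h2 r h
  have hu : ∀ e r, ∑ q, B r q * (B⁻¹.mulVec (Pi.single e 1)) q = if r = e then 1 else 0 := by
    intro e r
    have : B.mulVec (B⁻¹.mulVec (Pi.single e 1)) = Pi.single e 1 := by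
      rw [Matrix.mulVec_mulVec, Matrix.mul_nonsing_inv _ hB, Matrix.one_mulVec]
    have := congrFun this r
    rw [Pi.single_apply] at this
    exact this
  refine ⟨fun e => B⁻¹.mulVec (Pi.single e 1), ?_, ?_⟩
  · intro e _ d hd
    rw [← hu e d]
    simp [B, hd]
  · intro e he r hr
    have := hu e r
    rw [if_neg (by rintro rfl; exact hr he)] at this
    rw [← this]
    simp [B, hr]

/-- The reduced (Schur complement) entries. -/
noncomputable def schurS {k : Type*} [Field k] {n : ℕ} (x0 : Sym2 (Fin n) → PowerSeries k)
    (u : Fin n → Fin n → PowerSeries k) (d e : Fin n) : PowerSeries k :=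
  ∑ q, x0 s(d, q) * u e q

theorem schurS_symm {k : Type*} [Field k] {n : ℕ} (x0 : Sym2 (Fin n) → PowerSeries k)
    (D : Finset (Fin n)) (u : Fin n → Fin n → PowerSeries k)
    (hu1 : ∀ e ∈ D, ∀ d ∈ D, u e d = if d = e then 1 else 0)
    (hu2 : ∀ e ∈ D, ∀ r ∉ D, ∑ q, x0 s(r, q) * u e q = 0) (d e : Fin n) (hd : d ∈ D)
    (he : e ∈ D) : schurS x0 u d e = schurS x0 u e d := by
  have key : ∀ d ∈ D, ∀ e ∈ D, ∑ r, u d r * ∑ q, x0 s(r, q) * u e q = schurS x0 u d e := by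
    intro d hd e he
    rw [Finset.sum_eq_single d]
    · rw [hu1 d hd d hd, if_pos rfl, one_mul]; rfl
    · intro r _ hr
      by_cases h : r ∈ D
      · rw [hu1 d hd r h, if_neg hr, zero_mul]
      · rw [hu2 e he r h, mul_zero]
    · simp
  rw [← key d hd e he, ← key e he d hd]
  simp only [Finset.mul_sum]
  rw [Finset.sum_comm]
  refine Finset.sum_congr rfl fun r _ => Finset.sum_congr rfl fun q _ => ?_
  rw [Sym2.eq_swap]
  ring

/-- base matrix entries -/
noncomputable def baseX {k : Type*} [Field k] {n : ℕ} (cs : Sym2 (Fin n) → k)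
    (c : Sym2 (Fin n) → ℕ) (F : Set (Sym2 (Fin n))) (e : Sym2 (Fin n)) : PowerSeries k :=
  if e ∈ F then 0 else PowerSeries.C (cs e) * PowerSeries.X ^ c e

theorem main_lemma {k : Type*} [Field k] {n : ℕ} (cs : Sym2 (Fin n) → k)
    (c : Sym2 (Fin n) → ℕ) (F : Set (Sym2 (Fin n))) (D : Finset (Fin n))
    (hF : ∀ r q, s(r, q) ∈ F → r ∈ D)
    (u : Fin n → Fin n → PowerSeries k)
    (hu1 : ∀ e ∈ D, ∀ d ∈ D, u e d = if d = e then 1 else 0)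
    (hu2 : ∀ e ∈ D, ∀ r ∉ D, ∑ q, baseX cs c F s(r, q) * u e q = 0)
    (R : Fin n → Fin n → PowerSeries k) (hRsymm : ∀ d ∈ D, ∀ e ∈ D, R d e = R e d)
    (hR1 : ∀ d ∈ D, ∀ e ∈ D, s(d, e) ∉ F → R d e = schurS (baseX cs c F) u d e)
    (hR2 : ∀ d ∈ D, ∀ e ∈ D, s(d, e) ∈ F →
      PowerSeries.X ^ (c s(d, e) + 1) ∣ R d e - schurS (baseX cs c F) u d e)
    (ρ ρ' : Fin n → PowerSeries k)
    (hρ : ∀ d ∈ D, ∑ e ∈ D, R d e * ρ e = 0) (hρ' : ∀ d ∈ D, ∑ e ∈ D, R d e * ρ' e = 0)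
    (p q : Fin n) (hp : p ∈ D) (hq : q ∈ D) (hpq : ρ p * ρ' q ≠ ρ q * ρ' p) :
    ∃ g : Sym2 (Fin n) → PowerSeries k,
      (∀ e, PowerSeries.constantCoeff (g e) = if e ∈ F then 0 else cs e) ∧
      ∀ f f' : Fin (n - 1) → Fin n, Function.Injective f → Function.Injective f' →
      ((Matrix.of fun i j => PowerSeries.X ^ c s(i, j) * g s(i, j)).submatrix f f').det = 0 := by
  set x0 := baseX cs c F with hx0
  have hS := schurS_symm x0 D u hu1 hu2
  have hF' : ∀ r q, s(r, q) ∈ F → q ∈ D := fun r q h => hF q r (by rwa [Sym2.eq_swap])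
  have hex : ∀ e : Sym2 (Fin n), ∃ g : PowerSeries k,
      (PowerSeries.constantCoeff g = if e ∈ F then 0 else cs e) ∧
      ∀ d q, e = s(d, q) → PowerSeries.X ^ c e * g = x0 e +
        if e ∈ F then R d q - schurS x0 u d q else 0 := by
    intro e
    by_cases he : e ∈ F
    · induction e with
      | _ a b =>
        obtain ⟨h, hh⟩ := hR2 a (hF a b he) b (hF' a b he) he
        refine ⟨PowerSeries.X * h, by simp [he], ?_⟩
        intro d q hdq
        have : R d q - schurS x0 u d q = R a b - schurS x0 u a b := by
          rcases Sym2.eq_iff.1 hdq with ⟨rfl, rfl⟩ | ⟨rfl, rfl⟩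
          · rfl
          · rw [hRsymm _ (hF' _ _ he) _ (hF _ _ he), hS _ _ (hF' _ _ he) (hF _ _ he)]
        rw [if_pos he, this, hh, hx0, baseX, if_pos he]
        ring
    · refine ⟨PowerSeries.C (cs e), by simp [he], ?_⟩
      intro d q _
      rw [hx0, baseX]
      simp [he, mul_comm]
  choose g hg1 hg2 using hex
  refine ⟨g, hg1, ?_⟩
  set Y : Matrix (Fin n) (Fin n) (PowerSeries k) :=
    Matrix.of fun i j => PowerSeries.X ^ c s(i, j) * g s(i, j) with hY
  have hYe : ∀ r q, Y r q = x0 s(r, q) + if s(r, q) ∈ F then R r q - schurS x0 u r q else 0 :=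
    fun r q => hg2 s(r, q) r q rfl
  have hYu : ∀ e ∈ D, ∀ r, ∑ q, Y r q * u e q = if r ∈ D then R r e else 0 := by
    intro e he r
    simp only [hYe, add_mul, Finset.sum_add_distrib]
    by_cases hr : r ∈ D
    · rw [if_pos hr]
      have h2 : ∑ q, (if s(r, q) ∈ F then R r q - schurS x0 u r q else 0) * u e q =
          if s(r, e) ∈ F then R r e - schurS x0 u r e else 0 := by
        rw [Finset.sum_eq_single e]
        · rw [hu1 e he e he]; simp
        · intro q _ hqe
          by_cases hq : s(r, q) ∈ F
          · rw [hu1 e he q (hF' _ _ hq), if_neg hqe, mul_zero]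
          · rw [if_neg hq, zero_mul]
        · simp
      rw [h2]
      change schurS x0 u r e + _ = _
      split_ifs with h
      · ring
      · rw [hR1 r hr e he h, add_zero]
    · rw [if_neg hr, hu2 e he r hr, zero_add]
      refine Finset.sum_eq_zero fun q _ => ?_
      rw [if_neg (fun h => hr (hF _ _ h)), zero_mul]
  have hker : ∀ ρ : Fin n → PowerSeries k, (∀ d ∈ D, ∑ e ∈ D, R d e * ρ e = 0) →
      Y.mulVec (fun q => ∑ e ∈ D, ρ e * u e q) = 0 := by
    intro ρ hρ
    ext1 r
    simp only [Matrix.mulVec, dotProduct, Finset.mul_sum, Pi.zero_apply]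
    rw [Finset.sum_comm]
    have : ∀ e ∈ D, ∑ q, Y r q * (ρ e * u e q) = if r ∈ D then R r e * ρ e else 0 := by
      intro e he
      have := hYu e he r
      calc _ = ρ e * ∑ q, Y r q * u e q := by
            rw [Finset.mul_sum]; exact Finset.sum_congr rfl fun q _ => by ring
        _ = _ := by
            rw [this]; split_ifs
            · ring
            · simp
    rw [Finset.sum_congr rfl this]
    split_ifs with h
    · exact hρ r h
    · simp
  have hval : ∀ ρ : Fin n → PowerSeries k, ∀ d ∈ D, ∑ e ∈ D, ρ e * u e d = ρ d := by
    intro ρ d hd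
    rw [Finset.sum_eq_single d]
    · rw [hu1 d hd d hd]; simp
    · intro e he hne
      rw [hu1 e he d hd, if_neg hne.symm, mul_zero]
    · exact fun h => absurd hd h
  intro f f' _ hf'
  apply rank_lemma Y _ _ (hker ρ hρ) (hker ρ' hρ') p q _ f f' hf'
  simp only [hval _ p hp, hval _ q hq]
  exact hpq


theorem quad_solve {k : Type*} [Field k] (κ0 κ1 : PowerSeries k) (h : PowerSeries.X ∣ κ0) :
    ∃ z, z = κ0 + κ1 * z ^ 2 ∧ κ0 ∣ z := by
  have hs : PowerSeries.HasSubst (κ0 * κ1) := PowerSeries.HasSubst.of_constantCoeff_zero' (by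
    rw [map_mul, PowerSeries.X_dvd_iff.1 h, zero_mul])
  let Cat : PowerSeries k := PowerSeries.map (Nat.castRingHom k) PowerSeries.catalanSeries
  have hC : Cat ^ 2 * PowerSeries.X + 1 = Cat := by
    have := congrArg (PowerSeries.map (Nat.castRingHom k))
      PowerSeries.catalanSeries_sq_mul_X_add_one
    simpa using this
  have h2 := congrArg (PowerSeries.substAlgHom hs) hC
  rw [map_add, map_mul, map_pow, map_one, PowerSeries.substAlgHom_X] at h2
  refine ⟨κ0 * PowerSeries.substAlgHom hs Cat, ?_, Dvd.intro _ rfl⟩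
  linear_combination -κ0 * h2

/-- exact order -/
def HasOrd {k : Type*} [Field k] (a : PowerSeries k) (m : ℕ) : Prop :=
  ∃ g, a = PowerSeries.X ^ m * g ∧ PowerSeries.constantCoeff g ≠ 0

section
variable {k : Type*} [Field k]

theorem HasOrd.dvd {a : PowerSeries k} {m : ℕ} (h : HasOrd a m) : PowerSeries.X ^ m ∣ a := by
  obtain ⟨g, rfl, _⟩ := h
  exact Dvd.intro _ rfl

theorem HasOrd.ne_zero {a : PowerSeries k} {m : ℕ} (h : HasOrd a m) : a ≠ 0 := by
  obtain ⟨g, rfl, hg⟩ := h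
  refine mul_ne_zero (pow_ne_zero _ PowerSeries.X_ne_zero) ?_
  rintro rfl
  simp at hg

theorem HasOrd.mul {a b : PowerSeries k} {m p : ℕ} (h : HasOrd a m) (h' : HasOrd b p) :
    HasOrd (a * b) (m + p) := by
  obtain ⟨g, rfl, hg⟩ := h
  obtain ⟨g', rfl, hg'⟩ := h'
  exact ⟨g * g', by ring, by rw [map_mul]; exact mul_ne_zero hg hg'⟩

theorem HasOrd.add {a b : PowerSeries k} {m : ℕ} (h : HasOrd a m)
    (h' : PowerSeries.X ^ (m + 1) ∣ b) : HasOrd (a + b) m := by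
  obtain ⟨g, rfl, hg⟩ := h
  obtain ⟨g', rfl⟩ := h'
  exact ⟨g + PowerSeries.X * g', by ring, by simpa using hg⟩

theorem HasOrd.div {a b : PowerSeries k} {m p : ℕ} (h : HasOrd a m)
    (h' : PowerSeries.X ^ (m + p) ∣ b) : ∃ r, a * r = b ∧ PowerSeries.X ^ p ∣ r := by
  obtain ⟨g, rfl, hg⟩ := h
  obtain ⟨g', rfl⟩ := h'
  refine ⟨PowerSeries.X ^ p * (g⁻¹ * g'), ?_, Dvd.intro _ rfl⟩
  have := PowerSeries.mul_inv_cancel g hg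
  calc _ = PowerSeries.X ^ (m + p) * ((g * g⁻¹) * g') := by ring
    _ = _ := by rw [this, one_mul]

theorem pow_dvd_mul {a b : PowerSeries k} {m p q : ℕ} (h : PowerSeries.X ^ m ∣ a)
    (h' : PowerSeries.X ^ p ∣ b) (hq : q ≤ m + p) : PowerSeries.X ^ q ∣ a * b :=
  (pow_dvd_pow _ hq).trans (by rw [pow_add]; exact mul_dvd_mul h h')

theorem pow_dvd_le {a : PowerSeries k} {m q : ℕ} (h : PowerSeries.X ^ m ∣ a)
    (hq : q ≤ m) : PowerSeries.X ^ q ∣ a := (pow_dvd_pow _ hq).trans h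

end

/-- All data of a deformation problem. -/
structure SD (k : Type*) [Field k] (n : ℕ) where
  /-- the graph -/
  G : SimpleGraph (Fin n)
  /-- the forest -/
  T : SimpleGraph (Fin n)
  /-- a large number -/
  N : ℕ
  /-- another number -/
  M : ℕ
  hTG : T ≤ G
  hT : T.IsAcyclic
  hspan : ∀ u v : Fin n, T.Reachable u v ↔ G.Reachable u v
  hN : n + 2 ≤ N
  /-- generic constants -/
  cs : Sym2 (Fin n) → k
  hcs : ∀ e, cs e ≠ 0
  /-- vanishing set -/
  F : Set (Sym2 (Fin n))
  /-- core indices -/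
  D : Finset (Fin n)
  hF : ∀ r q, s(r, q) ∈ F → r ∈ D
  /-- solutions -/
  u : Fin n → Fin n → PowerSeries k
  hu1 : ∀ e ∈ D, ∀ d ∈ D, u e d = if d = e then 1 else 0
  hu2 : ∀ e ∈ D, ∀ r ∉ D, ∑ q, baseX cs (ecost G T N M) F s(r, q) * u e q = 0

namespace SD
variable {k : Type*} [Field k] {n : ℕ} (P : SD k n)

/-- cost -/
noncomputable def c (e : Sym2 (Fin n)) : ℕ := ecost P.G P.T P.N P.M e
/-- base -/
noncomputable def x0 (e : Sym2 (Fin n)) : PowerSeries k := baseX P.cs P.c P.F e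
/-- reduced entry -/
noncomputable def S (d e : Fin n) : PowerSeries k := schurS P.x0 P.u d e
/-- off-diagonal part -/
noncomputable def W (r e : Fin n) : PowerSeries k := ∑ q ∈ Finset.univ.erase r, P.x0 s(r, q) * P.u e q

theorem x0_dvd (e : Sym2 (Fin n)) : PowerSeries.X ^ P.c e ∣ P.x0 e := by
  unfold x0 baseX
  split_ifs
  · exact dvd_zero _
  · exact Dvd.intro_left _ rfl

theorem x0_ord (e : Sym2 (Fin n)) (h : e ∉ P.F) : HasOrd (P.x0 e) (P.c e) := by
  unfold x0 baseX
  rw [if_neg h]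
  exact ⟨_, mul_comm _ _, by simpa using P.hcs e⟩

theorem x0_mem (e : Sym2 (Fin n)) (h : e ∈ P.F) : P.x0 e = 0 := by
  unfold x0 baseX
  rw [if_pos h]

theorem c_diag (r : Fin n) : P.c s(r, r) = 0 := ecost_diag _ _ _ _ r
theorem c_pos {r q : Fin n} (h : r ≠ q) : 1 ≤ P.c s(r, q) := ecost_pos _ _ _ _ h

theorem split (r e : Fin n) : ∑ q, P.x0 s(r, q) * P.u e q = P.x0 s(r, r) * P.u e r + P.W r e := by
  rw [W, ← Finset.add_sum_erase _ _ (Finset.mem_univ r)]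

theorem S_symm {d e : Fin n} (hd : d ∈ P.D) (he : e ∈ P.D) : P.S d e = P.S e d :=
  schurS_symm _ P.D P.u P.hu1 P.hu2 d e hd he

theorem S_eq_W {d e : Fin n} (hd : d ∈ P.D) (he : e ∈ P.D) (h : d ≠ e) : P.S d e = P.W d e := by
  unfold S schurS
  rw [split, P.hu1 e he d hd, if_neg h, mul_zero, zero_add]

theorem u_eq {r e : Fin n} (hr : r ∉ P.D) (he : e ∈ P.D) :
    P.x0 s(r, r) * P.u e r = - P.W r e := by
  have : ∑ q, P.x0 s(r, q) * P.u e q = 0 := P.hu2 e he r hr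
  rw [split] at this
  exact eq_neg_of_add_eq_zero_left this

theorem diag_notMem {r : Fin n} (hr : r ∉ P.D) : s(r, r) ∉ P.F := fun h => hr (P.hF _ _ h)

theorem x0_diag_unit {r : Fin n} (hr : s(r, r) ∉ P.F) : HasOrd (P.x0 s(r, r)) 0 := by
  have := P.x0_ord _ hr
  rwa [P.c_diag] at this

theorem u_of_W {r e : Fin n} {m : ℕ} (hr : r ∉ P.D) (he : e ∈ P.D)
    (h : PowerSeries.X ^ m ∣ P.W r e) : PowerSeries.X ^ m ∣ P.u e r := by
  obtain ⟨t, ht, hd⟩ := (P.x0_diag_unit (P.diag_notMem hr)).div (b := - P.W r e) (p := m)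
    (by rw [zero_add]; exact (dvd_neg.2 h))
  rw [← P.u_eq hr he] at ht
  rwa [← mul_left_cancel₀ (P.x0_diag_unit (P.diag_notMem hr)).ne_zero ht]

theorem u_of_W_ord {r e : Fin n} {m : ℕ} (hr : r ∉ P.D) (he : e ∈ P.D)
    (h : HasOrd (P.W r e) m) : HasOrd (P.u e r) m := by
  obtain ⟨g, hg, hg0⟩ := h
  obtain ⟨g1, h1, h10⟩ := P.x0_diag_unit (P.diag_notMem hr)
  have := P.u_eq hr he
  rw [h1, hg, pow_zero, one_mul] at this
  refine ⟨- g1⁻¹ * g, ?_, ?_⟩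
  · have h2 := PowerSeries.mul_inv_cancel g1 h10
    linear_combination g1⁻¹ * this - P.u e r * h2
  · simpa using ⟨h10, hg0⟩

theorem u_dvd {e : Fin n} (he : e ∈ P.D) (φ : Fin n → ℕ) (h0 : φ e = 0)
    (hφ : ∀ r, r ∉ P.D → ∀ q, q ≠ r → φ r ≤ P.c s(r, q) + φ q) (r : Fin n) :
    PowerSeries.X ^ φ r ∣ P.u e r := by
  have key : ∀ j, ∀ r, PowerSeries.X ^ (min (φ r) j) ∣ P.u e r := by
    intro j
    induction j with
    | zero => intro r; simp
    | succ j ih =>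
      intro r
      by_cases hr : r ∈ P.D
      · rw [P.hu1 e he r hr]
        split_ifs with h
        · subst h; simp [h0]
        · exact dvd_zero _
      · apply P.u_of_W hr he
        apply Finset.dvd_sum
        intro q hq
        have hqr := Finset.ne_of_mem_erase hq
        refine pow_dvd_mul (P.x0_dvd _) (ih q) ?_
        have := hφ r hr q hqr
        have := P.c_pos hqr.symm
        omega
  have := key (φ r) r
  rwa [min_self] at this

/-- general upper estimate -/
theorem W_dvd {e : Fin n} (he : e ∈ P.D) (φ : Fin n → ℕ) (h0 : φ e = 0)
    (hφ : ∀ r, r ∉ P.D → ∀ q, q ≠ r → φ r ≤ P.c s(r, q) + φ q) (d : Fin n) (m : ℕ)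
    (hm : ∀ q, q ≠ d → s(d, q) ∉ P.F → m ≤ P.c s(d, q) + φ q) : PowerSeries.X ^ m ∣ P.W d e := by
  apply Finset.dvd_sum
  intro q hq
  have hqr := Finset.ne_of_mem_erase hq
  by_cases h : s(d, q) ∈ P.F
  · rw [P.x0_mem _ h, zero_mul]; exact dvd_zero _
  · exact pow_dvd_mul (P.x0_dvd _) (P.u_dvd he φ h0 hφ q) (hm q hqr h)

theorem W_ord {e : Fin n} (he : e ∈ P.D) (φ : Fin n → ℕ) (hφ : Pot P.c e φ) (r q : Fin n)
    (hr : r ≠ e) (hq : q ≠ r) (ht : φ r = P.c s(r, q) + φ q) (hF : s(r, q) ∉ P.F)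
    (hu : HasOrd (P.u e q) (φ q)) : HasOrd (P.W r e) (φ r) := by
  unfold W
  rw [← Finset.add_sum_erase _ _ (Finset.mem_erase.2 ⟨hq, Finset.mem_univ q⟩)]
  apply HasOrd.add
  · rw [ht]
    exact (P.x0_ord _ hF).mul hu
  · apply Finset.dvd_sum
    intro q' hq'
    have h1 := Finset.ne_of_mem_erase hq'
    have h2 := Finset.ne_of_mem_erase (Finset.mem_of_mem_erase hq')
    refine pow_dvd_mul (P.x0_dvd _) (P.u_dvd he φ hφ.zero
      (fun r' hr' q _ => hφ.le r' (by rintro rfl; exact hr' he) q) q') ?_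
    have h3 := hφ.le r hr q'
    have h4 : φ r ≠ P.c s(r, q') + φ q' := fun h => h1 (hφ.uniq r hr q' q h2 hq h ht)
    omega

theorem S_diag {d : Fin n} (hd : d ∈ P.D) : PowerSeries.X ^ 1 ∣ P.W d d := by
  apply P.W_dvd hd (fun r => 0) rfl (by simp)
  intro q hq _
  have := P.c_pos hq.symm
  omega

theorem S_diag_mem {d : Fin n} (hd : d ∈ P.D) (h : s(d, d) ∈ P.F) :
    PowerSeries.X ^ 1 ∣ P.S d d := by
  unfold S schurS
  rw [split, P.x0_mem _ h, zero_mul, zero_add]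
  exact P.S_diag hd

theorem S_diag_notMem {d : Fin n} (hd : d ∈ P.D) (h : s(d, d) ∉ P.F) : HasOrd (P.S d d) 0 := by
  unfold S schurS
  rw [split, P.hu1 d hd d hd, if_pos rfl, mul_one]
  exact (P.x0_diag_unit h).add (P.S_diag hd)

theorem dist_path {T : SimpleGraph (Fin n)} (hT : T.IsAcyclic) {a b : Fin n} (p : T.Walk a b)
    (hp : p.IsPath) : T.dist a b = p.length := by
  obtain ⟨q, hq, hl⟩ := (SimpleGraph.Walk.reachable p).exists_path_of_dist
  have := hT.path_unique ⟨p, hp⟩ ⟨q, hq⟩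
  simp only [Subtype.mk.injEq] at this
  rw [this, hl]

theorem W_path {e : Fin n} (he : e ∈ P.D) {r : Fin n} (p : P.T.Walk r e) (hp : p.IsPath)
    (hD : ∀ x ∈ p.support, x ≠ r → x ≠ e → x ∉ P.D) (hE : ∀ x ∈ p.edges, x ∉ P.F) (hre : r ≠ e) :
    HasOrd (P.W r e) (P.T.dist r e) := by
  induction p with
  | nil => exact absurd rfl hre
  | @cons r q e h p ih =>
    have hp' := hp
    rw [SimpleGraph.Walk.cons_isPath_iff] at hp
    have hpot := phi1_pot P.G P.T P.N P.M P.hT (by have := P.hN; omega) e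
    have hd := dist_path P.hT _ hp'
    have hd' := dist_path P.hT _ hp.1
    have hr1 : P.T.Reachable q e := SimpleGraph.Walk.reachable p
    have hr2 : P.T.Reachable r e := h.reachable.trans hr1
    have e1 : phi1 P.T P.N e r = P.T.dist r e := by rw [phi1, if_pos hr2]
    have e2 : phi1 P.T P.N e q = P.T.dist q e := by rw [phi1, if_pos hr1]
    rw [← e1]
    refine P.W_ord he _ hpot r q hre h.ne' ?_ (hE _ (by simp)) ?_
    · rw [e1, e2, hd, hd', c, ecost_edge _ _ _ _ h]
      simp [add_comm]
    · rw [e2]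
      by_cases hqe : q = e
      · subst hqe
        rw [P.hu1 q he q he]
        simp only [if_true, SimpleGraph.dist_self]
        exact ⟨1, by simp, by simp⟩
      · apply P.u_of_W_ord (hD q (by simp) h.ne' hqe) he
        apply ih he hp.1 _ _ hqe
        · intro x hx hxq hxe
          refine hD x (by simp [hx]) ?_ hxe
          rintro rfl
          exact hp.2 hx
        · intro x hx
          exact hE x (by simp [hx])

theorem S_path {d e : Fin n} (hd : d ∈ P.D) (he : e ∈ P.D) (p : P.T.Walk d e) (hp : p.IsPath)
    (hD : ∀ x ∈ p.support, x ≠ d → x ≠ e → x ∉ P.D) (hE : ∀ x ∈ p.edges, x ∉ P.F) (hre : d ≠ e) :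
    HasOrd (P.S d e) (P.T.dist d e) := by
  rw [P.S_eq_W hd he hre]
  exact P.W_path he p hp hD hE hre

theorem S_far {d e : Fin n} (hd : d ∈ P.D) (he : e ∈ P.D) (h : ¬ P.T.Reachable d e)
    (hF : s(d, e) ∉ P.F) : HasOrd (P.S d e) (P.M + P.N + 1) := by
  have hde : d ≠ e := by rintro rfl; exact h (SimpleGraph.Reachable.refl _)
  have hpot := phi2_pot P.G P.T P.N P.M P.hTG P.hspan e
  have e1 : phi2 P.T P.N P.M e d = P.M + P.N + 1 := by rw [phi2, if_neg hde, if_neg h]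
  rw [P.S_eq_W hd he hde, ← e1]
  refine P.W_ord he _ hpot d e hde hde.symm ?_ hF ?_
  · rw [e1, hpot.zero, c, ecost_unreach _ _ _ _ P.hTG (fun h' => h ((P.hspan _ _).2 h'))]
  · rw [hpot.zero, P.hu1 e he e he, if_pos rfl]
    exact ⟨1, by simp, by simp⟩

theorem S_far_mem {d e : Fin n} (hd : d ∈ P.D) (he : e ∈ P.D) (h : ¬ P.T.Reachable d e)
    (hF : s(d, e) ∈ P.F) : PowerSeries.X ^ (P.c s(d, e) + 1) ∣ P.S d e := by
  have hde : d ≠ e := by rintro rfl; exact h (SimpleGraph.Reachable.refl _)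
  have hpot := phi2_pot P.G P.T P.N P.M P.hTG P.hspan e
  have e1 : phi2 P.T P.N P.M e d = P.M + P.N + 1 := by rw [phi2, if_neg hde, if_neg h]
  have e2 : P.c s(d, e) = P.M + P.N + 1 := by
    rw [c, ecost_unreach _ _ _ _ P.hTG (fun h' => h ((P.hspan _ _).2 h'))]
  rw [P.S_eq_W hd he hde]
  refine P.W_dvd he _ hpot.zero (fun r hr q _ => hpot.le r (by rintro rfl; exact hr he) q) d _ ?_
  intro q hq hqF
  have hqe : q ≠ e := by rintro rfl; exact hqF hF
  have h3 := hpot.le d hde q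
  have h4 : phi2 P.T P.N P.M e d ≠ P.c s(d, q) + phi2 P.T P.N P.M e q := fun h =>
    hqe (hpot.uniq d hde q e hq hde.symm h (by rw [hpot.zero, e1]; exact e2.symm))
  have h5 : phi2 P.T P.N P.M e d ≤ P.c s(d, q) + phi2 P.T P.N P.M e q := h3
  omega

/-- crude estimate across an edge of the forest -/
theorem S_cross (U : Set (Fin n)) (a b : Fin n) (ha : a ∈ P.D) (hb : b ∈ P.D)
    (hF : s(a, b) ∈ P.F) (hU : ∀ x y, x ∈ U → y ∉ U → P.T.Adj x y → x = a ∧ y = b)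
    {d e : Fin n} (hd : d ∈ P.D) (he : e ∈ P.D) (hdU : d ∉ U) (heU : e ∈ U) :
    PowerSeries.X ^ (P.N + 1) ∣ P.S d e := by
  have hde : d ≠ e := by rintro rfl; exact hdU heU
  rw [P.S_eq_W hd he hde]
  refine P.W_dvd he (fun r => if r = e then 0 else if r ∈ U then 1 else P.N + 1) (by simp) ?_ d _ ?_
  · intro r hr q hqr
    have hre : r ≠ e := by rintro rfl; exact hr he
    have h1 := P.c_pos hqr.symm
    simp only [if_neg hre]
    by_cases hrU : r ∈ U
    · rw [if_pos hrU]; omega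
    · rw [if_neg hrU]
      by_cases hqU : q ∈ U
      · have h2 : ¬ P.T.Adj r q := by
          intro h
          have := (hU q r hqU hrU h.symm).2
          exact hr (this ▸ hb)
        have := ecost_nonedge P.G P.T P.N P.M hqr.symm h2
        unfold c
        omega
      · have hqe : q ≠ e := by rintro rfl; exact hqU heU
        rw [if_neg hqe, if_neg hqU]; omega
  · intro q hqd hqF
    by_cases hqU : q ∈ U
    · have h2 : ¬ P.T.Adj d q := by
        intro h
        obtain ⟨rfl, rfl⟩ := hU q d hqU hdU h.symm
        exact hqF (by rwa [Sym2.eq_swap])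
      have := ecost_nonedge P.G P.T P.N P.M hqd.symm h2
      unfold c
      omega
    · have hqe : q ≠ e := by rintro rfl; exact hqU heU
      simp only [if_neg hqe, if_neg hqU]; omega

/-- The conclusion. -/
def Good : Prop := ∃ g : Sym2 (Fin n) → PowerSeries k,
      (∀ e, PowerSeries.constantCoeff (g e) = if e ∈ P.F then 0 else P.cs e) ∧
      ∀ f f' : Fin (n - 1) → Fin n, Function.Injective f → Function.Injective f' →
      ((Matrix.of fun i j => PowerSeries.X ^ P.c s(i, j) * g s(i, j)).submatrix f f').det = 0

theorem good_of (R : Fin n → Fin n → PowerSeries k)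
    (hRsymm : ∀ d ∈ P.D, ∀ e ∈ P.D, R d e = R e d)
    (hR1 : ∀ d ∈ P.D, ∀ e ∈ P.D, s(d, e) ∉ P.F → R d e = P.S d e)
    (hR2 : ∀ d ∈ P.D, ∀ e ∈ P.D, s(d, e) ∈ P.F →
      PowerSeries.X ^ (P.c s(d, e) + 1) ∣ R d e ∧ PowerSeries.X ^ (P.c s(d, e) + 1) ∣ P.S d e)
    (ρ ρ' : Fin n → PowerSeries k)
    (hρ : ∀ d ∈ P.D, ∑ e ∈ P.D, R d e * ρ e = 0) (hρ' : ∀ d ∈ P.D, ∑ e ∈ P.D, R d e * ρ' e = 0)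
    (p q : Fin n) (hp : p ∈ P.D) (hq : q ∈ P.D) (hpq : ρ p * ρ' q ≠ ρ q * ρ' p) : P.Good :=
  main_lemma P.cs P.c P.F P.D P.hF P.u P.hu1 P.hu2 R hRsymm hR1
    (fun d hd e he h => dvd_sub (hR2 d hd e he h).1 (hR2 d hd e he h).2) ρ ρ' hρ hρ' p q hp hq hpq

end SD


namespace SD
variable {k : Type*} [Field k] {n : ℕ} (P : SD k n)

theorem good_A {i j l : Fin n} (hij : i ≠ j) (hil : i ≠ l) (hjl : j ≠ l) (hD : P.D = {i, j, l})
    (hF : P.F = {s(i, i), s(j, j), s(l, l)}) {dij dil djl : ℕ}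
    (h1 : HasOrd (P.S i j) dij) (h2 : HasOrd (P.S i l) dil) (h3 : HasOrd (P.S j l) djl)
    (t1 : dij < dil + djl) (t2 : dil < dij + djl) (t3 : djl < dij + dil) : P.Good := by
  have hi : i ∈ P.D := by simp [hD]
  have hj : j ∈ P.D := by simp [hD]
  have hl : l ∈ P.D := by simp [hD]
  have sij := P.S_symm hi hj
  have sil := P.S_symm hi hl
  have sjl := P.S_symm hj hl
  obtain ⟨ri, ri1, ri2⟩ := h3.div (p := 1) (b := P.S i j * P.S i l) (pow_dvd_mul h1.dvd h2.dvd (by omega))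
  obtain ⟨rj, rj1, rj2⟩ := h2.div (p := 1) (b := P.S i j * P.S j l) (pow_dvd_mul h1.dvd h3.dvd (by omega))
  obtain ⟨rl, rl1, rl2⟩ := h1.div (p := 1) (b := P.S i l * P.S j l) (pow_dvd_mul h2.dvd h3.dvd (by omega))
  obtain ⟨R, hR⟩ : ∃ R : Fin n → Fin n → PowerSeries k, ∀ d e, R d e =
    if d = e then (if d = i then ri else if d = j then rj else rl) else P.S d e := ⟨_, fun _ _ => rfl⟩
  have Rii : R i i = ri := by simp [hR]
  have Rjj : R j j = rj := by simp [hR, hij.symm]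
  have Rll : R l l = rl := by simp [hR, hil.symm, hjl.symm]
  have Rij : R i j = P.S i j := by simp [hR, hij]
  have Ril : R i l = P.S i l := by simp [hR, hil]
  have Rjl : R j l = P.S j l := by simp [hR, hjl]
  have Rji : R j i = P.S i j := by simp [hR, hij.symm, sij]
  have Rli : R l i = P.S i l := by simp [hR, hil.symm, sil]
  have Rlj : R l j = P.S j l := by simp [hR, hjl.symm, sjl]
  obtain ⟨ρ, hρ⟩ : ∃ ρ : Fin n → PowerSeries k, ∀ d, ρ d =
    if d = i then P.S j l else if d = j then - P.S i l else 0 := ⟨_, fun _ => rfl⟩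
  obtain ⟨ρ', hρ'⟩ : ∃ ρ : Fin n → PowerSeries k, ∀ d, ρ d =
    if d = i then 0 else if d = j then P.S i l else - P.S i j := ⟨_, fun _ => rfl⟩
  have a1 : ρ i = P.S j l := by simp [hρ]
  have a2 : ρ j = - P.S i l := by simp [hρ, hij.symm]
  have a3 : ρ l = 0 := by simp [hρ, hil.symm, hjl.symm]
  have b1 : ρ' i = 0 := by simp [hρ']
  have b2 : ρ' j = P.S i l := by simp [hρ', hij.symm]
  have b3 : ρ' l = - P.S i j := by simp [hρ', hil.symm, hjl.symm]
  have hsum : ∀ f : Fin n → PowerSeries k, ∑ e ∈ P.D, f e = f i + f j + f l := by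
    intro f
    rw [hD, Finset.sum_insert (by simp [hij, hil]), Finset.sum_insert (by simp [hjl]),
      Finset.sum_singleton]
    ring
  have hcase : ∀ d ∈ P.D, d = i ∨ d = j ∨ d = l := by
    intro d hd; simpa [hD] using hd
  refine P.good_of R ?_ ?_ ?_ ρ ρ' ?_ ?_ i j hi hj ?_
  · intro d hd e he
    rcases hcase d hd with rfl | rfl | rfl <;> rcases hcase e he with rfl | rfl | rfl <;>
      simp only [Rij, Rji, Ril, Rli, Rjl, Rlj]
  · intro d hd e he hde
    by_cases h : d = e
    · subst h
      exfalso
      apply hde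
      rw [hF]
      rcases hcase d hd with rfl | rfl | rfl <;> simp
    · rw [hR, if_neg h]
  · intro d hd e he hde
    have h : d = e := by
      by_contra h
      rw [hF] at hde
      simp only [Set.mem_insert_iff, Set.mem_singleton_iff, Sym2.eq_iff] at hde
      rcases hde with h' | h' | h' <;> rcases h' with h' | h' <;>
        exact h (h'.1.trans h'.2.symm)
    subst h
    rw [P.c_diag, zero_add]
    refine ⟨?_, P.S_diag_mem hd hde⟩
    rcases hcase d hd with rfl | rfl | rfl
    · rwa [Rii]
    · rwa [Rjj]
    · rwa [Rll]
  · intro d hd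
    rw [hsum, a1, a2, a3]
    rcases hcase d hd with rfl | rfl | rfl
    · rw [Rii, Rij]; linear_combination ri1
    · rw [Rji, Rjj]; linear_combination -rj1
    · rw [Rli, Rlj]; ring
  · intro d hd
    rw [hsum, b1, b2, b3]
    rcases hcase d hd with rfl | rfl | rfl
    · rw [Rij, Ril]; ring
    · rw [Rjj, Rjl]; linear_combination rj1
    · rw [Rlj, Rll]; linear_combination -rl1
  · rw [a1, b2, b1, mul_zero]
    exact mul_ne_zero h3.ne_zero h2.ne_zero

theorem good_B {i j : Fin n} (hij : i ≠ j) (hD : P.D = {i, j})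
    (hF : P.F = {s(i, i), s(j, j), s(i, j)})
    (h1 : PowerSeries.X ^ (P.c s(i, j) + 1) ∣ P.S i j) : P.Good := by
  have hi : i ∈ P.D := by simp [hD]
  have hj : j ∈ P.D := by simp [hD]
  have hcase : ∀ d ∈ P.D, d = i ∨ d = j := by
    intro d hd; simpa [hD] using hd
  have hii : s(i, i) ∈ P.F := by simp [hF]
  have hjj : s(j, j) ∈ P.F := by simp [hF]
  have hij' : s(i, j) ∈ P.F := by simp [hF]
  have hji' : s(j, i) ∈ P.F := by rw [Sym2.eq_swap]; exact hij'
  refine P.good_of (fun _ _ => 0) ?_ ?_ ?_ (Pi.single i 1) (Pi.single j 1) ?_ ?_ i j hi hj ?_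
  · intros; rfl
  · intro d hd e he hde
    exfalso
    apply hde
    rcases hcase d hd with rfl | rfl <;> rcases hcase e he with rfl | rfl <;> assumption
  · intro d hd e he hde
    refine ⟨dvd_zero _, ?_⟩
    rcases hcase d hd with rfl | rfl <;> rcases hcase e he with rfl | rfl
    · rw [P.c_diag]; exact P.S_diag_mem hd hde
    · exact h1
    · rw [Sym2.eq_swap, P.S_symm hd he]; exact h1
    · rw [P.c_diag]; exact P.S_diag_mem hd hde
  · simp
  · simp
  · simp [hij, hij.symm]

theorem good_C3 {i j b : Fin n} (hij : i ≠ j) (hib : i ≠ b) (hjb : j ≠ b) (hD : P.D = {i, j, b})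
    (hF : P.F = {s(i, i), s(j, j), s(i, b)}) (hc : P.c s(i, b) = 1) {p : ℕ} (hp : 1 ≤ p)
    (h1 : HasOrd (P.S b j) p) (h2 : PowerSeries.X ^ (p + 2) ∣ P.S i j)
    (h3 : PowerSeries.X ^ 2 ∣ P.S i b) : P.Good := by
  have hi : i ∈ P.D := by simp [hD]
  have hj : j ∈ P.D := by simp [hD]
  have hb : b ∈ P.D := by simp [hD]
  have sij := P.S_symm hi hj
  have sbj := P.S_symm hb hj
  have hbbF : s(b, b) ∉ P.F := by
    rw [hF]
    simp [hib.symm, hjb.symm]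
  have hbb := P.S_diag_notMem hb hbbF
  obtain ⟨z, z1, z2⟩ := h1.div (p := 2) (b := P.S i j * P.S b b) (h2.mul_right _)
  obtain ⟨ri, ri1, ri2⟩ := hbb.div (p := 1) (b := z ^ 2) (by
    rw [pow_two]; exact pow_dvd_mul z2 z2 (by omega))
  obtain ⟨rj, rj1, rj2⟩ := hbb.div (p := 1) (b := P.S b j ^ 2) (by
    rw [pow_two (P.S b j)]; exact pow_dvd_mul h1.dvd h1.dvd (by omega))
  obtain ⟨R, hR⟩ : ∃ R : Fin n → Fin n → PowerSeries k, ∀ d e, R d e =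
    if s(d, e) = s(i, i) then ri else if s(d, e) = s(j, j) then rj else
      if s(d, e) = s(i, b) then z else P.S d e := ⟨_, fun _ _ => rfl⟩
  have Rii : R i i = ri := by simp [hR]
  have Rjj : R j j = rj := by simp [hR, hij.symm]
  have Rib : R i b = z := by simp [hR, hib.symm, hij]
  have Rbi : R b i = z := by simp [hR, hib.symm, hij]
  have Rij : R i j = P.S i j := by simp [hR, hij, hij.symm, hjb]
  have Rji : R j i = P.S i j := by simp [hR, hij, hij.symm, hjb, sij]
  have Rbb : R b b = P.S b b := by simp [hR, hib.symm, hjb.symm]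
  have Rjb : R j b = P.S b j := by simp [hR, hij.symm, hjb.symm, sbj, hjb]
  have Rbj : R b j = P.S b j := by simp [hR, hij.symm, hjb.symm, hib.symm]
  obtain ⟨ρ, hρ⟩ : ∃ ρ : Fin n → PowerSeries k, ∀ d, ρ d =
    if d = i then P.S b b else if d = j then 0 else -z := ⟨_, fun _ => rfl⟩
  obtain ⟨ρ', hρ'⟩ : ∃ ρ : Fin n → PowerSeries k, ∀ d, ρ d =
    if d = i then 0 else if d = j then P.S b b else - P.S b j := ⟨_, fun _ => rfl⟩
  have a1 : ρ i = P.S b b := by simp [hρ]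
  have a2 : ρ j = 0 := by simp [hρ, hij.symm]
  have a3 : ρ b = -z := by simp [hρ, hib.symm, hjb.symm]
  have b1 : ρ' i = 0 := by simp [hρ']
  have b2 : ρ' j = P.S b b := by simp [hρ', hij.symm]
  have b3 : ρ' b = - P.S b j := by simp [hρ', hib.symm, hjb.symm]
  have hsum : ∀ f : Fin n → PowerSeries k, ∑ e ∈ P.D, f e = f i + f j + f b := by
    intro f
    rw [hD, Finset.sum_insert (by simp [hij, hib]), Finset.sum_insert (by simp [hjb]),
      Finset.sum_singleton]
    ring
  have hcase : ∀ d ∈ P.D, d = i ∨ d = j ∨ d = b := by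
    intro d hd; simpa [hD] using hd
  refine P.good_of R ?_ ?_ ?_ ρ ρ' ?_ ?_ i j hi hj ?_
  · intro d hd e he
    rcases hcase d hd with rfl | rfl | rfl <;> rcases hcase e he with rfl | rfl | rfl <;>
      simp only [Rij, Rji, Rib, Rbi, Rjb, Rbj]
  · intro d hd e he hde
    rw [hF] at hde
    simp only [Set.mem_insert_iff, Set.mem_singleton_iff, not_or] at hde
    rw [hR, if_neg hde.1, if_neg hde.2.1, if_neg hde.2.2]
  · intro d hd e he hde
    have hde' := hde
    rw [hF] at hde
    simp only [Set.mem_insert_iff, Set.mem_singleton_iff] at hde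
    rcases hde with h | h | h
    · rcases Sym2.eq_iff.1 h with ⟨rfl, rfl⟩ | ⟨rfl, rfl⟩ <;>
      · rw [Rii, P.c_diag]; exact ⟨ri2, P.S_diag_mem hi (by simp [hF])⟩
    · rcases Sym2.eq_iff.1 h with ⟨rfl, rfl⟩ | ⟨rfl, rfl⟩ <;>
      · rw [Rjj, P.c_diag]; exact ⟨rj2, P.S_diag_mem hj (by simp [hF])⟩
    · rw [h, hc]
      rcases Sym2.eq_iff.1 h with ⟨rfl, rfl⟩ | ⟨rfl, rfl⟩
      · rw [Rib]; exact ⟨z2, h3⟩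
      · rw [Rbi, P.S_symm hd he]; exact ⟨z2, h3⟩
  · intro d hd
    rw [hsum, a1, a2, a3]
    rcases hcase d hd with rfl | rfl | rfl
    · rw [Rii, Rij, Rib]; linear_combination ri1
    · rw [Rji, Rjj, Rjb]; linear_combination -z1
    · rw [Rbi, Rbb]; ring
  · intro d hd
    rw [hsum, b1, b2, b3]
    rcases hcase d hd with rfl | rfl | rfl
    · rw [Rij, Rib]; linear_combination -z1
    · rw [Rjj, Rjb]; linear_combination rj1
    · rw [Rbj, Rbb]; ring
  · rw [a1, b2, b1, mul_zero]
    exact mul_ne_zero hbb.ne_zero hbb.ne_zero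

theorem good_C4 {i j a b : Fin n} (hij : i ≠ j) (hia : i ≠ a) (hib : i ≠ b) (hja : j ≠ a)
    (hjb : j ≠ b) (hab : a ≠ b) (hD : P.D = {i, j, a, b})
    (hF : P.F = {s(i, i), s(j, j), s(a, b)}) (hc : P.c s(a, b) = 1) {p p' m : ℕ} (hp : 1 ≤ p)
    (hp' : 1 ≤ p') (hm : p + p' + 2 ≤ m)
    (h1 : HasOrd (P.S i a) p) (h2 : HasOrd (P.S j b) p') (h3 : PowerSeries.X ^ m ∣ P.S i j)
    (h4 : PowerSeries.X ^ m ∣ P.S i b) (h5 : PowerSeries.X ^ m ∣ P.S j a)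
    (h6 : PowerSeries.X ^ 2 ∣ P.S a b) : P.Good := by
  have hi : i ∈ P.D := by simp [hD]
  have hj : j ∈ P.D := by simp [hD]
  have ha : a ∈ P.D := by simp [hD]
  have hb : b ∈ P.D := by simp [hD]
  have haaF : s(a, a) ∉ P.F := by
    rw [hF]
    simp [hia.symm, hja.symm, hab]
  have hbbF : s(b, b) ∉ P.F := by
    rw [hF]
    simp [hib.symm, hjb.symm, hab.symm]
  have haa := P.S_diag_notMem ha haaF
  have hbb := P.S_diag_notMem hb hbbF
  -- solve the quadratic equation
  have hB1 : HasOrd (P.S i a * P.S j b + P.S i b * P.S j a) (p + p') :=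
    (h1.mul h2).add (pow_dvd_mul h4 h5 (by omega))
  obtain ⟨κ1, κ11, κ12⟩ := hB1.div (p := 2) (b := P.S i j) (pow_dvd_le h3 hm)
  obtain ⟨κ0, κ01, κ02⟩ := hB1.div (p := 2) (b := -(P.S i j * (P.S a a * P.S b b)
      - P.S j a * (P.S i a * P.S b b) - P.S i b * (P.S a a * P.S j b))) (by
    have h3' := pow_dvd_le h3 hm
    have h4' := pow_dvd_le h4 hm
    have h5' := pow_dvd_le h5 hm
    exact dvd_neg.2 (dvd_sub (dvd_sub (h3'.mul_right _) (h5'.mul_right _)) (h4'.mul_right _)))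
  obtain ⟨z, z1, z2⟩ := quad_solve κ0 κ1 ((dvd_pow_self _ two_ne_zero).trans κ02)
  have z2 : PowerSeries.X ^ 2 ∣ z := κ02.trans z2
  have hz : P.S i j * (P.S a a * P.S b b - z ^ 2) - P.S j a * (P.S i a * P.S b b)
      - P.S i b * (P.S a a * P.S j b) + z * (P.S i a * P.S j b + P.S i b * P.S j a) = 0 := by
    linear_combination (P.S i a * P.S j b + P.S i b * P.S j a) * z1 + κ01 + z ^ 2 * κ11
  have hΔ : HasOrd (P.S a a * P.S b b - z ^ 2) 0 := by
    rw [sub_eq_add_neg]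
    refine (haa.mul hbb).add (dvd_neg.2 ?_)
    rw [pow_two]
    exact pow_dvd_mul z2 z2 (by omega)
  obtain ⟨ri, ri1, ri2⟩ := hΔ.div (p := 1) (b := P.S i a * (P.S b b * P.S i a - z * P.S i b) +
      P.S i b * (P.S a a * P.S i b - z * P.S i a)) (by
    exact dvd_add ((pow_dvd_le h1.dvd (by omega)).mul_right _)
      ((pow_dvd_le h4 (by omega)).mul_right _))
  obtain ⟨rj, rj1, rj2⟩ := hΔ.div (p := 1) (b := P.S j a * (P.S b b * P.S j a - z * P.S j b) +
      P.S j b * (P.S a a * P.S j b - z * P.S j a)) (by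
    exact dvd_add ((pow_dvd_le h5 (by omega)).mul_right _)
      ((pow_dvd_le h2.dvd (by omega)).mul_right _))
  obtain ⟨R, hR⟩ : ∃ R : Fin n → Fin n → PowerSeries k, ∀ d e, R d e =
    if s(d, e) = s(i, i) then ri else if s(d, e) = s(j, j) then rj else
      if s(d, e) = s(a, b) then z else P.S d e := ⟨_, fun _ _ => rfl⟩
  have Rii : R i i = ri := by simp [hR]
  have Rjj : R j j = rj := by simp [hR, hab, hab.symm, hij.symm]
  have Rab : R a b = z := by simp [hR, hab, hab.symm, hia.symm, hja.symm]
  have Rba : R b a = z := by simp [hR, hab, hab.symm, hib.symm, hjb.symm]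
  have Rij : R i j = P.S i j := by simp [hR, hab, hab.symm, hij, hij.symm, hia, hib]
  have Rji : R j i = P.S i j := by simp [hR, hab, hab.symm, hij, hij.symm, hja, hjb, P.S_symm hi hj]
  have Ria : R i a = P.S i a := by simp [hR, hab, hab.symm, hij, hia.symm, hia, hib]
  have Rai : R a i = P.S i a := by simp [hR, hab, hab.symm, hij, hia.symm, hja.symm, hib, P.S_symm hi ha]
  have Rib : R i b = P.S i b := by simp [hR, hab, hab.symm, hij, hib.symm, hia, hib]
  have Rbi : R b i = P.S i b := by simp [hR, hab, hab.symm, hij, hib.symm, hjb.symm, hia, P.S_symm hi hb]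
  have Rja : R j a = P.S j a := by simp [hR, hab, hab.symm, hij.symm, hja.symm, hja, hjb]
  have Raj : R a j = P.S j a := by simp [hR, hab, hab.symm, hia.symm, hja.symm, hjb, P.S_symm hj ha]
  have Rjb : R j b = P.S j b := by simp [hR, hab, hab.symm, hij.symm, hjb.symm, hja, hjb]
  have Rbj : R b j = P.S j b := by simp [hR, hab, hab.symm, hib.symm, hjb.symm, hja, P.S_symm hj hb]
  have Raa : R a a = P.S a a := by simp [hR, hab, hab.symm, hia.symm, hja.symm, hab]
  have Rbb : R b b = P.S b b := by simp [hR, hab, hab.symm, hib.symm, hjb.symm, hab.symm]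
  obtain ⟨ρ, hρ⟩ : ∃ ρ : Fin n → PowerSeries k, ∀ d, ρ d =
    if d = i then P.S a a * P.S b b - z ^ 2 else if d = j then 0 else
      if d = a then -(P.S b b * P.S i a - z * P.S i b) else -(P.S a a * P.S i b - z * P.S i a) :=
        ⟨_, fun _ => rfl⟩
  obtain ⟨ρ', hρ'⟩ : ∃ ρ : Fin n → PowerSeries k, ∀ d, ρ d =
    if d = i then 0 else if d = j then P.S a a * P.S b b - z ^ 2 else
      if d = a then -(P.S b b * P.S j a - z * P.S j b) else -(P.S a a * P.S j b - z * P.S j a) :=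
        ⟨_, fun _ => rfl⟩
  have a1 : ρ i = P.S a a * P.S b b - z ^ 2 := by simp [hρ]
  have a2 : ρ j = 0 := by simp [hρ, hij.symm]
  have a3 : ρ a = -(P.S b b * P.S i a - z * P.S i b) := by simp [hρ, hia.symm, hja.symm]
  have a4 : ρ b = -(P.S a a * P.S i b - z * P.S i a) := by
    simp [hρ, hib.symm, hjb.symm, hab.symm]
  have b1 : ρ' i = 0 := by simp [hρ']
  have b2 : ρ' j = P.S a a * P.S b b - z ^ 2 := by simp [hρ', hij.symm]
  have b3 : ρ' a = -(P.S b b * P.S j a - z * P.S j b) := by simp [hρ', hia.symm, hja.symm]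
  have b4 : ρ' b = -(P.S a a * P.S j b - z * P.S j a) := by
    simp [hρ', hib.symm, hjb.symm, hab.symm]
  have hsum : ∀ f : Fin n → PowerSeries k, ∑ e ∈ P.D, f e = f i + f j + f a + f b := by
    intro f
    rw [hD, Finset.sum_insert (by simp [hij, hib, hia]), Finset.sum_insert (by simp [hjb, hja]),
      Finset.sum_insert (by simp [hab]), Finset.sum_singleton]
    ring
  have hcase : ∀ d ∈ P.D, d = i ∨ d = j ∨ d = a ∨ d = b := by
    intro d hd; simpa [hD] using hd
  refine P.good_of R ?_ ?_ ?_ ρ ρ' ?_ ?_ i j hi hj ?_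
  · intro d hd e he
    rcases hcase d hd with rfl | rfl | rfl | rfl <;>
      rcases hcase e he with rfl | rfl | rfl | rfl <;>
      simp only [Rij, Rji, Rib, Rbi, Rjb, Rbj, Ria, Rai, Rja, Raj, Rab, Rba]
  · intro d hd e he hde
    rw [hF] at hde
    simp only [Set.mem_insert_iff, Set.mem_singleton_iff, not_or] at hde
    rw [hR, if_neg hde.1, if_neg hde.2.1, if_neg hde.2.2]
  · intro d hd e he hde
    have hde' := hde
    rw [hF] at hde
    simp only [Set.mem_insert_iff, Set.mem_singleton_iff] at hde
    rcases hde with h | h | h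
    · rcases Sym2.eq_iff.1 h with ⟨rfl, rfl⟩ | ⟨rfl, rfl⟩ <;>
      · rw [Rii, P.c_diag]; exact ⟨ri2, P.S_diag_mem hi (by simp [hF])⟩
    · rcases Sym2.eq_iff.1 h with ⟨rfl, rfl⟩ | ⟨rfl, rfl⟩ <;>
      · rw [Rjj, P.c_diag]; exact ⟨rj2, P.S_diag_mem hj (by simp [hF])⟩
    · rw [h, hc]
      rcases Sym2.eq_iff.1 h with ⟨rfl, rfl⟩ | ⟨rfl, rfl⟩
      · rw [Rab]; exact ⟨z2, h6⟩
      · rw [Rba, P.S_symm hd he]; exact ⟨z2, h6⟩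
  · intro d hd
    rw [hsum, a1, a2, a3, a4]
    rcases hcase d hd with rfl | rfl | rfl | rfl
    · rw [Rii, Rij, Rib, Ria]; linear_combination ri1
    · rw [Rji, Rjj, Rjb, Rja]; linear_combination hz
    · rw [Rai, Raj, Raa, Rab]; ring
    · rw [Rbi, Rbj, Rba, Rbb]; ring
  · intro d hd
    rw [hsum, b1, b2, b3, b4]
    rcases hcase d hd with rfl | rfl | rfl | rfl
    · rw [Rii, Rij, Rib, Ria]; linear_combination hz
    · rw [Rji, Rjj, Rjb, Rja]; linear_combination rj1
    · rw [Rai, Raj, Raa, Rab]; ring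
    · rw [Rbi, Rbj, Rba, Rbb]; ring
  · rw [a1, b2, b1, mul_zero]
    exact mul_ne_zero hΔ.ne_zero hΔ.ne_zero

end SD


/-- Data independent of the vanishing set. -/
structure BD (k : Type*) [Field k] (n : ℕ) where
  /-- the graph -/
  G : SimpleGraph (Fin n)
  /-- the forest -/
  T : SimpleGraph (Fin n)
  /-- a large number -/
  N : ℕ
  /-- another number -/
  M : ℕ
  hTG : T ≤ G
  hT : T.IsAcyclic
  hspan : ∀ u v : Fin n, T.Reachable u v ↔ G.Reachable u v
  hN : n + 2 ≤ N
  /-- generic constants -/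
  cs : Sym2 (Fin n) → k
  hcs : ∀ e, cs e ≠ 0

namespace BD
variable {k : Type*} [Field k] {n : ℕ} (B : BD k n)

/-- The conclusion for a vanishing set. -/
def Good (F : Set (Sym2 (Fin n))) : Prop := ∃ g : Sym2 (Fin n) → PowerSeries k,
      (∀ e, PowerSeries.constantCoeff (g e) = if e ∈ F then 0 else B.cs e) ∧
      ∀ f f' : Fin (n - 1) → Fin n, Function.Injective f → Function.Injective f' →
      ((Matrix.of fun i j => PowerSeries.X ^ (ecost B.G B.T B.N B.M) s(i, j) *
        g s(i, j)).submatrix f f').det = 0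

theorem exists_SD (F : Set (Sym2 (Fin n))) (D : Finset (Fin n))
    (hF : ∀ r q, s(r, q) ∈ F → r ∈ D) :
    ∃ P : SD k n, P.T = B.T ∧ P.N = B.N ∧ P.F = F ∧ P.D = D ∧ (P.Good → B.Good F) := by
  obtain ⟨u, hu1, hu2⟩ := solve_lemma (baseX B.cs (ecost B.G B.T B.N B.M) F) D (by
    intro r q hrq
    unfold baseX
    split_ifs
    · simp
    · have := ecost_pos B.G B.T B.N B.M hrq
      rw [map_mul, map_pow, PowerSeries.constantCoeff_X, zero_pow (by omega), mul_zero]) (by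
    intro r hr
    unfold baseX
    rw [if_neg (fun h => hr (hF _ _ h)), ecost_diag]
    simpa using B.hcs _)
  exact ⟨⟨B.G, B.T, B.N, B.M, B.hTG, B.hT, B.hspan, B.hN, B.cs, B.hcs, F, D, hF, u, hu1, hu2⟩,
    rfl, rfl, rfl, rfl, fun h => h⟩

end BD

theorem walk_edge_ne_diag {n : ℕ} {T : SimpleGraph (Fin n)} {a b : Fin n} (p : T.Walk a b)
    {x : Fin n} : s(x, x) ∉ p.edges := by
  intro h
  have := p.adj_of_mem_edges h
  exact this.ne rfl

namespace BD
variable {k : Type*} [Field k] {n : ℕ} (B : BD k n)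

theorem good_far {i j : Fin n} (h : ¬ B.T.Reachable i j) :
    B.Good {s(i, i), s(j, j), s(i, j)} := by
  have hij : i ≠ j := by rintro rfl; exact h (SimpleGraph.Reachable.refl _)
  obtain ⟨P, hT, hN, hF, hD, hg⟩ := B.exists_SD {s(i, i), s(j, j), s(i, j)} {i, j} (by
    intro r q h
    simp at h ⊢
    tauto)
  apply hg
  exact P.good_B hij hD hF (P.S_far_mem (by simp [hD]) (by simp [hD]) (by rwa [hT]) (by simp [hF]))

theorem ord_A (P : SD k n) {i j l : Fin n} (hij : i ≠ j) (hD : P.D = {i, j, l})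
    (hF : P.F = {s(i, i), s(j, j), s(l, l)})
    (h : ¬ (P.T.Reachable i l ∧ P.T.Reachable l j ∧
      P.T.dist i j = P.T.dist i l + P.T.dist l j)) :
    HasOrd (P.S i j) (if P.T.Reachable i j then P.T.dist i j else P.M + P.N + 1) := by
  have hi : i ∈ P.D := by simp [hD]
  have hj : j ∈ P.D := by simp [hD]
  split_ifs with hr
  · obtain ⟨p, hp, hl⟩ := hr.exists_path_of_dist
    refine P.S_path hi hj p hp ?_ ?_ hij
    · intro x hx hxi hxj hxD
      have : x = l := by
        rw [hD] at hxD
        simp at hxD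
        tauto
      subst this
      apply h
      refine ⟨(p.takeUntil x hx).reachable, (p.dropUntil x hx).reachable, ?_⟩
      rw [SD.dist_path P.hT p hp, SD.dist_path P.hT _ (hp.takeUntil hx),
        SD.dist_path P.hT _ (hp.dropUntil hx), ← SimpleGraph.Walk.length_append,
        SimpleGraph.Walk.take_spec]
    · intro x hx hxF
      rw [hF] at hxF
      simp only [Set.mem_insert_iff, Set.mem_singleton_iff] at hxF
      rcases hxF with rfl | rfl | rfl <;> exact walk_edge_ne_diag p hx
  · refine P.S_far hi hj hr ?_
    rw [hF]
    simp only [Set.mem_insert_iff, Set.mem_singleton_iff, Sym2.eq_iff]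
    rintro (h | h | h) <;> grind

/-- betweenness in the forest -/
def Btw (T : SimpleGraph (Fin n)) (i l j : Fin n) : Prop :=
  T.Reachable i l ∧ T.Reachable l j ∧ T.dist i j = T.dist i l + T.dist l j

theorem Btw.symm {T : SimpleGraph (Fin n)} {i l j : Fin n} (h : Btw T i l j) : Btw T j l i := by
  refine ⟨h.2.1.symm, h.1.symm, ?_⟩
  have := h.2.2
  rw [SimpleGraph.dist_comm, this, SimpleGraph.dist_comm (u := j), SimpleGraph.dist_comm (u := l) (v := i)]
  omega

theorem good_tri {i j l : Fin n} (hij : i ≠ j) (hil : i ≠ l) (hjl : j ≠ l)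
    (h1 : ¬ Btw B.T i l j) (h2 : ¬ Btw B.T i j l) (h3 : ¬ Btw B.T j i l) :
    B.Good {s(i, i), s(j, j), s(l, l)} := by
  obtain ⟨P, hT, hN, hF, hD, hg⟩ := B.exists_SD {s(i, i), s(j, j), s(l, l)} {i, j, l} (by
    intro r q h
    simp at h ⊢
    tauto)
  apply hg
  have o1 := ord_A P hij hD hF (by rw [hT]; exact h1)
  have o2 := ord_A P hil (l := j) (by rw [hD]; ext; simp; tauto) (by rw [hF]; ext; simp; tauto)
    (by rw [hT]; exact h2)
  have o3 := ord_A P hjl (l := i) (by rw [hD]; ext; simp; tauto) (by rw [hF]; ext; simp; tauto)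
    (by rw [hT]; exact h3)
  rw [← hT] at h1 h2 h3
  have c1 := SimpleGraph.dist_comm (G := P.T) (u := i) (v := j)
  have c2 := SimpleGraph.dist_comm (G := P.T) (u := i) (v := l)
  have c3 := SimpleGraph.dist_comm (G := P.T) (u := j) (v := l)
  have hPN := P.hN
  have r12 : P.T.Reachable i j → P.T.Reachable i l → P.T.Reachable j l := fun a b => a.symm.trans b
  have r13 : P.T.Reachable i j → P.T.Reachable j l → P.T.Reachable i l := fun a b => a.trans b
  have r23 : P.T.Reachable i l → P.T.Reachable j l → P.T.Reachable i j := fun a b => a.trans b.symm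
  have d1 : P.T.Reachable i j → P.T.dist i j < n ∧ 0 < P.T.dist i j :=
    fun h => ⟨dist_lt_card _ h, h.pos_dist_of_ne hij⟩
  have d2 : P.T.Reachable i l → P.T.dist i l < n ∧ 0 < P.T.dist i l :=
    fun h => ⟨dist_lt_card _ h, h.pos_dist_of_ne hil⟩
  have d3 : P.T.Reachable j l → P.T.dist j l < n ∧ 0 < P.T.dist j l :=
    fun h => ⟨dist_lt_card _ h, h.pos_dist_of_ne hjl⟩
  by_cases a1 : P.T.Reachable i j
  · by_cases a2 : P.T.Reachable i l
    · have a3 := r12 a1 a2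
      have t1 := a2.dist_triangle_left j
      have t2 := a1.dist_triangle_left l
      have t3 := a1.symm.dist_triangle_left l
      have n1 : P.T.dist i j ≠ P.T.dist i l + P.T.dist l j := fun h => h1 ⟨a2, a3.symm, h⟩
      have n2 : P.T.dist i l ≠ P.T.dist i j + P.T.dist j l := fun h => h2 ⟨a1, a3, h⟩
      have n3 : P.T.dist j l ≠ P.T.dist j i + P.T.dist i l := fun h => h3 ⟨a1.symm, a2, h⟩
      rw [if_pos a1] at o1
      rw [if_pos a2] at o2
      rw [if_pos a3] at o3
      exact P.good_A hij hil hjl hD hF o1 o2 o3 (by omega) (by omega) (by omega)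
    · have a3 : ¬ P.T.Reachable j l := fun h => a2 (r13 a1 h)
      have := d1 a1
      rw [if_pos a1] at o1
      rw [if_neg a2] at o2
      rw [if_neg a3] at o3
      exact P.good_A hij hil hjl hD hF o1 o2 o3 (by omega) (by omega) (by omega)
  · rw [if_neg a1] at o1
    by_cases a2 : P.T.Reachable i l
    · have a3 : ¬ P.T.Reachable j l := fun h => a1 (r23 a2 h)
      have := d2 a2
      rw [if_pos a2] at o2
      rw [if_neg a3] at o3
      exact P.good_A hij hil hjl hD hF o1 o2 o3 (by omega) (by omega) (by omega)
    · rw [if_neg a2] at o2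
      by_cases a3 : P.T.Reachable j l
      · have := d3 a3
        rw [if_pos a3] at o3
        exact P.good_A hij hil hjl hD hF o1 o2 o3 (by omega) (by omega) (by omega)
      · rw [if_neg a3] at o3
        exact P.good_A hij hil hjl hD hF o1 o2 o3 (by omega) (by omega) (by omega)

end BD


namespace BD
variable {k : Type*} [Field k] {n : ℕ} (B : BD k n)

/-- the side of an edge of a forest -/
theorem exists_side {T : SimpleGraph (Fin n)} (hT : T.IsAcyclic) {i a b j : Fin n}
    (p1 : T.Walk i a) (h : T.Adj a b) (p2 : T.Walk b j)
    (hp : (p1.append (SimpleGraph.Walk.cons h p2)).IsPath) :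
    p1.IsPath ∧ p2.IsPath ∧ (∀ x ∈ p1.support, x ∉ p2.support) ∧
    ∃ U : Set (Fin n), (∀ x y, x ∈ U → y ∉ U → T.Adj x y → x = a ∧ y = b) ∧
      i ∈ U ∧ a ∈ U ∧ b ∉ U ∧ j ∉ U := by
  have hp1 : p1.IsPath := hp.of_append_left
  have hp2 : (SimpleGraph.Walk.cons h p2).IsPath := hp.of_append_right
  rw [SimpleGraph.Walk.cons_isPath_iff] at hp2
  have hd : ∀ x ∈ p1.support, x ∉ p2.support := by
    have := hp.support_nodup
    rw [SimpleGraph.Walk.support_append] at this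
    simp only [SimpleGraph.Walk.support_cons, List.tail_cons] at this
    intro x hx hx'
    exact (List.disjoint_of_nodup_append this) hx hx'
  refine ⟨hp1, hp2.1, hd, ?_⟩
  have e1 : s(a, b) ∉ p1.edges := fun h' =>
    hd b (p1.snd_mem_support_of_mem_edges h') p2.start_mem_support
  have e2 : s(a, b) ∉ p2.edges := fun h' =>
    hd a p1.end_mem_support (p2.fst_mem_support_of_mem_edges h')
  have hbr : ¬ (T.deleteEdges {s(a, b)}).Reachable a b := by
    have := SimpleGraph.isAcyclic_iff_forall_adj_isBridge.1 hT h
    rw [SimpleGraph.isBridge_iff] at this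
    exact this
  have q1 : (T.deleteEdges {s(a, b)}).Reachable i a :=
    (p1.toDeleteEdges {s(a, b)} (by intro e he he'; rw [Set.mem_singleton_iff] at he'; exact e1 (he' ▸ he))).reachable
  have q2 : (T.deleteEdges {s(a, b)}).Reachable b j :=
    (p2.toDeleteEdges {s(a, b)} (by intro e he he'; rw [Set.mem_singleton_iff] at he'; exact e2 (he' ▸ he))).reachable
  refine ⟨{x | (T.deleteEdges {s(a, b)}).Reachable a x}, ?_, q1.symm,
    SimpleGraph.Reachable.refl _, hbr, fun h' => hbr (SimpleGraph.Reachable.trans h' q2.symm)⟩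
  intro x y hx hy hxy
  by_cases he : s(x, y) = s(a, b)
  · rcases Sym2.eq_iff.1 he with h' | ⟨rfl, rfl⟩
    · exact h'
    · exact absurd (SimpleGraph.Reachable.refl _) hy
  · exact absurd (SimpleGraph.Reachable.trans hx (SimpleGraph.Adj.reachable
      (by rw [SimpleGraph.deleteEdges_adj]; exact ⟨hxy, he⟩))) hy

theorem good_edge3 {i b j : Fin n} (h : B.T.Adj i b) (p2 : B.T.Walk b j) (hbj : b ≠ j)
    (hp : ((SimpleGraph.Walk.nil : B.T.Walk i i).append (SimpleGraph.Walk.cons h p2)).IsPath) :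
    B.Good {s(i, i), s(j, j), s(i, b)} := by
  obtain ⟨-, hp2, hd, U, hU, hiU, -, hbU, hjU⟩ := exists_side B.hT _ h p2 hp
  have hij : i ≠ j := by rintro rfl; exact hjU hiU
  obtain ⟨P, hT, hN, hF, hD, hg⟩ := B.exists_SD {s(i, i), s(j, j), s(i, b)} {i, j, b} (by
    intro r q h
    simp at h ⊢
    tauto)
  apply hg
  rw [← hT] at hU
  have hi : i ∈ P.D := by simp [hD]
  have hj : j ∈ P.D := by simp [hD]
  have hb : b ∈ P.D := by simp [hD]
  have heF : s(i, b) ∈ P.F := by simp [hF]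
  have hPN := P.hN
  have s1 := P.S_cross U i b hi hb heF hU hj hi hjU hiU
  have s2 := P.S_cross U i b hi hb heF hU hb hi hbU hiU
  rw [P.S_symm hj hi] at s1
  rw [P.S_symm hb hi] at s2
  have hdist : P.T.dist b j < n := by rw [hT]; exact dist_lt_card _ p2.reachable
  refine P.good_C3 hij h.ne hbj.symm hD hF (ecost_edge _ _ _ _ (by rw [hT]; exact h))
    (p := P.T.dist b j) (by rw [hT]; exact p2.reachable.pos_dist_of_ne hbj) ?_
    (pow_dvd_le s1 (by omega)) (pow_dvd_le s2 (by omega))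
  have : ∃ q : P.T.Walk b j, q.IsPath ∧ q.support = p2.support := by
    rw [hT]; exact ⟨p2, hp2, rfl⟩
  obtain ⟨q, hq, hqs⟩ := this
  rw [← hqs] at hd
  refine P.S_path hb hj q hq ?_ ?_ hbj
  · intro x hx hxb hxj hxD
    rw [hD] at hxD
    simp at hxD
    have : x = i := by tauto
    subst this
    exact hd x (by simp) hx
  · intro x hx hxF
    rw [hF] at hxF
    simp only [Set.mem_insert_iff, Set.mem_singleton_iff] at hxF
    rcases hxF with rfl | rfl | rfl
    · exact walk_edge_ne_diag q hx
    · exact walk_edge_ne_diag q hx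
    · exact hd i (by simp) (q.fst_mem_support_of_mem_edges hx)

theorem good_edge {i a b j : Fin n} (p1 : B.T.Walk i a) (h : B.T.Adj a b) (p2 : B.T.Walk b j)
    (hp : (p1.append (SimpleGraph.Walk.cons h p2)).IsPath) :
    B.Good {s(i, i), s(j, j), s(a, b)} := by
  by_cases hia : i = a
  · subst hia
    have hp1 : p1 = SimpleGraph.Walk.nil := by
      have := hp.of_append_left
      exact (SimpleGraph.Walk.isPath_iff_eq_nil).1 this
    subst hp1
    by_cases hbj : b = j
    · subst hbj
      obtain ⟨-, hp2, hd, U, hU, hiU, -, hbU, -⟩ := exists_side B.hT _ h p2 hp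
      obtain ⟨P, hT, hN, hF, hD, hg⟩ := B.exists_SD {s(i, i), s(b, b), s(i, b)} {i, b} (by
        intro r q h
        simp at h ⊢
        tauto)
      apply hg
      rw [← hT] at hU
      have hi : i ∈ P.D := by simp [hD]
      have hb : b ∈ P.D := by simp [hD]
      have hPN := P.hN
      have s2 := P.S_cross U i b hi hb (by simp [hF]) hU hb hi hbU hiU
      rw [P.S_symm hb hi] at s2
      refine P.good_B h.ne hD hF (pow_dvd_le s2 ?_)
      have : P.c s(i, b) = 1 := ecost_edge _ _ _ _ (by rw [hT]; exact h)
      omega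
    · exact B.good_edge3 h p2 hbj hp
  by_cases hbj : b = j
  · subst hbj
    have hp2 : p2 = SimpleGraph.Walk.nil := by
      have := hp.of_append_right
      rw [SimpleGraph.Walk.cons_isPath_iff] at this
      exact (SimpleGraph.Walk.isPath_iff_eq_nil).1 this.1
    subst hp2
    have := B.good_edge3 h.symm p1.reverse (Ne.symm hia) (by
      have := hp.reverse
      rw [SimpleGraph.Walk.reverse_append] at this
      simpa using this)
    have e : ({s(i, i), s(b, b), s(a, b)} : Set (Sym2 (Fin n))) = {s(b, b), s(i, i), s(b, a)} := by
      rw [Sym2.eq_swap (a := a), Set.insert_comm]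
    rw [e]
    exact this
  obtain ⟨hp1, hp2, hd, U, hU, hiU, haU, hbU, hjU⟩ := exists_side B.hT p1 h p2 hp
  have hij : i ≠ j := by rintro rfl; exact hjU hiU
  have hib : i ≠ b := by rintro rfl; exact hbU hiU
  have hja : j ≠ a := by rintro rfl; exact hjU haU
  obtain ⟨P, hT, hN, hF, hD, hg⟩ := B.exists_SD {s(i, i), s(j, j), s(a, b)} {i, j, a, b} (by
    intro r q h
    simp at h ⊢
    tauto)
  apply hg
  rw [← hT] at hU
  have hi : i ∈ P.D := by simp [hD]
  have hj : j ∈ P.D := by simp [hD]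
  have ha : a ∈ P.D := by simp [hD]
  have hb : b ∈ P.D := by simp [hD]
  have heF : s(a, b) ∈ P.F := by simp [hF]
  have hPN := P.hN
  have s1 := P.S_cross U a b ha hb heF hU hj hi hjU hiU
  have s2 := P.S_cross U a b ha hb heF hU hb hi hbU hiU
  have s3 := P.S_cross U a b ha hb heF hU hj ha hjU haU
  have s4 := P.S_cross U a b ha hb heF hU hb ha hbU haU
  rw [P.S_symm hj hi] at s1
  rw [P.S_symm hb hi] at s2
  rw [P.S_symm hb ha] at s4
  have hlen := hp.length_lt
  rw [SimpleGraph.Walk.length_append, SimpleGraph.Walk.length_cons, Fintype.card_fin] at hlen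
  have hd1 : P.T.dist i a = p1.length := by rw [hT]; exact SD.dist_path B.hT p1 hp1
  have hd2 : P.T.dist j b = p2.length := by
    rw [hT, SimpleGraph.dist_comm]; exact SD.dist_path B.hT p2 hp2
  have l1 : 1 ≤ P.T.dist i a := by rw [hT]; exact p1.reachable.pos_dist_of_ne hia
  have l2 : 1 ≤ P.T.dist j b := by
    rw [hT]; exact p2.reachable.symm.pos_dist_of_ne (Ne.symm hbj)
  have w1 : ∃ q : P.T.Walk i a, q.IsPath ∧ q.support = p1.support := by
    rw [hT]; exact ⟨p1, hp1, rfl⟩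
  have w2 : ∃ q : P.T.Walk b j, q.IsPath ∧ q.support = p2.support := by
    rw [hT]; exact ⟨p2, hp2, rfl⟩
  obtain ⟨q1, hq1, hqs1⟩ := w1
  obtain ⟨q2, hq2, hqs2⟩ := w2
  rw [← hqs1, ← hqs2] at hd
  refine P.good_C4 hij hia hib hja (Ne.symm hbj) h.ne hD hF
    (ecost_edge _ _ _ _ (by rw [hT]; exact h)) (p := P.T.dist i a) (p' := P.T.dist j b)
    (m := P.N + 1) l1 l2 (by omega) ?_ ?_ s1 s2 s3 (pow_dvd_le s4 (by omega))
  · refine P.S_path hi ha q1 hq1 ?_ ?_ hia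
    · intro x hx hxi hxa hxD
      rw [hD] at hxD
      simp at hxD
      have : x = j ∨ x = b := by tauto
      rcases this with rfl | rfl
      · exact hd x hx q2.end_mem_support
      · exact hd x hx q2.start_mem_support
    · intro x hx hxF
      rw [hF] at hxF
      simp only [Set.mem_insert_iff, Set.mem_singleton_iff] at hxF
      rcases hxF with rfl | rfl | rfl
      · exact walk_edge_ne_diag q1 hx
      · exact walk_edge_ne_diag q1 hx
      · exact hd b (q1.snd_mem_support_of_mem_edges hx) q2.start_mem_support
  · rw [P.S_symm hj hb, SimpleGraph.dist_comm]
    refine P.S_path hb hj q2 hq2 ?_ ?_ hbj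
    · intro x hx hxi hxa hxD
      rw [hD] at hxD
      simp at hxD
      have : x = i ∨ x = a := by tauto
      rcases this with rfl | rfl
      · exact hd x q1.start_mem_support hx
      · exact hd x q1.end_mem_support hx
    · intro x hx hxF
      rw [hF] at hxF
      simp only [Set.mem_insert_iff, Set.mem_singleton_iff] at hxF
      rcases hxF with rfl | rfl | rfl
      · exact walk_edge_ne_diag q2 hx
      · exact walk_edge_ne_diag q2 hx
      · exact hd a q1.end_mem_support (q2.fst_mem_support_of_mem_edges hx)

theorem edge_split {T : SimpleGraph (Fin n)} {i j : Fin n} (p : T.Walk i j) (e : Sym2 (Fin n))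
    (he : e ∈ p.edges) : ∃ (a b : Fin n) (p1 : T.Walk i a) (h : T.Adj a b) (p2 : T.Walk b j),
      e = s(a, b) ∧ p = p1.append (SimpleGraph.Walk.cons h p2) := by
  induction p with
  | nil => simp at he
  | @cons u v w h p ih =>
    rw [SimpleGraph.Walk.edges_cons, List.mem_cons] at he
    rcases he with rfl | he
    · exact ⟨u, v, SimpleGraph.Walk.nil, h, p, rfl, rfl⟩
    · obtain ⟨a, b, p1, h', p2, he, hp⟩ := ih he
      exact ⟨a, b, SimpleGraph.Walk.cons h p1, h', p2, he, by rw [hp]; rfl⟩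

theorem good_path {i j : Fin n} (p : B.T.Walk i j) (hp : p.IsPath) (e : Sym2 (Fin n))
    (he : e ∈ p.edges) : B.Good {s(i, i), s(j, j), e} := by
  obtain ⟨a, b, p1, h, p2, rfl, hpp⟩ := edge_split p e he
  exact B.good_edge p1 h p2 (hpp ▸ hp)

end BD


theorem coeff_kill {σ K : Type*} [Field K] (F : Set σ) (m : σ →₀ ℕ) (hm : ∀ e ∈ F, m e = 0)
    (g : MvPolynomial σ K) :
    coeff m (aeval (fun e => if e ∈ F then (0 : MvPolynomial σ K) else X e) g) = coeff m g := by
  induction g using MvPolynomial.induction_on' with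
  | monomial u a =>
    rw [aeval_monomial]
    by_cases hu : ∀ e ∈ F, u e = 0
    · have : (u.prod fun i k => (if i ∈ F then (0 : MvPolynomial σ K) else X i) ^ k) =
          u.prod fun i k => X i ^ k := by
        apply Finsupp.prod_congr
        intro x hx
        rw [if_neg]
        intro hxF
        exact (Finsupp.mem_support_iff.1 hx) (hu x hxF)
      rw [this, algebraMap_eq, ← monomial_eq]
    · push Not at hu
      obtain ⟨e, he, hue⟩ := hu
      have : (u.prod fun i k => (if i ∈ F then (0 : MvPolynomial σ K) else X i) ^ k) = 0 := by
        rw [Finsupp.prod]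
        apply Finset.prod_eq_zero (Finsupp.mem_support_iff.2 hue)
        rw [if_pos he, zero_pow hue]
      rw [this, mul_zero, coeff_zero, coeff_monomial, if_neg]
      rintro rfl
      exact hue (hm e he)
  | add p q hp hq => rw [map_add, coeff_add, coeff_add, hp, hq]

theorem meets_of_ker {σ K : Type*} [Field K] (F : Set σ) (g : MvPolynomial σ K)
    (hg : aeval (fun e => if e ∈ F then (0 : FractionRing (MvPolynomial σ K)) else
      algebraMap (MvPolynomial σ K) _ (X e)) g = 0) (m : σ →₀ ℕ) (hm : m ∈ g.support) :
    ∃ e ∈ F, m e ≠ 0 := by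
  by_contra hcon
  push Not at hcon
  have h1 : (fun e => if e ∈ F then (0 : FractionRing (MvPolynomial σ K)) else
      algebraMap (MvPolynomial σ K) _ (X e)) =
      algebraMap (MvPolynomial σ K) (FractionRing (MvPolynomial σ K)) ∘
        fun e => (if e ∈ F then (0 : MvPolynomial σ K) else X e) := by
    funext e
    simp only [Function.comp_apply]
    split_ifs <;> simp
  rw [h1, MvPolynomial.aeval_algebraMap_apply] at hg
  have h2 : aeval (fun e => if e ∈ F then (0 : MvPolynomial σ K) else X e) g = 0 :=
    (map_eq_zero_iff _ (IsFractionRing.injective (MvPolynomial σ K) _)).1 hg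
  have h3 := coeff_kill F m hcon g
  rw [h2, coeff_zero] at h3
  exact (mem_support_iff.1 hm) h3.symm

theorem prod_dvd_monomial {σ K : Type*} [Field K] (S : Finset σ) (m : σ →₀ ℕ) (c : K)
    (h : ∀ e ∈ S, m e ≠ 0) : (∏ e ∈ S, (X e : MvPolynomial σ K)) ∣ monomial m c := by
  have h1 : (∏ e ∈ S, (X e : MvPolynomial σ K)) = monomial (∑ e ∈ S, Finsupp.single e 1) 1 := by
    rw [monomial_sum_one]
    rfl
  rw [h1]
  refine ⟨monomial (m - ∑ e ∈ S, Finsupp.single e 1) c, ?_⟩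
  rw [monomial_mul, one_mul, add_tsub_cancel_of_le]
  intro x
  rw [Finsupp.finsetSum_apply]
  by_cases hx : x ∈ S
  · rw [Finset.sum_eq_single x]
    · rw [Finsupp.single_eq_same]
      exact Nat.one_le_iff_ne_zero.2 (h x hx)
    · intro b _ hb
      rw [Finsupp.single_eq_of_ne hb.symm]
    · exact fun h => absurd hx h
  · rw [Finset.sum_eq_zero]
    · exact Nat.zero_le _
    · intro b hb
      rw [Finsupp.single_eq_of_ne]
      rintro rfl
      exact hx hb

theorem diag_inj {n : ℕ} : Function.Injective (fun j : Fin n => s(j, j)) := by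
  intro a b h
  simpa using h

theorem diag_prod {K : Type*} [Field K] {n : ℕ} (S : Finset (Fin n)) :
    (∏ j ∈ S, (X s(j, j) : SymPolyRing K n)) =
      ∏ e ∈ S.image (fun j => s(j, j)), (X e : SymPolyRing K n) := by
  rw [Finset.prod_image (fun a _ b _ h => diag_inj h)]

theorem Btw_mem {n : ℕ} {T : SimpleGraph (Fin n)} (hT : T.IsAcyclic) {i l j : Fin n}
    (h : BD.Btw T i l j) (p : T.Walk i j) (hp : p.IsPath) : l ∈ p.support := by
  obtain ⟨h1, h2, h3⟩ := h
  obtain ⟨q1, _, l1⟩ := h1.exists_path_of_dist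
  obtain ⟨q2, _, l2⟩ := h2.exists_path_of_dist
  have hq : (q1.append q2).IsPath := by
    apply SimpleGraph.Walk.isPath_of_length_eq_dist
    rw [SimpleGraph.Walk.length_append]; omega
  have := hT.path_unique ⟨p, hp⟩ ⟨_, hq⟩
  simp only [Subtype.mk.injEq] at this
  rw [this, SimpleGraph.Walk.mem_support_append_iff]
  exact Or.inl q1.end_mem_support

theorem comb_lemma {K : Type*} [Field K] {n : ℕ} (hn : 2 ≤ n) (T : SimpleGraph (Fin n))
    (hT : T.IsAcyclic) (m : Sym2 (Fin n) →₀ ℕ) (c : K)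
    (hA : ∀ i j l, i ≠ j → i ≠ l → j ≠ l → m s(i, i) = 0 → m s(j, j) = 0 → m s(l, l) = 0 →
      BD.Btw T i l j ∨ BD.Btw T i j l ∨ BD.Btw T j i l)
    (hB : ∀ i j, ¬ T.Reachable i j → m s(i, i) = 0 → m s(j, j) = 0 → m s(i, j) ≠ 0)
    (hC : ∀ i j (p : T.Walk i j), p.IsPath → m s(i, i) = 0 → m s(j, j) = 0 →
      ∀ e ∈ p.edges, m e ≠ 0) : monomial m c ∈ forestIdeal K n T := by
  by_cases h1 : ∃ i : Fin n, ∀ j, m s(j, j) = 0 → j = i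
  · obtain ⟨i, hi⟩ := h1
    refine Ideal.mem_of_dvd _ ?_ (Ideal.subset_span (Or.inl ⟨i, rfl⟩))
    rw [diag_prod]
    apply prod_dvd_monomial
    intro e he
    obtain ⟨j, hj, rfl⟩ := Finset.mem_image.1 he
    exact fun h => (Finset.mem_erase.1 hj).1 (hi j h)
  by_cases h2 : ∃ i j : Fin n, m s(i, i) = 0 ∧ m s(j, j) = 0 ∧ ¬ T.Reachable i j
  · have h2' : ∃ i j : Fin n, i < j ∧ m s(i, i) = 0 ∧ m s(j, j) = 0 ∧ ¬ T.Reachable i j := by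
      obtain ⟨i, j, hi, hj, hr⟩ := h2
      rcases lt_trichotomy i j with h | rfl | h
      · exact ⟨i, j, h, hi, hj, hr⟩
      · exact absurd (SimpleGraph.Reachable.refl _) hr
      · exact ⟨j, i, h, hj, hi, fun h => hr h.symm⟩
    obtain ⟨i, j, hlt, hi, hj, hr⟩ := h2'
    refine Ideal.mem_of_dvd _ ?_ (Ideal.subset_span (Or.inr (Or.inl ⟨i, j, hlt, hr, rfl⟩)))
    rw [diag_prod, mul_comm, ← Finset.prod_insert (f := fun e => (X e : SymPolyRing K n))]
    · apply prod_dvd_monomial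
      intro e he
      rcases Finset.mem_insert.1 he with rfl | he
      · exact hB i j hr hi hj
      · obtain ⟨l, hl, rfl⟩ := Finset.mem_image.1 he
        simp only [Finset.mem_erase, Finset.mem_univ, and_true] at hl
        intro hl0
        rcases hA i j l hlt.ne hl.2.symm hl.1.symm hi hj hl0 with h | h | h
        · exact hr (h.1.trans h.2.1)
        · exact hr h.1
        · exact hr h.1.symm
    · intro h
      obtain ⟨l, hl, h⟩ := Finset.mem_image.1 h
      rcases Sym2.eq_iff.1 h with ⟨h', h''⟩ | ⟨h', h''⟩
      · exact hlt.ne (h'.symm.trans h'')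
      · exact hlt.ne (h''.symm.trans h')
  push Not at h1 h2
  obtain ⟨i0, hi0, -⟩ := h1 ⟨0, by omega⟩
  obtain ⟨j0, hj0, hij0⟩ := h1 i0
  obtain ⟨⟨i, j⟩, hmem, hmax⟩ := Finset.exists_max_image
    ((Finset.univ : Finset (Fin n × Fin n)).filter (fun x => m s(x.1, x.1) = 0 ∧ m s(x.2, x.2) = 0))
    (fun x => T.dist x.1 x.2) ⟨(i0, j0), by simp [hi0, hj0]⟩
  simp only [Finset.mem_filter, Finset.mem_univ, true_and, Prod.forall] at hmem hmax
  obtain ⟨hi, hj⟩ := hmem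
  have hij : i ≠ j := by
    rintro rfl
    have a1 := hmax i0 j0 ⟨hi0, hj0⟩
    have a2 := (h2 i0 j0 hi0 hj0).pos_dist_of_ne hij0.symm
    simp only [SimpleGraph.dist_self] at a1
    omega
  obtain ⟨p, hp, -⟩ := (h2 i j hi hj).exists_path_of_dist
  refine Ideal.mem_of_dvd _ ?_ (Ideal.subset_span (Or.inr (Or.inr ⟨i, j, p, hp, hij, rfl⟩)))
  unfold pathGenerator
  rw [diag_prod, ← List.prod_toFinset _ hp.isTrail.edges_nodup, ← Finset.prod_union]
  · apply prod_dvd_monomial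
    intro e he
    rcases Finset.mem_union.1 he with he | he
    · obtain ⟨l, hl, rfl⟩ := Finset.mem_image.1 he
      simp only [Finset.mem_sdiff, Finset.mem_univ, true_and, List.mem_toFinset] at hl
      intro hl0
      have hli : i ≠ l := by rintro rfl; exact hl p.start_mem_support
      have hlj : j ≠ l := by rintro rfl; exact hl p.end_mem_support
      rcases hA i j l hij hli hlj hi hj hl0 with h | h | h
      · exact hl (Btw_mem hT h p hp)
      · have a1 := hmax i l ⟨hi, hl0⟩
        have a2 := h.2.1.pos_dist_of_ne hlj
        have a3 := h.2.2
        omega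
      · have a1 := hmax j l ⟨hj, hl0⟩
        have a2 := h.2.1.pos_dist_of_ne hli
        have a3 := h.2.2
        rw [SimpleGraph.dist_comm (u := j) (v := i)] at a3
        omega
    · exact hC i j p hp hi hj e (List.mem_toFinset.1 he)
  · rw [Finset.disjoint_left]
    intro e he he'
    obtain ⟨l, hl, rfl⟩ := Finset.mem_image.1 he
    exact walk_edge_ne_diag p (List.mem_toFinset.1 he')

theorem iter_le_ker {K : Type*} [Field K] {n : ℕ} (G T : SimpleGraph (Fin n))
    (hTG : T ≤ G) (hT : T.IsAcyclic)
    (hspan : ∀ u v : Fin n, T.Reachable u v ↔ G.Reachable u v) (F : Set (Sym2 (Fin n)))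
    (hF : ∀ B : BD (FractionRing (SymPolyRing K n)) n, B.T = T → B.Good F) :
    initialIdeal (diagWeight n)
        (initialIdeal (graphWeight T)
          (initialIdeal (graphWeight G) (minorsIdeal (n - 1) (genericSym K n)))) ≤
      RingHom.ker (aeval (R := K) (fun e => if e ∈ F then (0 : FractionRing (SymPolyRing K n)) else
      algebraMap (SymPolyRing K n) _ (X e))) := by
  apply initialIdeal_comb (graphWeight T) (diagWeight n) _ _ (n + 2)
  intro N hN
  apply initialIdeal_comb (graphWeight G) (fun s => N * graphWeight T s + diagWeight n s) _ _ 0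
  intro M _
  rw [initialIdeal, Ideal.span_le]
  rintro _ ⟨f, hf, -, rfl⟩
  obtain ⟨g, hg1, hg2⟩ := hF ⟨G, T, N, M, hTG, hT, hspan, hN,
    fun e => algebraMap (SymPolyRing K n) _ (X e), fun e => by
      rw [Ne, map_eq_zero_iff _ (IsFractionRing.injective (SymPolyRing K n) _)]
      exact X_ne_zero _⟩ rfl
  have := val_lemma (fun s => M * graphWeight G s + (N * graphWeight T s + diagWeight n s))
    (ecost G T N M) (2 * M + 2 * N + 2) (weight_add_ecost G T hTG N M) g hg2 f hf
  simp only [hg1] at this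
  exact this

theorem le_forest (K : Type*) [Field K] (n : ℕ) (hn : 2 ≤ n) (G T : SimpleGraph (Fin n))
    (hTG : T ≤ G) (hT : T.IsAcyclic)
    (hspan : ∀ u v : Fin n, T.Reachable u v ↔ G.Reachable u v) :
    initialIdeal (diagWeight n)
        (initialIdeal (graphWeight T)
          (initialIdeal (graphWeight G) (minorsIdeal (n - 1) (genericSym K n)))) ≤
      forestIdeal K n T := by
  intro g hg
  have key : ∀ F : Set (Sym2 (Fin n)),
      (∀ B : BD (FractionRing (SymPolyRing K n)) n, B.T = T → B.Good F) →
      ∀ m ∈ g.support, ∃ e ∈ F, m e ≠ 0 := fun F hF m hm =>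
    meets_of_ker F g (iter_le_ker G T hTG hT hspan F hF hg) m hm
  rw [g.as_sum]
  refine Ideal.sum_mem _ fun m hm => ?_
  refine comb_lemma hn T hT m _ ?_ ?_ ?_
  · intro i j l hij hil hjl hi hj hl
    by_contra hcon
    push Not at hcon
    obtain ⟨e, he, hme⟩ := key {s(i, i), s(j, j), s(l, l)} (by
      rintro B rfl
      exact B.good_tri hij hil hjl hcon.1 hcon.2.1 hcon.2.2) m hm
    simp only [Set.mem_insert_iff, Set.mem_singleton_iff] at he
    rcases he with rfl | rfl | rfl <;> exact hme (by assumption)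
  · intro i j hr hi hj
    obtain ⟨e, he, hme⟩ := key {s(i, i), s(j, j), s(i, j)} (by
      rintro B rfl
      exact B.good_far hr) m hm
    simp only [Set.mem_insert_iff, Set.mem_singleton_iff] at he
    rcases he with rfl | rfl | rfl
    · exact absurd hi hme
    · exact absurd hj hme
    · exact hme
  · intro i j p hp hi hj e' he'
    obtain ⟨e, he, hme⟩ := key {s(i, i), s(j, j), e'} (by
      rintro B rfl
      exact B.good_path p hp e' he') m hm
    simp only [Set.mem_insert_iff, Set.mem_singleton_iff] at he
    rcases he with rfl | rfl | rfl
    · exact absurd hi hme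
    · exact absurd hj hme
    · exact hme

/-- For a simple graph `G` on `[n]` and a spanning forest `T` of `G`, the iterated
initial ideal of `I_{n-1}(X)` with respect to `w_G`, then `w_T`, then `w_diag` is the
squarefree monomial ideal `I_T`; equivalently, the `(n-1)`-minors of `X` are a Gröbner
basis of `I_{n-1}(X)` with respect to the weight order `<_{T,G}`. -/
theorem initialIdeal_submaximalMinors_generic_symmetric
    (K : Type*) [Field K] (n : ℕ) (hn : 2 ≤ n) (G T : SimpleGraph (Fin n))
    (hTG : T ≤ G) (hT : T.IsAcyclic)
    (hspan : ∀ u v : Fin n, T.Reachable u v ↔ G.Reachable u v) :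
    initialIdeal (diagWeight n)
        (initialIdeal (graphWeight T)
          (initialIdeal (graphWeight G) (minorsIdeal (n - 1) (genericSym K n)))) =
      forestIdeal K n T := by
  exact le_antisymm (le_forest K n hn G T hTG hT hspan) (forest_le hn G T hTG hT hspan)
end
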